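/- arXiv:2102.01543 — 3 statements merged into one kernel-verified Lean document; each statement's English description precedes it below -/
import Mathlib

section
/- There exist absolute constants C, c > 0 such that: (i) for every sufficiently large integer N there is a set B ⊆ {1,…,N} containing no nontrivial 3-term arithmetic progression and such that the complement {1,…,N} \ B contains no arithmetic progression of length ⌈exp(C·(log N)^{3/4}·(log log N)^{1/4})⌉; (ii) consequently, for every sufficiently large integer k there exist an integer N ≥ k^{c·(log k / log log k)^{1/3}} and a set B ⊆ {1,…,N} containing no nontrivial 3-term arithmetic progression whose complement {1,…,N} \ B contains no arithmetic progression of length k. -/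
/-- `B` contains no nontrivial 3-term arithmetic progression. -/
def No3APF (B : Finset ℕ) : Prop :=
  ∀ a d : ℕ, 0 < d → a ∈ B → a + d ∈ B → a + 2 * d ∈ B → False

/-- `S` contains an arithmetic progression of length `k`
(a set `{a + j*d : 0 ≤ j < k}` with `d ≠ 0`). -/
def HasAPF (S : Finset ℕ) (k : ℕ) : Prop :=
  ∃ a d : ℕ, 0 < d ∧ ∀ j < k, a + j * d ∈ S

section boxes

lemma vb_intCast {P : ℕ} [NeZero P] (z : ℤ) (l : ℕ) (hz : z.natAbs ≤ l) :
    ((z : ZMod P).valMinAbs).natAbs ≤ l := by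
  refine le_trans ?_ hz
  apply ZMod.natAbs_min_of_le_div_two P
  · simp
  · exact ZMod.natAbs_valMinAbs_le _

lemma vb_add {P : ℕ} [NeZero P] {x y : ZMod P} {k l : ℕ} (hx : x.valMinAbs.natAbs ≤ k)
    (hy : y.valMinAbs.natAbs ≤ l) : (x + y).valMinAbs.natAbs ≤ k + l := by
  have h : x + y = ((x.valMinAbs + y.valMinAbs : ℤ) : ZMod P) := by simp
  rw [h]
  apply vb_intCast
  omega

lemma vb_neg {P : ℕ} {x : ZMod P} {k : ℕ} (hx : x.valMinAbs.natAbs ≤ k) :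
    (-x).valMinAbs.natAbs ≤ k := by
  rwa [ZMod.natAbs_valMinAbs_neg]

lemma card_vb_le (P : ℕ) [NeZero P] (l : ℕ) :
    (Finset.univ.filter (fun x : ZMod P => x.valMinAbs.natAbs ≤ l)).card ≤ 2 * l + 1 := by
  have h : (Finset.univ.filter (fun x : ZMod P => x.valMinAbs.natAbs ≤ l)).card
      ≤ (Finset.Icc (-(l : ℤ)) l).card := by
    apply Finset.card_le_card_of_injOn ZMod.valMinAbs
    · intro x hx
      simp at hx ⊢
      omega
    · exact ZMod.injective_valMinAbs.injOn
  refine h.trans ?_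
  simp
  omega

lemma le_card_vb (P : ℕ) [NeZero P] (l : ℕ) (hl : l < P) :
    l + 1 ≤ (Finset.univ.filter (fun x : ZMod P => x.valMinAbs.natAbs ≤ l)).card := by
  have h : (Finset.range (l + 1)).card ≤
      (Finset.univ.filter (fun x : ZMod P => x.valMinAbs.natAbs ≤ l)).card := by
    apply Finset.card_le_card_of_injOn (fun n : ℕ => (n : ZMod P))
    · intro x hx
      simp at hx ⊢
      have := vb_intCast (P := P) (x : ℤ) l (by simp; omega)
      simpa using this
    · intro x hx y hy hxy
      simp at hx hy hxy
      rw [ZMod.natCast_eq_natCast_iff'] at hxy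
      rwa [Nat.mod_eq_of_lt (by omega), Nat.mod_eq_of_lt (by omega)] at hxy
  simpa using h

/-- the box in `(Z/P)^D`. -/
def vbox (P D l : ℕ) [NeZero P] : Finset (Fin D → ZMod P) :=
  Fintype.piFinset (fun _ => Finset.univ.filter (fun x : ZMod P => x.valMinAbs.natAbs ≤ l))

lemma mem_vbox {P D l : ℕ} [NeZero P] (x : Fin D → ZMod P) :
    x ∈ vbox P D l ↔ ∀ i, (x i).valMinAbs.natAbs ≤ l := by
  simp [vbox]

lemma card_vbox_le (P D l : ℕ) [NeZero P] : (vbox P D l).card ≤ (2 * l + 1) ^ D := by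
  simp only [vbox, Fintype.card_piFinset, Finset.prod_const, Finset.card_univ, Fintype.card_fin]
  exact Nat.pow_le_pow_left (card_vb_le P l) _

lemma le_card_vbox (P D l : ℕ) [NeZero P] (hl : l < P) : (l + 1) ^ D ≤ (vbox P D l).card := by
  simp only [vbox, Fintype.card_piFinset, Finset.prod_const, Finset.card_univ, Fintype.card_fin]
  exact Nat.pow_le_pow_left (le_card_vb P l hl) _

end boxes

section fourier

/-- Number of representations of `b` as a sum of `m` values of `φ` on `S`. -/
noncomputable def cnt {ι : Type*} {P : ℕ} (S : Finset ι) (φ : ι → ZMod P) : ℕ → ZMod P → ℝ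
  | 0, b => if b = 0 then 1 else 0
  | m + 1, b => ∑ i ∈ S, cnt S φ m (b - φ i)

lemma cnt_nonneg {ι : Type*} {P : ℕ} (S : Finset ι) (φ : ι → ZMod P) (m : ℕ) (b : ZMod P) :
    0 ≤ cnt S φ m b := by
  induction m generalizing b with
  | zero => simp only [cnt]; split_ifs <;> norm_num
  | succ m ih => exact Finset.sum_nonneg fun i _ => ih _

lemma sum_cnt {ι : Type*} {P : ℕ} [NeZero P] (S : Finset ι) (φ : ι → ZMod P) (m : ℕ) :
    ∑ b, cnt S φ m b = (S.card : ℝ) ^ m := by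
  induction m with
  | zero => simp [cnt]
  | succ m ih =>
    simp only [cnt]
    rw [Finset.sum_comm]
    have : ∀ i ∈ S, ∑ b, cnt S φ m (b - φ i) = (S.card : ℝ) ^ m := by
      intro i _
      rw [← ih]
      exact Fintype.sum_equiv (Equiv.subRight (φ i)) _ _ (fun b => rfl)
    rw [Finset.sum_congr rfl this]
    simp
    ring

lemma pow_eq_cnt {ι : Type*} {P : ℕ} [NeZero P] (S : Finset ι) (φ : ι → ZMod P) (m : ℕ)
    (α : ZMod P) :
    (∑ i ∈ S, (ZMod.stdAddChar (α * φ i) : ℂ)) ^ m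
      = ∑ b, (cnt S φ m b : ℂ) * ZMod.stdAddChar (α * b) := by
  induction m with
  | zero =>
    simp only [cnt, pow_zero]
    rw [Finset.sum_eq_single (0 : ZMod P)]
    · simp
    · intro b _ hb; simp [hb]
    · simp
  | succ m ih =>
    rw [pow_succ, ih, Finset.sum_mul_sum, Finset.sum_comm]
    simp only [cnt, Complex.ofReal_sum, Finset.sum_mul]
    rw [Finset.sum_comm (s := Finset.univ) (t := S)]
    refine Finset.sum_congr rfl fun i _ => ?_
    refine Fintype.sum_equiv (Equiv.addRight (φ i)) _ _ (fun b => ?_)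
    simp [mul_add, AddChar.map_add_eq_mul, mul_assoc]

lemma sum_pow_eq_cnt {ι : Type*} {P : ℕ} [NeZero P] (S : Finset ι) (φ : ι → ZMod P) (m : ℕ) :
    ∑ α, (∑ i ∈ S, (ZMod.stdAddChar (α * φ i) : ℂ)) ^ m = P * (cnt S φ m 0 : ℂ) := by
  simp only [pow_eq_cnt]
  rw [Finset.sum_comm]
  simp only [← Finset.mul_sum]
  simp only [AddChar.sum_mulShift _ (ZMod.isPrimitive_stdAddChar P)]
  simp [ZMod.card, mul_comm]

/-- counting relations -/
lemma cnt_bound {P : ℕ} [Fact P.Prime] (H : Finset (ZMod P)) (Q : ℕ) (hQ : 2 ≤ Q) (hQP : Q ≤ P)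
    (m : ℕ) (b : ZMod P) :
    (H.card : ℝ) * cnt (H ×ˢ Finset.range Q ×ˢ Finset.range Q)
      (fun t => t.1 * ((t.2.1 : ZMod P) - (t.2.2 : ZMod P))) m b
      ≤ H.card * (H.card * Q) ^ m + 2 * (Q ^ 2 * H.card) ^ m := by
  induction m generalizing b with
  | zero =>
    simp only [cnt]
    have : (0:ℝ) ≤ H.card := by positivity
    split_ifs <;> simp <;> linarith
  | succ m ih =>
    set S := (H ×ˢ Finset.range Q ×ˢ Finset.range Q) with hS
    set φ : ZMod P × ℕ × ℕ → ZMod P := (fun t => t.1 * ((t.2.1 : ZMod P) - (t.2.2 : ZMod P))) with hφ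
    have hcard : (S.card : ℝ) = H.card * Q ^ 2 := by
      simp only [hS, Finset.card_product, Finset.card_range]; push_cast; ring
    have hsplit : cnt S φ (m + 1) b = ∑ c ∈ Finset.range Q, ∑ c' ∈ Finset.range Q,
        ∑ h ∈ H, cnt S φ m (b - φ (h, c, c')) := by
      simp only [cnt]
      rw [hS, Finset.sum_product_right, Finset.sum_product]
    have hH0 : (0:ℝ) ≤ H.card := by positivity
    have hQ0 : (2:ℝ) ≤ Q := by exact_mod_cast hQ
    set E : ℝ := H.card * (H.card * Q) ^ m + 2 * (Q ^ 2 * H.card) ^ m with hE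
    have hE0 : 0 ≤ E := by positivity
    have hin : ∀ c ∈ Finset.range Q, ∀ c' ∈ Finset.range Q,
        (∑ h ∈ H, cnt S φ m (b - φ (h, c, c'))) ≤
          (if c = c' then E else 0) + (Q ^ 2 * H.card) ^ m := by
      intro c hc c' hc'
      split_ifs with hcc
      · subst hcc
        have : ∀ h ∈ H, cnt S φ m (b - φ (h, c, c)) = cnt S φ m b := by
          intro h _; simp [hφ]
        rw [Finset.sum_congr rfl this]
        simp only [Finset.sum_const, nsmul_eq_mul]
        have := ih b
        have h2 : (0:ℝ) ≤ (Q ^ 2 * H.card) ^ m := by positivity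
        linarith
      · have hne : ((c : ZMod P) - c') ≠ 0 := by
          rw [sub_ne_zero]
          intro h
          rw [ZMod.natCast_eq_natCast_iff'] at h
          simp at hc hc'
          rw [Nat.mod_eq_of_lt (by omega), Nat.mod_eq_of_lt (by omega)] at h
          exact hcc h
        have hinj : Set.InjOn (fun h => b - φ (h, c, c')) (H : Set (ZMod P)) := by
          intro x _ y _ hxy
          simp only [hφ, sub_right_inj] at hxy
          exact mul_right_cancel₀ hne hxy
        rw [← Finset.sum_image (f := fun z => cnt S φ m z) hinj]
        calc _ ≤ ∑ z, cnt S φ m z :=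
              Finset.sum_le_sum_of_subset_of_nonneg (Finset.subset_univ _)
                (fun _ _ _ => cnt_nonneg _ _ _ _)
          _ = _ := by rw [sum_cnt, hcard]; ring
    have htot : cnt S φ (m + 1) b ≤ Q * E + Q ^ 2 * (Q ^ 2 * H.card) ^ m := by
      rw [hsplit]
      calc _ ≤ ∑ c ∈ Finset.range Q, ∑ c' ∈ Finset.range Q,
            ((if c = c' then E else 0) + (Q ^ 2 * H.card : ℝ) ^ m) :=
            Finset.sum_le_sum fun c hc => Finset.sum_le_sum fun c' hc' => hin c hc c' hc'
        _ = _ := by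
            simp only [Finset.sum_add_distrib, Finset.sum_ite_eq, Finset.sum_const,
              Finset.card_range, nsmul_eq_mul]
            rw [Finset.sum_congr rfl (fun c hc => if_pos hc)]
            simp
            ring
    calc (H.card : ℝ) * cnt S φ (m + 1) b
        ≤ H.card * (Q * E + Q ^ 2 * (Q ^ 2 * H.card) ^ m) := by gcongr
      _ ≤ _ := by
          rw [hE, pow_succ _ m, pow_succ _ m]
          have h3 : (0:ℝ) ≤ (Q ^ 2 * H.card) ^ m * H.card * Q := by positivity
          nlinarith [mul_le_mul_of_nonneg_left hQ0 h3]

end fourier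
section moment

lemma fejer_lower {P : ℕ} [NeZero P] (Q l : ℕ) (h : 6 * Q * l ≤ P) (x : ZMod P)
    (hx : x.valMinAbs.natAbs ≤ l) :
    (Q : ℝ) ^ 2 / 4 ≤ Complex.normSq (∑ c ∈ Finset.range Q, (ZMod.stdAddChar ((c : ZMod P) * x) : ℂ)) := by
  have hP : (0:ℝ) < P := by exact_mod_cast Nat.pos_of_ne_zero (NeZero.ne P)
  have hre : (Q : ℝ) / 2 ≤ (∑ c ∈ Finset.range Q, (ZMod.stdAddChar ((c : ZMod P) * x) : ℂ)).re := by
    rw [Complex.re_sum]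
    have : ∀ c ∈ Finset.range Q, (1 / 2 : ℝ) ≤ (ZMod.stdAddChar ((c : ZMod P) * x) : ℂ).re := by
      intro c hc
      have hcx : (c : ZMod P) * x = (((c : ℤ) * x.valMinAbs : ℤ) : ZMod P) := by simp
      rw [hcx, ZMod.stdAddChar_coe]
      have hform : (2 * Real.pi * Complex.I * (((c : ℤ) * x.valMinAbs : ℤ) : ℂ) / P : ℂ)
          = ((2 * Real.pi * (c * x.valMinAbs) / P : ℝ) : ℂ) * Complex.I := by
        push_cast; ring
      rw [hform, Complex.exp_ofReal_mul_I_re, ← Real.cos_abs, ← Real.cos_pi_div_three]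
      apply Real.cos_le_cos_of_nonneg_of_le_pi (abs_nonneg _)
      · linarith [Real.pi_pos]
      · rw [abs_div, abs_mul, abs_mul, abs_mul, abs_of_pos hP, abs_of_pos Real.pi_pos]
        have h1 : |(x.valMinAbs : ℝ)| ≤ l := by
          rw [← Int.cast_abs, Int.abs_eq_natAbs]; exact_mod_cast hx
        have h2 : (c : ℝ) ≤ Q := by
          simp at hc; exact_mod_cast hc.le
        have h3 : (6 * Q * l : ℝ) ≤ P := by exact_mod_cast h
        have h4 : (c : ℝ) * |(x.valMinAbs : ℝ)| ≤ Q * l := by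
          exact mul_le_mul h2 h1 (abs_nonneg _) (by positivity)
        rw [div_le_div_iff₀ hP (by norm_num)]
        norm_num
        nlinarith [Real.pi_pos, mul_le_mul_of_nonneg_left h4 Real.pi_pos.le,
          mul_le_mul_of_nonneg_left h3 Real.pi_pos.le]
    calc (Q : ℝ) / 2 = ∑ c ∈ Finset.range Q, (1 / 2 : ℝ) := by simp; ring
      _ ≤ _ := Finset.sum_le_sum this
  rw [Complex.normSq_apply]
  have hQ0 : (0:ℝ) ≤ Q := by positivity
  nlinarith [mul_self_nonneg (∑ c ∈ Finset.range Q, (ZMod.stdAddChar ((c : ZMod P) * x) : ℂ)).im]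

lemma normSq_expand {P : ℕ} [NeZero P] (H : Finset (ZMod P)) (Q : ℕ) (α : ZMod P) :
    ((∑ h ∈ H, Complex.normSq (∑ c ∈ Finset.range Q,
        (ZMod.stdAddChar ((c : ZMod P) * (h * α)) : ℂ)) : ℝ) : ℂ)
      = ∑ t ∈ (H ×ˢ Finset.range Q ×ˢ Finset.range Q),
        (ZMod.stdAddChar (α * (t.1 * ((t.2.1 : ZMod P) - (t.2.2 : ZMod P)))) : ℂ) := by
  rw [Finset.sum_product, Complex.ofReal_sum]
  refine Finset.sum_congr rfl fun h _ => ?_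
  rw [← Complex.mul_conj, map_sum, Finset.sum_mul_sum, Finset.sum_product]
  refine Finset.sum_congr rfl fun c _ => Finset.sum_congr rfl fun c' _ => ?_
  have : (starRingEnd ℂ) (ZMod.stdAddChar ((c' : ZMod P) * (h * α)) : ℂ)
      = ZMod.stdAddChar (-((c' : ZMod P) * (h * α))) := by
    rw [AddChar.map_neg_eq_conj]
  rw [this, ← AddChar.map_add_eq_mul]
  congr 1
  ring

lemma moment_raw {P : ℕ} [Fact P.Prime] (H : Finset (ZMod P)) (Q l : ℕ) (hQ : 2 ≤ Q)
    (h : 6 * Q * l ≤ P) (m : ℕ) :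
    ∑ α : ZMod P, ((H.filter (fun x => (x * α).valMinAbs.natAbs ≤ l)).card : ℝ) ^ m
      ≤ (4 / (Q : ℝ) ^ 2) ^ m * (P * cnt (H ×ˢ Finset.range Q ×ˢ Finset.range Q)
      (fun t => t.1 * ((t.2.1 : ZMod P) - (t.2.2 : ZMod P))) m 0) := by
  have hQ0 : (0:ℝ) < Q := by positivity
  set G : ZMod P → ℝ := fun α => ∑ h ∈ H, Complex.normSq (∑ c ∈ Finset.range Q,
        (ZMod.stdAddChar ((c : ZMod P) * (h * α)) : ℂ)) with hG
  have h1 : ∑ α, G α ^ m = P * cnt (H ×ˢ Finset.range Q ×ˢ Finset.range Q)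
      (fun t => t.1 * ((t.2.1 : ZMod P) - (t.2.2 : ZMod P))) m 0 := by
    have := sum_pow_eq_cnt (H ×ˢ Finset.range Q ×ˢ Finset.range Q)
      (fun t => t.1 * ((t.2.1 : ZMod P) - (t.2.2 : ZMod P))) m
    simp only [← normSq_expand] at this
    exact_mod_cast this
  rw [← h1, Finset.mul_sum]
  refine Finset.sum_le_sum fun α _ => ?_
  rw [← mul_pow]
  apply pow_le_pow_left₀ (by positivity)
  have h2 : ((H.filter (fun x => (x * α).valMinAbs.natAbs ≤ l)).card : ℝ) * ((Q : ℝ) ^ 2 / 4)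
      ≤ G α := by
    rw [hG, ← nsmul_eq_mul, ← Finset.sum_const]
    calc _ ≤ ∑ x ∈ (H.filter (fun x => (x * α).valMinAbs.natAbs ≤ l)), Complex.normSq
          (∑ c ∈ Finset.range Q, (ZMod.stdAddChar ((c : ZMod P) * (x * α)) : ℂ)) :=
          Finset.sum_le_sum fun x hx => fejer_lower Q l h _ (Finset.mem_filter.1 hx).2
      _ ≤ _ := Finset.sum_le_sum_of_subset_of_nonneg (Finset.filter_subset _ _)
          (fun _ _ _ => Complex.normSq_nonneg _)
  rw [div_mul_eq_mul_div, le_div_iff₀ (by positivity)]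
  linarith

lemma moment_one {P : ℕ} [Fact P.Prime] (H : Finset (ZMod P)) (Q l : ℕ) (hQ : 2 ≤ Q)
    (hQP : Q ≤ P) (h : 6 * Q * l ≤ P) (m : ℕ) (hm : 1 ≤ m) :
    ∑ α : ZMod P, ((H.filter (fun x => (x * α).valMinAbs.natAbs ≤ l)).card : ℝ) ^ m
      ≤ P * ((4 / (Q : ℝ)) ^ m * (3 * (H.card : ℝ) ^ m + 2 * (Q : ℝ) ^ (m * m))) := by
  rcases Nat.eq_zero_or_pos H.card with h0 | hpos
  · rw [Finset.card_eq_zero] at h0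
    subst h0
    simp [Nat.ne_of_gt hm]
    positivity
  have hH : (0:ℝ) < H.card := by exact_mod_cast hpos
  have hQ0 : (0:ℝ) < Q := by positivity
  refine (moment_raw H Q l hQ h m).trans ?_
  have hc := cnt_bound H Q hQ hQP m 0
  set E := cnt (H ×ˢ Finset.range Q ×ˢ Finset.range Q)
      (fun t => t.1 * ((t.2.1 : ZMod P) - (t.2.2 : ZMod P))) m 0
  have key : E ≤ (Q : ℝ) ^ m * (3 * (H.card : ℝ) ^ m + 2 * (Q : ℝ) ^ (m * m)) := by
    refine le_of_mul_le_mul_left (hc.trans ?_) hH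
    have e1 : (H.card * (H.card * Q) ^ m + 2 * (Q ^ 2 * H.card) ^ m : ℝ)
        = Q ^ m * (H.card * H.card ^ m + 2 * (Q ^ m * H.card ^ m)) := by
      rw [mul_pow, mul_pow, ← pow_mul, mul_comm 2 m, pow_mul]; ring
    rw [e1, mul_left_comm (H.card : ℝ)]
    apply mul_le_mul_of_nonneg_left _ (by positivity)
    have e2 : (Q ^ m * H.card ^ m : ℝ) ≤ H.card * (H.card ^ m + Q ^ (m * m)) := by
      rcases le_total ((Q : ℝ) ^ m) H.card with hle | hle
      · have := mul_le_mul_of_nonneg_right hle (pow_nonneg hH.le m)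
        have h5 : (0:ℝ) ≤ H.card * Q ^ (m * m) := by positivity
        linarith
      · obtain ⟨n, rfl⟩ : ∃ n, m = n + 1 := ⟨m - 1, by omega⟩
        have h6 : (H.card : ℝ) ^ n ≤ (Q ^ (n + 1)) ^ n := pow_le_pow_left₀ hH.le hle n
        have h7 : (Q : ℝ) ^ ((n + 1) * (n + 1)) = Q ^ (n + 1) * (Q ^ (n + 1)) ^ n := by
          rw [← pow_mul, ← pow_add]; congr 1; ring
        rw [h7, pow_succ (H.card : ℝ) n]
        have h8 : (0:ℝ) ≤ H.card * (H.card ^ n * H.card) := by positivity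
        have h9 : (0:ℝ) ≤ Q ^ (n + 1) * H.card := by positivity
        nlinarith [mul_le_mul_of_nonneg_left h6 h9]
    linarith
  calc (4 / (Q : ℝ) ^ 2) ^ m * (P * E)
      ≤ (4 / (Q : ℝ) ^ 2) ^ m * (P * ((Q : ℝ) ^ m * (3 * (H.card : ℝ) ^ m + 2 * (Q : ℝ) ^ (m * m)))) := by
        gcongr
    _ = _ := by
        have : (4 / (Q : ℝ)) ^ m = (4 / (Q : ℝ) ^ 2) ^ m * (Q : ℝ) ^ m := by
          rw [← mul_pow]; congr 1; field_simp
        rw [this]; ring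

lemma moment_multi {P : ℕ} [Fact P.Prime] (H : Finset (ZMod P)) (Q l : ℕ) (hQ : 20 ≤ Q)
    (hQP : Q ≤ P) (h : 6 * Q * l ≤ P) (m : ℕ) (hm : 1 ≤ m) (D : ℕ) :
    ∑ α : Fin D → ZMod P,
      ((H.filter (fun x => ∀ i, (x * α i).valMinAbs.natAbs ≤ l)).card : ℝ) ^ m
      ≤ (P : ℝ) ^ D * ((3 * (4 / (Q : ℝ)) ^ m) ^ D * (H.card : ℝ) ^ m + (Q : ℝ) ^ (m * m)) := by
  have hQ0 : (20:ℝ) ≤ Q := by exact_mod_cast hQ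
  induction D with
  | zero =>
    simp
  | succ D ih =>
    rw [← (Fin.consEquiv (fun _ => ZMod P)).sum_comp, Fintype.sum_prod_type, Finset.sum_comm]
    have hA : (4 / (Q : ℝ)) ^ m ≤ 1 / 5 := by
      calc (4 / (Q : ℝ)) ^ m ≤ (1 / 5) ^ m := by
            apply pow_le_pow_left₀ (by positivity)
            rw [div_le_div_iff₀ (by linarith) (by norm_num)]; linarith
        _ ≤ (1 / 5) ^ 1 := pow_le_pow_of_le_one (by norm_num) (by norm_num) hm
        _ = _ := by norm_num
    have hA0 : 0 ≤ (4 / (Q : ℝ)) ^ m := by positivity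
    set A := (4 / (Q : ℝ)) ^ m with hAdef
    have hstep : ∀ β : Fin D → ZMod P,
        ∑ a : ZMod P, ((H.filter (fun x => ∀ i, (x * (Fin.consEquiv (fun _ => ZMod P)) (a, β) i).valMinAbs.natAbs ≤ l)).card : ℝ) ^ m
        ≤ P * (A * (3 * ((H.filter (fun x => ∀ i, (x * β i).valMinAbs.natAbs ≤ l)).card : ℝ) ^ m + 2 * (Q : ℝ) ^ (m * m))) := by
      intro β
      have hm1 := moment_one (H.filter (fun x => ∀ i, (x * β i).valMinAbs.natAbs ≤ l)) Q l
        (by omega) hQP h m hm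
      have hfil : ∀ a : ZMod P, (H.filter (fun x => ∀ i, (x *
          (Fin.consEquiv (fun _ => ZMod P)) (a, β) i).valMinAbs.natAbs ≤ l))
          = (H.filter (fun x => ∀ i, (x * β i).valMinAbs.natAbs ≤ l)).filter
            (fun x => (x * a).valMinAbs.natAbs ≤ l) := by
        intro a
        ext x
        simp only [Finset.mem_filter, Fin.forall_fin_succ, Fin.consEquiv_apply, Fin.cons_zero,
          Fin.cons_succ]
        tauto
      simp only [hfil]
      exact hm1
    refine (Finset.sum_le_sum fun β _ => hstep β).trans ?_
    rw [← Finset.mul_sum, ← Finset.mul_sum, Finset.sum_add_distrib, ← Finset.mul_sum]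
    simp only [Finset.sum_const, Finset.card_univ, Fintype.card_pi, ZMod.card, Finset.prod_const,
      Fintype.card_fin, nsmul_eq_mul, Nat.cast_pow]
    set B := (Q : ℝ) ^ (m * m)
    have hB : 0 ≤ B := by positivity
    calc _ ≤ (P : ℝ) * (A * (3 * ((P : ℝ) ^ D * ((3 * A) ^ D * (H.card : ℝ) ^ m + B)) + P ^ D * (2 * B))) := by
          gcongr
      _ = (P : ℝ) ^ (D + 1) * ((3 * A) ^ (D + 1) * (H.card : ℝ) ^ m + (A * 5) * B) := by ring
      _ ≤ _ := by
          gcongr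
          nlinarith

end moment
section select

lemma card_preimage_hom {G V : Type*} [AddCommGroup G] [AddCommGroup V] [Fintype G] [Fintype V]
    [DecidableEq V] (f : G →+ V) (hf : Function.Surjective f) (S : Finset V) :
    (Finset.univ.filter (fun g => f g ∈ S)).card * Fintype.card V = S.card * Fintype.card G := by
  classical
  set k := (Finset.univ.filter (fun g => f g = 0)).card with hk
  have hfib : ∀ v : V, (Finset.univ.filter (fun g => f g = v)).card = k := by
    intro v
    exact AddMonoidHom.card_fiber_eq_of_mem_range f (hf v) (hf 0)
  have hgen : ∀ T : Finset V, (Finset.univ.filter (fun g => f g ∈ T)).card = T.card * k := by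
    intro T
    rw [Finset.card_eq_sum_card_fiberwise (f := f) (t := T)
      (fun g hg => by simpa using hg)]
    rw [Finset.sum_const_nat (m := k)]
    intro v hv
    rw [← hfib v, Finset.filter_filter]
    congr 1
    ext g
    simp only [Finset.mem_filter, Finset.mem_univ, true_and]
    constructor
    · exact fun h => h.2
    · intro h; exact ⟨h ▸ hv, h⟩
  have h1 := hgen Finset.univ
  simp only [Finset.mem_univ, Finset.filter_true, Finset.card_univ] at h1
  rw [hgen, h1]
  ring

/-- number of returns of the orbit of `α` to the box of radius `l`. -/
noncomputable def hcount (P D l X : ℕ) [NeZero P] (α : Fin D → ZMod P) : ℕ :=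
  ((Finset.range X).filter (fun h => h • α ∈ vbox P D l)).card

lemma hcount_eq {P D l X : ℕ} [NeZero P] (hX : X ≤ P) (α : Fin D → ZMod P) :
    hcount P D l X α = (((Finset.range X).image (fun h : ℕ => (h : ZMod P))).filter
      (fun x => ∀ i, (x * α i).valMinAbs.natAbs ≤ l)).card := by
  unfold hcount
  rw [Finset.filter_image, Finset.card_image_of_injOn]
  · congr 1
    ext h
    simp [mem_vbox]
  · intro x hx y hy hxy
    simp at hx hy hxy
    rw [ZMod.natCast_eq_natCast_iff'] at hxy
    rwa [Nat.mod_eq_of_lt (by omega), Nat.mod_eq_of_lt (by omega)] at hxy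

lemma card_range_image {P X : ℕ} [NeZero P] (hX : X ≤ P) :
    ((Finset.range X).image (fun h : ℕ => (h : ZMod P))).card = X := by
  rw [Finset.card_image_of_injOn, Finset.card_range]
  intro x hx y hy hxy
  simp at hx hy hxy
  rw [ZMod.natCast_eq_natCast_iff'] at hxy
  rwa [Nat.mod_eq_of_lt (by omega), Nat.mod_eq_of_lt (by omega)] at hxy

lemma bad_count {P D Q l X s : ℕ} [Fact P.Prime] (hD : 1 ≤ D) (hQ : 20 ≤ Q) (hQP : Q ≤ P)
    (hl : 6 * Q * l ≤ P) (hX : X = Q ^ (2 * D)) (hXP : X ≤ P) (hs : 1 ≤ s) :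
    ((Finset.univ.filter (fun α : Fin D → ZMod P =>
      (X : ℝ) * 12 ^ D * s / Q ^ D ≤ hcount P D l X α)).card : ℝ) * (s : ℝ) ^ D ≤ 2 * (P : ℝ) ^ D := by
  set Bad := (Finset.univ.filter (fun α : Fin D → ZMod P =>
      (X : ℝ) * 12 ^ D * s / Q ^ D ≤ hcount P D l X α)) with hBad
  have hmom := moment_multi ((Finset.range X).image (fun h : ℕ => (h : ZMod P))) Q l hQ hQP hl D hD D
  simp only [← hcount_eq hXP, card_range_image hXP] at hmom
  have hQ0 : (0:ℝ) < Q := by positivity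
  have hX0 : (0:ℝ) < X := by rw [hX]; positivity
  have h1 : (Bad.card : ℝ) * ((X : ℝ) * 12 ^ D * s / Q ^ D) ^ D ≤
      ∑ α : Fin D → ZMod P, (hcount P D l X α : ℝ) ^ D := by
    rw [← nsmul_eq_mul, ← Finset.sum_const]
    calc _ ≤ ∑ α ∈ Bad, (hcount P D l X α : ℝ) ^ D :=
          Finset.sum_le_sum fun α hα => pow_le_pow_left₀ (by positivity)
            (Finset.mem_filter.1 hα).2 _
      _ ≤ _ := Finset.sum_le_sum_of_subset_of_nonneg (Finset.subset_univ _)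
          (fun _ _ _ => by positivity)
  have h2 := h1.trans hmom
  set R : ℝ := (X : ℝ) ^ D * (12 ^ D / Q ^ D) ^ D with hR
  have hR0 : 0 < R := by positivity
  have h3 : ((X : ℝ) * 12 ^ D * s / Q ^ D) ^ D = R * s ^ D := by
    rw [hR, ← mul_pow, ← mul_pow]; congr 1; ring
  have h4 : (3 * (4 / (Q : ℝ)) ^ D) ^ D * (X : ℝ) ^ D ≤ R := by
    rw [hR, mul_comm]
    gcongr
    rw [div_pow, ← mul_div_assoc]
    gcongr
    calc (3:ℝ) * 4 ^ D ≤ 3 ^ D * 4 ^ D := by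
          gcongr; exact le_self_pow₀ (by norm_num) (by omega)
      _ = 12 ^ D := by rw [← mul_pow]; norm_num
  have h5 : (Q : ℝ) ^ (D * D) ≤ R := by
    have : (Q : ℝ) ^ (D * D) = (X : ℝ) ^ D * (1 / Q ^ D) ^ D := by
      rw [hX, ← mul_pow, pow_mul (Q : ℝ) D D]
      congr 1
      push_cast
      rw [two_mul, pow_add]
      field_simp
    rw [this, hR]
    gcongr
    exact one_le_pow₀ (by norm_num)
  rw [h3] at h2
  have h6 : (Bad.card : ℝ) * (R * s ^ D) ≤ (P : ℝ) ^ D * (R + R) :=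
    h2.trans (by gcongr)
  refine le_of_mul_le_mul_right ?_ hR0
  linarith

lemma exists_theta {P D Q L w s N X : ℕ} [Fact P.Prime] (hD : 1 ≤ D) (hQ : 20 ≤ Q) (hQP : Q ≤ P)
    (hl : 12 * Q * L ≤ P) (hX : X = Q ^ (2 * D)) (hXP : X ≤ P) (hs : 1 ≤ s)
    (hw : 1 ≤ w) (hsw : 3 * s * w ≤ P) (hN : 8 * N ≤ s ^ D) (hNP : N ≤ P) :
    ∃ θ : Fin D → ZMod P, ∀ d : ℕ, 0 < d → d < N → d • θ ∉ vbox P D w ∧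
      (hcount P D (2 * L) X (d • θ) : ℝ) < (X : ℝ) * 12 ^ D * s / Q ^ D := by
  classical
  set Bad1 := (Finset.univ.filter (fun α : Fin D → ZMod P =>
      (X : ℝ) * 12 ^ D * s / Q ^ D ≤ hcount P D (2 * L) X α)) with hBad1
  have hb1 := bad_count (l := 2 * L) (s := s) hD hQ hQP (by linarith) hX hXP hs
  rw [← hBad1] at hb1
  have hP0 : (0:ℝ) < P := by exact_mod_cast (Fact.out : P.Prime).pos
  have hb2 : ((vbox P D w).card : ℝ) * (s : ℝ) ^ D ≤ (P : ℝ) ^ D := by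
    have h1 : ((vbox P D w).card : ℝ) ≤ (2 * w + 1) ^ D := by exact_mod_cast card_vbox_le P D w
    calc _ ≤ ((2 * w + 1 : ℝ)) ^ D * (s : ℝ) ^ D := by gcongr
      _ = ((2 * w + 1 : ℝ) * s) ^ D := by rw [mul_pow]
      _ ≤ _ := by
          gcongr
          have : (2 * w + 1) * s ≤ P := by nlinarith
          exact_mod_cast this
  set Bad := vbox P D w ∪ Bad1 with hBad
  have hb : (Bad.card : ℝ) * (s : ℝ) ^ D ≤ 3 * (P : ℝ) ^ D := by
    have : (Bad.card : ℝ) ≤ (vbox P D w).card + Bad1.card := by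
      exact_mod_cast Finset.card_union_le _ _
    have hs0 : (0:ℝ) ≤ (s : ℝ) ^ D := by positivity
    nlinarith
  set U := (Finset.Ioo 0 N).biUnion (fun d => Finset.univ.filter
    (fun θ : Fin D → ZMod P => d • θ ∈ Bad)) with hU
  have hUc : U.card ≤ N * Bad.card := by
    calc U.card ≤ (Finset.Ioo 0 N).card * Bad.card := by
          apply Finset.card_biUnion_le_card_mul
          intro d hd
          simp only [Finset.mem_Ioo] at hd
          apply Finset.card_le_card_of_injOn (fun θ => d • θ)
          · intro θ hθ; simpa using hθ
          · intro x _ y _ hxy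
            have hd0 : (d : ZMod P) ≠ 0 := by
              rw [Ne, ZMod.natCast_eq_zero_iff]
              intro hdiv
              have := Nat.le_of_dvd hd.1 hdiv
              omega
            funext i
            have := congrFun hxy i
            simp only [Pi.smul_apply, nsmul_eq_mul] at this
            exact mul_left_cancel₀ hd0 this
      _ ≤ _ := by
          gcongr
          simp
  have hlt : U.card < Fintype.card (Fin D → ZMod P) := by
    have hcard : Fintype.card (Fin D → ZMod P) = P ^ D := by simp [ZMod.card]
    rw [hcard]
    have h8 : (8 * N : ℝ) ≤ (s : ℝ) ^ D := by exact_mod_cast hN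
    have h9 : (U.card : ℝ) ≤ N * Bad.card := by exact_mod_cast hUc
    have h10 : (Bad.card : ℝ) * (8 * N) ≤ Bad.card * (s : ℝ) ^ D := by gcongr
    have h11 : (0:ℝ) < (P : ℝ) ^ D := by positivity
    have : (U.card : ℝ) < (P : ℝ) ^ D := by linarith
    exact_mod_cast this
  obtain ⟨θ, hθ⟩ : ∃ θ, θ ∉ U := by
    by_contra hcon
    push Not at hcon
    have : U = Finset.univ := Finset.eq_univ_iff_forall.2 hcon
    rw [this, Finset.card_univ] at hlt
    exact lt_irrefl _ hlt
  refine ⟨θ, fun d hd0 hdN => ?_⟩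
  have hnb : d • θ ∉ Bad := by
    intro hmem
    apply hθ
    rw [hU, Finset.mem_biUnion]
    exact ⟨d, by simp [hd0, hdN], Finset.mem_filter.2 ⟨Finset.mem_univ _, hmem⟩⟩
  rw [hBad, Finset.mem_union, not_or] at hnb
  refine ⟨hnb.1, ?_⟩
  have := hnb.2
  rw [hBad1, Finset.mem_filter] at this
  simpa using this

end select
section select2

lemma hit_fiber {P D L X : ℕ} [NeZero P] (β α c : Fin D → ZMod P) :
    ((Finset.range X).filter (fun j => β + j • α - c ∈ vbox P D L)).card
      ≤ hcount P D (2 * L) X α := by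
  classical
  set J := (Finset.range X).filter (fun j => β + j • α - c ∈ vbox P D L) with hJ
  rcases J.eq_empty_or_nonempty with h0 | hne
  · simp [h0]
  · set j0 := J.min' hne with hj0
    have hj0m : j0 ∈ J := J.min'_mem hne
    unfold hcount
    apply Finset.card_le_card_of_injOn (fun j => j - j0)
    · intro j hj
      have hle : j0 ≤ j := J.min'_le j hj
      have hj1 := Finset.mem_filter.1 hj
      have hj2 := Finset.mem_filter.1 hj0m
      rw [Finset.mem_coe, Finset.mem_filter]
      refine ⟨?_, ?_⟩
      · have := Finset.mem_range.1 hj1.1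
        rw [Finset.mem_range]
        exact lt_of_le_of_lt (Nat.sub_le _ _) this
      · have e : (j - j0) • α = (β + j • α - c) + -(β + j0 • α - c) := by
          have : j • α = (j - j0) • α + j0 • α := by rw [← add_nsmul]; congr 1; omega
          rw [this]; abel
        have h3 := (mem_vbox _).1 hj1.2
        have h4 := (mem_vbox _).1 hj2.2
        rw [e, mem_vbox]
        intro i
        rw [two_mul]
        exact vb_add (h3 i) (vb_neg (h4 i))
    · intro x hx y hy hxy
      have hx1 : j0 ≤ x := J.min'_le x hx
      have hy1 : j0 ≤ y := J.min'_le y hy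
      simp only at hxy
      omega

lemma hit_card {P D L X : ℕ} [NeZero P] {Z : Type*} [Fintype Z] [DecidableEq Z]
    (lab : (Fin D → ZMod P) → Z) (β α : Fin D → ZMod P) (hL : L < P) :
    X * (L + 1) ^ D ≤ hcount P D (2 * L) X α *
      (Finset.univ.filter (fun z : (Fin D → ZMod P) × Z => ∃ j < X, β + j • α - z.1 ∈ vbox P D L ∧
        lab (β + j • α - z.1) = z.2)).card := by
  classical
  set Hit := (Finset.univ.filter (fun z : (Fin D → ZMod P) × Z => ∃ j < X,
    β + j • α - z.1 ∈ vbox P D L ∧ lab (β + j • α - z.1) = z.2)) with hHit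
  set S := Finset.range X ×ˢ vbox P D L with hS
  set f : ℕ × (Fin D → ZMod P) → (Fin D → ZMod P) := fun t => β + t.1 • α - t.2 with hf
  have h1 : S.card ≤ hcount P D (2 * L) X α * (S.image f).card := by
    apply Finset.card_le_mul_card_image
    intro c _
    refine le_trans ?_ (hit_fiber (L := L) (X := X) β α c)
    apply Finset.card_le_card_of_injOn Prod.fst
    · rintro ⟨j, y⟩ hjy
      simp only [hS, hf, Finset.coe_filter, Finset.mem_product, Finset.mem_range,
        Set.mem_ofPred_eq] at hjy ⊢
      refine ⟨hjy.1.1, ?_⟩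
      rw [← hjy.2]
      simpa using hjy.1.2
    · rintro ⟨j, y⟩ hjy ⟨j', y'⟩ hjy' hjj
      simp only [hS, hf, Finset.coe_filter, Finset.mem_product, Finset.mem_range,
        Set.mem_ofPred_eq] at hjy hjy' hjj
      subst hjj
      have := hjy.2.trans hjy'.2.symm
      rw [sub_right_inj] at this
      rw [this]
  have h2 : (S.image f).card ≤ Hit.card := by
    apply Finset.card_le_card_of_surjOn Prod.fst
    intro c hc
    simp only [Finset.coe_image, Set.mem_image] at hc
    obtain ⟨⟨j, y⟩, hjy, rfl⟩ := hc
    simp only [hS, Finset.coe_product, Set.mem_prod, Finset.mem_coe, Finset.mem_range] at hjy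
    refine ⟨(f (j, y), lab y), ?_, rfl⟩
    have hy : β + j • α - f (j, y) = y := by simp [hf]
    rw [hHit, Finset.mem_coe, Finset.mem_filter]
    refine ⟨Finset.mem_univ _, j, hjy.1, ?_⟩
    simp only [hy]
    exact ⟨hjy.2, trivial⟩
  calc X * (L + 1) ^ D ≤ S.card := by
        rw [hS, Finset.card_product, Finset.card_range]
        gcongr
        exact le_card_vbox P D L hL
    _ ≤ _ := h1
    _ ≤ _ := by gcongr

/-- the map whose small values correspond to possible progressions across different shells -/
def crossHom (M : ℕ) (V Z : Type*) [AddCommGroup V] [AddCommGroup Z] (i j k : Fin M) :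
    (Fin M → V × Z) →+ V where
  toFun ω := (ω i).1 + (ω k).1 - 2 • (ω j).1
  map_zero' := by simp
  map_add' x y := by simp [smul_add]; abel

lemma crossHom_surj {P D M : ℕ} [Fact P.Prime] (hP2 : P ≠ 2) {Z : Type*} [AddCommGroup Z]
    (i j k : Fin M) (h : ¬ (i = j ∧ j = k)) :
    Function.Surjective (crossHom M (Fin D → ZMod P) Z i j k) := by
  intro v
  by_cases hki : k = i
  · subst hki
    have hkj : j ≠ k := by
      intro hh; exact h ⟨hh.symm, hh⟩
    have h2 : (2 : ZMod P) ≠ 0 := by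
      have h3 : ((2 : ℕ) : ZMod P) ≠ 0 := by
        rw [Ne, ZMod.natCast_eq_zero_iff]
        intro hd
        exact hP2 ((Nat.prime_dvd_prime_iff_eq Fact.out Nat.prime_two).1 hd)
      exact_mod_cast h3
    refine ⟨Pi.single k ((fun l => (2 : ZMod P)⁻¹ * v l), 0), ?_⟩
    simp only [crossHom, AddMonoidHom.coe_mk, ZeroHom.coe_mk, Pi.single_eq_same,
      Pi.single_eq_of_ne hkj]
    funext l
    simp only [Prod.fst_zero, smul_zero, sub_zero, Pi.add_apply]
    rw [← two_mul, mul_inv_cancel_left₀ h2]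
  · by_cases hkj : k = j
    · subst hkj
      refine ⟨Pi.single i (v, 0), ?_⟩
      simp [crossHom, Pi.single_eq_of_ne hki]
    · refine ⟨Pi.single k (v, 0), ?_⟩
      simp [crossHom, Pi.single_eq_of_ne (Ne.symm hki), Pi.single_eq_of_ne (Ne.symm hkj)]

lemma exists_omega {M : ℕ} {V Z : Type*} [AddCommGroup V] [Fintype V] [DecidableEq V]
    [AddCommGroup Z] [Fintype Z] [DecidableEq Z]
    (hsurj : ∀ i j k : Fin M, ¬ (i = j ∧ j = k) → Function.Surjective (crossHom M V Z i j k))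
    (S : Finset V) (hS : 2 * (M : ℝ) ^ 3 * S.card < Fintype.card V) {ι : Type*} (I : Finset ι)
    (Hit : ι → Finset (V × Z)) (p : ℝ)
    (hHit : ∀ a ∈ I, p * Fintype.card (V × Z) ≤ (Hit a).card)
    (hp : 2 * (I.card : ℝ) * Real.exp (-(p * M)) ≤ 1) :
    ∃ ω : Fin M → V × Z,
      (∀ i j k, ¬ (i = j ∧ j = k) → (ω i).1 + (ω k).1 - 2 • (ω j).1 ∉ S) ∧
      (∀ a ∈ I, ∃ i, ω i ∈ Hit a) := by
  classical
  let Ω := Fin M → V × Z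
  have hΩ0 : (0:ℝ) < Fintype.card Ω := by exact_mod_cast Fintype.card_pos
  have hV0 : (0:ℝ) < Fintype.card V := by exact_mod_cast Fintype.card_pos
  set T : Finset (Fin M × Fin M × Fin M) :=
    Finset.univ.filter (fun t => ¬ (t.1 = t.2.1 ∧ t.2.1 = t.2.2)) with hT
  set U1 : Finset Ω := T.biUnion (fun t => Finset.univ.filter
    (fun ω : Ω => crossHom M V Z t.1 t.2.1 t.2.2 ω ∈ S)) with hU1
  set U2 : Finset Ω := I.biUnion (fun a => Fintype.piFinset (fun _ : Fin M => (Hit a)ᶜ)) with hU2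
  have hc1 : 2 * (U1.card : ℝ) < Fintype.card Ω := by
    have h1 : (U1.card : ℝ) ≤ ∑ t ∈ T, ((Finset.univ.filter
        (fun ω : Ω => crossHom M V Z t.1 t.2.1 t.2.2 ω ∈ S)).card : ℝ) := by
      exact_mod_cast Finset.card_biUnion_le
    have h2 : ∀ t ∈ T, ((Finset.univ.filter
        (fun ω : Ω => crossHom M V Z t.1 t.2.1 t.2.2 ω ∈ S)).card : ℝ)
        = S.card * Fintype.card Ω / (Fintype.card V : ℝ) := by
      intro t ht
      have := card_preimage_hom (crossHom M V Z t.1 t.2.1 t.2.2)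
        (hsurj _ _ _ (Finset.mem_filter.1 ht).2) S
      rw [eq_div_iff (by positivity)]
      exact_mod_cast this
    rw [Finset.sum_congr rfl h2, Finset.sum_const, nsmul_eq_mul] at h1
    have h3 : (T.card : ℝ) ≤ (M : ℝ) ^ 3 := by
      have : T.card ≤ M ^ 3 := by
        calc T.card ≤ Finset.univ.card := Finset.card_le_univ _
          _ = M ^ 3 := by simp; ring
      exact_mod_cast this
    calc 2 * (U1.card : ℝ) ≤ 2 * ((M : ℝ) ^ 3 * (S.card * Fintype.card Ω / (Fintype.card V : ℝ))) := by
          have : (0:ℝ) ≤ (S.card * Fintype.card Ω / (Fintype.card V : ℝ)) := by positivity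
          nlinarith
      _ = (2 * (M : ℝ) ^ 3 * S.card) / (Fintype.card V : ℝ) * Fintype.card Ω := by ring
      _ < 1 * Fintype.card Ω := by
          gcongr
          rw [div_lt_one (by positivity)]
          exact hS
      _ = _ := one_mul _
  have hc2 : 2 * (U2.card : ℝ) ≤ Fintype.card Ω := by
    have h1 : (U2.card : ℝ) ≤ ∑ a ∈ I, ((Fintype.piFinset (fun _ : Fin M => (Hit a)ᶜ)).card : ℝ) := by
      exact_mod_cast Finset.card_biUnion_le
    have h2 : ∀ a ∈ I, ((Fintype.piFinset (fun _ : Fin M => (Hit a)ᶜ)).card : ℝ)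
        ≤ Fintype.card Ω * Real.exp (-(p * M)) := by
      intro a ha
      have hh := hHit a ha
      have hcard : (Fintype.card Ω : ℝ) = (Fintype.card (V × Z) : ℝ) ^ M := by
        simp [Ω]
      rw [Fintype.card_piFinset, Finset.prod_const, Finset.card_univ, Fintype.card_fin,
        hcard]
      have e : Real.exp (-(p * M)) = Real.exp (-p) ^ M := by
        rw [← Real.exp_nat_mul]; congr 1; ring
      rw [e, ← mul_pow]
      push_cast
      apply pow_le_pow_left₀ (by positivity)
      have h4 : ((Hit a)ᶜ.card : ℝ) = Fintype.card (V × Z) - (Hit a).card := by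
        have := Finset.card_add_card_compl (Hit a)
        have h5 : ((Hit a).card : ℝ) + ((Hit a)ᶜ).card = Fintype.card (V × Z) := by
          exact_mod_cast this
        linarith
      rw [h4]
      have h6 : 1 - p ≤ Real.exp (-p) := by linarith [Real.add_one_le_exp (-p)]
      have h7 : (0:ℝ) ≤ Fintype.card (V × Z) := by positivity
      nlinarith
    have h3 := h1.trans (Finset.sum_le_sum h2)
    rw [Finset.sum_const, nsmul_eq_mul] at h3
    nlinarith
  obtain ⟨ω, hω⟩ : ∃ ω, ω ∉ U1 ∪ U2 := by
    by_contra hcon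
    push Not at hcon
    have h1 : U1 ∪ U2 = Finset.univ := Finset.eq_univ_iff_forall.2 hcon
    have h2 := Finset.card_union_le U1 U2
    rw [h1, Finset.card_univ] at h2
    have h3 : (Fintype.card Ω : ℝ) ≤ U1.card + U2.card := by exact_mod_cast h2
    linarith
  rw [Finset.mem_union, not_or] at hω
  refine ⟨ω, fun i j k hijk hmem => hω.1 ?_, fun a ha => ?_⟩
  · rw [hU1, Finset.mem_biUnion]
    exact ⟨(i, j, k), Finset.mem_filter.2 ⟨Finset.mem_univ _, hijk⟩,
      Finset.mem_filter.2 ⟨Finset.mem_univ _, hmem⟩⟩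
  · by_contra hcon
    push Not at hcon
    apply hω.2
    rw [hU2, Finset.mem_biUnion]
    refine ⟨a, ha, ?_⟩
    rw [Fintype.mem_piFinset]
    intro i
    simpa using hcon i

end select2
section construct

/-- the quadratic form -/
def qform {P D : ℕ} (x : Fin D → ZMod P) : ℕ := ∑ i, (x i).valMinAbs.natAbs ^ 2

lemma qform_le {P D L : ℕ} [NeZero P] {x : Fin D → ZMod P} (hx : x ∈ vbox P D L) :
    qform x ≤ D * L ^ 2 := by
  rw [mem_vbox] at hx
  calc qform x ≤ ∑ _i : Fin D, L ^ 2 :=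
        Finset.sum_le_sum fun i _ => Nat.pow_le_pow_left (hx i) 2
    _ = _ := by simp

lemma shell_eq {P D L w K : ℕ} [NeZero P] (hK : D * L ^ 2 / w ^ 2 < K) {x y : Fin D → ZMod P}
    (hx : x ∈ vbox P D L) (hy : y ∈ vbox P D L)
    (h : ((qform x / w ^ 2 : ℕ) : ZMod K) = ((qform y / w ^ 2 : ℕ) : ZMod K)) :
    qform x / w ^ 2 = qform y / w ^ 2 := by
  have h1 : qform x / w ^ 2 < K := lt_of_le_of_lt (Nat.div_le_div_right (qform_le hx)) hK
  have h2 : qform y / w ^ 2 < K := lt_of_le_of_lt (Nat.div_le_div_right (qform_le hy)) hK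
  rw [ZMod.natCast_eq_natCast_iff'] at h
  rwa [Nat.mod_eq_of_lt h1, Nat.mod_eq_of_lt h2] at h

lemma shell_free {P D L w : ℕ} [NeZero P] (hL : 4 * L < P) (hw : 1 ≤ w)
    {x y z : Fin D → ZMod P}
    (hx : x ∈ vbox P D L) (hy : y ∈ vbox P D L) (hz : z ∈ vbox P D L)
    (hxyz : x + z = 2 • y) (h1 : qform x / w ^ 2 = qform y / w ^ 2)
    (h2 : qform z / w ^ 2 = qform y / w ^ 2) : y - x ∈ vbox P D w := by
  rw [mem_vbox] at hx hy hz ⊢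
  have hlift : ∀ i, (x i).valMinAbs + (z i).valMinAbs - 2 * (y i).valMinAbs = 0 := by
    intro i
    apply Int.eq_zero_of_abs_lt_dvd (m := (P : ℤ))
    · rw [← ZMod.intCast_zmod_eq_zero_iff_dvd]
      push_cast
      have := congrFun hxyz i
      simp only [Pi.add_apply, Pi.smul_apply, nsmul_eq_mul] at this
      rw [this]; push_cast; ring
    · have := hx i; have := hy i; have := hz i
      rw [abs_lt]
      constructor <;> omega
  have hcast : ∀ t : Fin D → ZMod P, ((qform t : ℕ) : ℤ) = ∑ i, (t i).valMinAbs ^ 2 := by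
    intro t
    simp [qform]
  have hsum : ((qform x : ℕ) : ℤ) + qform z - 2 * qform y
      = 2 * ∑ i, ((y i).valMinAbs - (x i).valMinAbs) ^ 2 := by
    rw [hcast, hcast, hcast, Finset.mul_sum, Finset.mul_sum, ← Finset.sum_add_distrib,
      ← Finset.sum_sub_distrib]
    refine Finset.sum_congr rfl fun i _ => ?_
    have : (z i).valMinAbs = 2 * (y i).valMinAbs - (x i).valMinAbs := by linarith [hlift i]
    rw [this]; ring
  have hW : 0 < w ^ 2 := by positivity
  have hsmall : ∑ i, ((y i).valMinAbs - (x i).valMinAbs) ^ 2 < (w : ℤ) ^ 2 := by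
    have a1 := Nat.div_add_mod (qform x) (w ^ 2)
    have a2 := Nat.div_add_mod (qform y) (w ^ 2)
    have a3 := Nat.div_add_mod (qform z) (w ^ 2)
    have b1 := Nat.mod_lt (qform x) hW
    have b3 := Nat.mod_lt (qform z) hW
    rw [h1] at a1
    rw [h2] at a3
    zify at a1 a2 a3 b1 b3
    have b2 : (0:ℤ) ≤ (qform y : ℤ) % (w : ℤ) ^ 2 := Int.emod_nonneg _ (by positivity)
    linarith
  intro i
  have hi : ((y i).valMinAbs - (x i).valMinAbs) ^ 2 < (w : ℤ) ^ 2 :=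
    lt_of_le_of_lt (Finset.single_le_sum (f := fun i => ((y i).valMinAbs - (x i).valMinAbs) ^ 2)
      (fun _ _ => sq_nonneg _) (Finset.mem_univ i)) hsmall
  have hi2 := abs_lt_of_sq_lt_sq hi (by positivity)
  have e : (y - x) i = (((y i).valMinAbs - (x i).valMinAbs : ℤ) : ZMod P) := by simp
  rw [e]
  apply vb_intCast
  rw [abs_lt] at hi2
  omega

lemma construct {P D Q L w s N X M K : ℕ} [Fact P.Prime] (hP2 : P ≠ 2) [NeZero K]
    (hD : 1 ≤ D) (hQ : 20 ≤ Q) (hQP : Q ≤ P)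
    (hl : 12 * Q * L ≤ P) (hl' : P ≤ 12 * Q * (L + 1)) (hX : X = Q ^ (2 * D)) (hXP : X ≤ P)
    (hs : 1 ≤ s) (hw : 1 ≤ w) (hsw : 3 * s * w ≤ P) (hN : 8 * N ≤ s ^ D) (hNP : N ≤ P)
    (hK : D * L ^ 2 / w ^ 2 < K) (hM : 2 * (M : ℝ) ^ 3 * (8 * L + 1) ^ D < (P : ℝ) ^ D)
    (hexp : 2 * (N : ℝ) ^ 2 * Real.exp (-(1 / (144 ^ D * s * K) * M)) ≤ 1) :
    ∃ B ⊆ Finset.Icc 1 N, No3APF B ∧ ¬ HasAPF (Finset.Icc 1 N \ B) X := by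
  classical
  have hPpos := (Fact.out : P.Prime).pos
  have hLP : 4 * L < P := by nlinarith
  obtain ⟨θ, hθ⟩ := exists_theta hD hQ hQP hl hX hXP hs hw hsw hN hNP
  set lab : (Fin D → ZMod P) → ZMod K := fun x => ((qform x / w ^ 2 : ℕ) : ZMod K) with hlab
  set Hit : ℕ × ℕ → Finset ((Fin D → ZMod P) × ZMod K) := fun t =>
    (Finset.univ.filter (fun z : (Fin D → ZMod P) × ZMod K => ∃ j < X,
      t.1 • θ + j • (t.2 • θ) - z.1 ∈ vbox P D L ∧
        lab (t.1 • θ + j • (t.2 • θ) - z.1) = z.2)) with hHit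
  have hP0 : (0:ℝ) < P := by exact_mod_cast hPpos
  have hK0 : (0:ℝ) < K := by exact_mod_cast Nat.pos_of_ne_zero (NeZero.ne K)
  have hs0 : (0:ℝ) < s := by exact_mod_cast hs
  have hQ0 : (0:ℝ) < Q := by positivity
  have hX0 : (0:ℝ) < X := by rw [hX]; positivity
  obtain ⟨ω, hω1, hω2⟩ := exists_omega (M := M) (V := Fin D → ZMod P) (Z := ZMod K)
    (fun i j k h => crossHom_surj hP2 i j k h) (vbox P D (4 * L))
    (by
      have h1 : (Fintype.card (Fin D → ZMod P) : ℝ) = (P : ℝ) ^ D := by simp [ZMod.card]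
      rw [h1]
      refine lt_of_le_of_lt ?_ hM
      gcongr
      have := card_vbox_le P D (4 * L)
      calc ((vbox P D (4 * L)).card : ℝ) ≤ (((2 * (4 * L) + 1) ^ D : ℕ) : ℝ) := by
            exact_mod_cast this
        _ = _ := by push_cast; ring)
    (Finset.Icc 1 N ×ˢ Finset.Ioo 0 N) Hit (1 / (144 ^ D * s * K))
    (by
      rintro ⟨a, d⟩ had
      simp only [Finset.mem_product, Finset.mem_Ioo] at had
      have h1 := hit_card (L := L) (X := X) lab (a • θ) (d • θ) (by omega)
      have h2 := (hθ d had.2.1 had.2.2).2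
      have h3 : ((X * (L + 1) ^ D : ℕ) : ℝ) ≤
          hcount P D (2 * L) X (d • θ) * (Hit (a, d)).card := by
        exact_mod_cast h1
      have h4 : ((X * (L + 1) ^ D : ℕ) : ℝ) ≤
          ((X : ℝ) * 12 ^ D * s / Q ^ D) * (Hit (a, d)).card :=
        h3.trans (by gcongr)
      have h5 : (P : ℝ) ^ D ≤ (12 * Q * (L + 1)) ^ D := by
        gcongr; exact_mod_cast hl'
      have h6 : (Fintype.card ((Fin D → ZMod P) × ZMod K) : ℝ) = (P : ℝ) ^ D * K := by
        simp [ZMod.card]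
      rw [h6]
      have h7 : 1 / (144 ^ D * s * K) * ((P : ℝ) ^ D * K) = (P : ℝ) ^ D / (144 ^ D * s) := by
        field_simp
      rw [h7, div_le_iff₀ (by positivity)]
      have h8 : ((L : ℝ) + 1) ^ D ≤ 12 ^ D * s / Q ^ D * (Hit (a, d)).card := by
        refine le_of_mul_le_mul_left ?_ hX0
        push_cast at h4
        calc _ ≤ _ := h4
          _ = _ := by ring
      calc (P : ℝ) ^ D ≤ (12 * Q * (L + 1)) ^ D := h5
        _ = 12 ^ D * Q ^ D * ((L : ℝ) + 1) ^ D := by rw [mul_pow, mul_pow]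
        _ ≤ 12 ^ D * Q ^ D * (12 ^ D * s / Q ^ D * (Hit (a, d)).card) := by gcongr
        _ = _ := by
            have : (144 : ℝ) ^ D = 12 ^ D * 12 ^ D := by rw [← mul_pow]; norm_num
            rw [this]
            field_simp)
    (by
      refine le_trans ?_ hexp
      gcongr
      rw [Finset.card_product]
      push_cast
      rw [sq]
      gcongr
      · simp
      · simp)
  set B := (Finset.Icc 1 N).filter (fun n => ∃ i, n • θ - (ω i).1 ∈ vbox P D L ∧
    lab (n • θ - (ω i).1) = (ω i).2) with hB
  refine ⟨B, Finset.filter_subset _ _, ?_, ?_⟩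
  · intro a d hd ha had had2
    rw [hB, Finset.mem_filter] at ha had had2
    obtain ⟨haI, i, hi1, hi2⟩ := ha
    obtain ⟨-, j, hj1, hj2⟩ := had
    obtain ⟨hbI, k, hk1, hk2⟩ := had2
    rw [Finset.mem_Icc] at haI hbI
    have hbad := (hθ d hd (by omega)).1
    by_cases hijk : i = j ∧ j = k
    · obtain ⟨rfl, rfl⟩ := hijk
      have hx : a • θ - (ω i).1 + ((a + 2 * d) • θ - (ω i).1)
          = 2 • ((a + d) • θ - (ω i).1) := by
        rw [add_nsmul, add_nsmul, mul_nsmul']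
        abel
      have := shell_free hLP hw hi1 hj1 hk1 hx
        (shell_eq hK hi1 hj1 (hi2.trans hj2.symm)) (shell_eq hK hk1 hj1 (hk2.trans hj2.symm))
      apply hbad
      have e : (a + d) • θ - (ω i).1 - (a • θ - (ω i).1) = d • θ := by
        rw [add_nsmul]; abel
      rwa [e] at this
    · apply hω1 i j k hijk
      have e : (ω i).1 + (ω k).1 - 2 • (ω j).1 = (-(a • θ - (ω i).1) + -((a + 2 * d) • θ - (ω k).1))
          + (((a + d) • θ - (ω j).1) + ((a + d) • θ - (ω j).1)) := by
        rw [add_nsmul, add_nsmul, mul_nsmul']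
        abel
      rw [mem_vbox] at hi1 hj1 hk1
      rw [e, mem_vbox]
      intro l
      have := vb_add (vb_add (vb_neg (hi1 l)) (vb_neg (hk1 l))) (vb_add (hj1 l) (hj1 l))
      have e2 : 4 * L = L + L + (L + L) := by ring
      rw [e2]
      exact this
  · rintro ⟨a, d, hd, hap⟩
    have hX2 : 2 ≤ X := by
      rw [hX]
      calc 2 ≤ Q := by omega
        _ ≤ Q ^ (2 * D) := Nat.le_self_pow (by omega) Q
    have h0 := hap 0 (by omega)
    have h1 := hap 1 (by omega)
    rw [Finset.mem_sdiff, Finset.mem_Icc] at h0 h1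
    have hmem : (a, d) ∈ (Finset.Icc 1 N ×ˢ Finset.Ioo 0 N) := by
      simp only [Finset.mem_product, Finset.mem_Icc, Finset.mem_Ioo]
      omega
    obtain ⟨i, hi⟩ := hω2 (a, d) hmem
    rw [hHit, Finset.mem_filter] at hi
    obtain ⟨-, j, hj, hj1, hj2⟩ := hi
    have h2 := hap j hj
    rw [Finset.mem_sdiff] at h2
    apply h2.2
    rw [hB, Finset.mem_filter]
    have e : (a + j * d) • θ = a • θ + j • (d • θ) := by
      rw [add_nsmul, mul_nsmul']
    refine ⟨h2.1, i, ?_⟩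
    rw [e]
    exact ⟨hj1, hj2⟩

end construct

lemma main_params (D : ℕ) (hD : 5 ≤ D) (N : ℕ) (hN : 8 * N ≤ 2 ^ (D ^ 4)) :
    ∃ B ⊆ Finset.Icc 1 N, No3APF B ∧ ¬ HasAPF (Finset.Icc 1 N \ B) (2 ^ (24 * D ^ 3)) := by
  obtain ⟨Q, hQdef⟩ : ∃ Q, Q = 2 ^ (12 * D ^ 2) := ⟨_, rfl⟩
  obtain ⟨s, hsdef⟩ : ∃ s, s = 2 ^ (D ^ 3) := ⟨_, rfl⟩
  obtain ⟨K, hKdef⟩ : ∃ K, K = 2 ^ (2 * D ^ 3 + D) := ⟨_, rfl⟩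
  obtain ⟨M, hMdef⟩ : ∃ M, M = 2 ^ (4 * D ^ 3 - 1) := ⟨_, rfl⟩
  obtain ⟨X, hXdef⟩ : ∃ X, X = 2 ^ (24 * D ^ 3) := ⟨_, rfl⟩
  rw [← hXdef]
  have hD3 : 25 * D ≤ D ^ 3 := by nlinarith [Nat.mul_le_mul hD hD]
  have hD2 : 25 ≤ D ^ 2 := by nlinarith
  have hQ1 : 20 ≤ Q := by
    rw [hQdef]
    calc 20 ≤ 2 ^ 5 := by norm_num
      _ ≤ _ := Nat.pow_le_pow_right (by norm_num) (by omega)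
  have hs1 : 1 ≤ s := by rw [hsdef]; exact Nat.one_le_two_pow
  have hKpos : 0 < K := by rw [hKdef]; positivity
  obtain ⟨P, hPge, hPp⟩ := Nat.exists_infinite_primes (X + N + 12 * Q + 6 * s + 3)
  have : Fact P.Prime := ⟨hPp⟩
  have : NeZero K := ⟨hKpos.ne'⟩
  obtain ⟨L, hL⟩ : ∃ L, L = P / (12 * Q) := ⟨_, rfl⟩
  obtain ⟨w, hw⟩ : ∃ w, w = P / (3 * s) := ⟨_, rfl⟩
  have hl : 12 * Q * L ≤ P := by rw [hL]; exact Nat.mul_div_le _ _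
  have hl' : P < 12 * Q * (L + 1) := by
    rw [hL]; exact Nat.lt_mul_div_succ _ (by omega)
  have hsw : 3 * s * w ≤ P := by rw [hw]; exact Nat.mul_div_le _ _
  have hsw' : P < 3 * s * (w + 1) := by
    rw [hw]; exact Nat.lt_mul_div_succ _ (by omega)
  have hL1 : 1 ≤ L := by
    rw [hL]; exact (Nat.one_le_div_iff (by omega)).2 (by omega)
  have hw1 : 1 ≤ w := by
    rw [hw]; exact (Nat.one_le_div_iff (by omega)).2 (by omega)
  have hLsw : L ≤ s * w := by
    have h1 : 3 * s * (w + 1) ≤ 6 * (s * w) := by nlinarith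
    have h2 : 12 * L ≤ 12 * Q * L := by nlinarith
    omega
  have hMQ : 2 * M ^ 3 < Q ^ D := by
    rw [hMdef, hQdef, ← pow_mul, ← pow_mul, ← pow_succ']
    apply Nat.pow_lt_pow_right (by norm_num)
    have : 12 * D ^ 2 * D = 12 * D ^ 3 := by ring
    omega
  have hLQ : (8 * L + 1) * Q ≤ P := by nlinarith
  refine construct (P := P) (D := D) (Q := Q) (L := L) (w := w) (s := s) (N := N) (X := X) (M := M)
    (K := K) (by omega) (by omega) hQ1 (by omega) hl hl'.le ?_ (by omega) hs1 hw1 hsw ?_ (by omega)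
    ?_ ?_ ?_
  · rw [hXdef, hQdef, ← pow_mul]
    congr 1; ring
  · rw [hsdef, ← pow_mul]
    have e : D ^ 3 * D = D ^ 4 := by ring
    rw [e]; exact hN
  · apply Nat.div_lt_of_lt_mul
    have h1 : L ^ 2 ≤ (s * w) ^ 2 := Nat.pow_le_pow_left hLsw 2
    have h2 : D < 2 ^ D := Nat.lt_two_pow_self
    have h3 : K = 2 ^ D * s ^ 2 := by
      rw [hKdef, hsdef, ← pow_mul, ← pow_add]; congr 1; ring
    calc D * L ^ 2 ≤ D * (s * w) ^ 2 := Nat.mul_le_mul_left _ h1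
      _ < 2 ^ D * (s * w) ^ 2 := Nat.mul_lt_mul_of_pos_right h2 (by positivity)
      _ = w ^ 2 * K := by rw [h3]; ring
  · have h1 : (8 * L + 1) ^ D * Q ^ D ≤ P ^ D := by
      rw [← mul_pow]; exact Nat.pow_le_pow_left hLQ D
    have h2 : 2 * M ^ 3 * (8 * L + 1) ^ D < P ^ D := by
      calc 2 * M ^ 3 * (8 * L + 1) ^ D < Q ^ D * (8 * L + 1) ^ D :=
            Nat.mul_lt_mul_of_pos_right hMQ (by positivity)
        _ ≤ P ^ D := by rw [mul_comm]; exact h1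
    exact_mod_cast h2
  · have h1 : 2 * D ^ 4 * (144 ^ D * s * K) ≤ M := by
      have a1 : D ^ 4 ≤ (2 ^ D) ^ 4 := Nat.pow_le_pow_left Nat.lt_two_pow_self.le 4
      have a2 : 144 ^ D ≤ (2 ^ 8) ^ D := Nat.pow_le_pow_left (by norm_num) D
      calc 2 * D ^ 4 * (144 ^ D * s * K) ≤ 2 * (2 ^ D) ^ 4 * ((2 ^ 8) ^ D * s * K) := by gcongr
        _ = 2 ^ (1 + D * 4 + 8 * D + D ^ 3 + (2 * D ^ 3 + D)) := by
            rw [hsdef, hKdef, ← pow_mul, ← pow_mul]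
            simp only [pow_add, pow_one]; ring
        _ ≤ M := by
            rw [hMdef]
            apply Nat.pow_le_pow_right (by norm_num)
            omega
    have h1' : (2 * D ^ 4 : ℝ) * (144 ^ D * s * K) ≤ M := by exact_mod_cast h1
    have hpos : (0 : ℝ) < 144 ^ D * s * K := by
      have : (0 : ℝ) < s := by exact_mod_cast hs1
      have : (0 : ℝ) < K := by exact_mod_cast hKpos
      positivity
    have h2 : (2 * D ^ 4 : ℝ) ≤ 1 / (144 ^ D * s * K) * M := by
      rw [one_div_mul_eq_div, le_div_iff₀ hpos]; exact h1'
    have h3 : Real.exp (-(1 / (144 ^ D * s * K) * M)) ≤ Real.exp (-(2 * D ^ 4 : ℝ)) :=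
      Real.exp_le_exp.2 (by linarith)
    have h4 : (2 : ℝ) ^ (2 * D ^ 4) ≤ Real.exp (2 * D ^ 4 : ℝ) := by
      have : Real.exp (2 * D ^ 4 : ℝ) = Real.exp 1 ^ (2 * D ^ 4) := by
        rw [← Real.exp_nat_mul]; push_cast; ring_nf
      rw [this]
      gcongr
      linarith [Real.add_one_le_exp (1 : ℝ)]
    have h5 : 2 * N ^ 2 ≤ 2 ^ (2 * D ^ 4) := by
      calc 2 * N ^ 2 ≤ (8 * N) ^ 2 := by nlinarith
        _ ≤ (2 ^ (D ^ 4)) ^ 2 := Nat.pow_le_pow_left hN 2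
        _ = _ := by rw [← pow_mul]; congr 1; ring
    have h5' : 2 * (N : ℝ) ^ 2 ≤ 2 ^ (2 * D ^ 4) := by exact_mod_cast h5
    calc 2 * (N : ℝ) ^ 2 * Real.exp (-(1 / (144 ^ D * s * K) * M))
        ≤ Real.exp (2 * D ^ 4 : ℝ) * Real.exp (-(2 * D ^ 4 : ℝ)) := by
          gcongr
          linarith
      _ = 1 := by rw [← Real.exp_add]; simp

lemma HasAPF.mono {S : Finset ℕ} {k k' : ℕ} (h : k ≤ k') (H : HasAPF S k') : HasAPF S k := by
  obtain ⟨a, d, hd, hap⟩ := H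
  exact ⟨a, d, hd, fun j hj => hap j (by omega)⟩

lemma two_pow_le_exp (n : ℕ) : (2 : ℝ) ^ n ≤ Real.exp n := by
  have : Real.exp (n : ℝ) = Real.exp 1 ^ n := by
    rw [← Real.exp_nat_mul]; simp
  rw [this]
  gcongr
  linarith [Real.add_one_le_exp (1 : ℝ)]

lemma exp_half_le_two_pow (n : ℕ) : Real.exp (n / 2 : ℝ) ≤ (2 : ℝ) ^ n := by
  have : (2 : ℝ) ^ n = Real.exp (n * Real.log 2) := by
    rw [Real.exp_nat_mul, Real.exp_log (by norm_num)]
  rw [this]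
  apply Real.exp_le_exp.2
  have := Real.log_two_gt_d9
  have hn : (0 : ℝ) ≤ n := Nat.cast_nonneg n
  nlinarith

lemma part_one (N : ℕ) (hN0 : ⌈Real.exp 81⌉₊ ≤ N) :
    ∃ B ⊆ Finset.Icc 1 N, No3APF B ∧
      ¬ HasAPF (Finset.Icc 1 N \ B)
        ⌈Real.exp (648 * Real.log N ^ ((3:ℝ)/4) * Real.log (Real.log N) ^ ((1:ℝ)/4))⌉₊ := by
  have hNe : Real.exp 81 ≤ N := Nat.ceil_le.1 hN0
  have hNpos : (0 : ℝ) < N := lt_of_lt_of_le (Real.exp_pos _) hNe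
  have hlog : 81 ≤ Real.log N := (Real.le_log_iff_exp_le hNpos).2 hNe
  have hll : 1 ≤ Real.log (Real.log N) := by
    rw [Real.le_log_iff_exp_le (by linarith)]
    linarith [Real.exp_one_lt_d9]
  obtain ⟨t, ht⟩ : ∃ t, t = Real.log N ^ ((1:ℝ)/4) := ⟨_, rfl⟩
  have ht0 : 0 ≤ t := by rw [ht]; exact Real.rpow_nonneg (by linarith) _
  have ht4 : t ^ 4 = Real.log N := by
    rw [ht, ← Real.rpow_natCast, ← Real.rpow_mul (by linarith)]
    norm_num
  have ht3 : Real.log N ^ ((3:ℝ)/4) = t ^ 3 := by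
    rw [ht, ← Real.rpow_natCast, ← Real.rpow_mul (by linarith)]
    norm_num
  have ht1 : 3 ≤ t := by
    by_contra hc
    push Not at hc
    have : t ^ 4 < 3 ^ 4 := pow_lt_pow_left₀ hc ht0 (by norm_num)
    linarith
  obtain ⟨D, hD⟩ : ∃ D, D = ⌈2 * t⌉₊ := ⟨_, rfl⟩
  have hDl : 2 * t ≤ D := by rw [hD]; exact Nat.le_ceil _
  have hDu : (D : ℝ) ≤ 3 * t := by
    have := Nat.ceil_lt_add_one (a := 2 * t) (by linarith)
    rw [← hD] at this
    linarith
  have hD5 : 5 ≤ D := by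
    have : (5 : ℝ) ≤ D := by linarith
    exact_mod_cast this
  have hD4 : 16 * Real.log N ≤ (D : ℝ) ^ 4 := by
    rw [← ht4]
    calc 16 * t ^ 4 = (2 * t) ^ 4 := by ring
      _ ≤ _ := by gcongr
  have hN : 8 * N ≤ 2 ^ (D ^ 4) := by
    have h1 : (8 * N : ℝ) ≤ 2 ^ (D ^ 4) := by
      refine le_trans ?_ (exp_half_le_two_pow (D ^ 4))
      calc (8 * N : ℝ) ≤ Real.exp 81 * N := by
            gcongr
            linarith [Real.add_one_le_exp (81 : ℝ)]
        _ ≤ Real.exp (Real.log N) * Real.exp (Real.log N) := by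
            rw [Real.exp_log hNpos]; gcongr
        _ = Real.exp (Real.log N + Real.log N) := by rw [Real.exp_add]
        _ ≤ _ := by
            apply Real.exp_le_exp.2
            push_cast
            linarith
    exact_mod_cast h1
  obtain ⟨B, hB, hB3, hBX⟩ := main_params D hD5 N hN
  refine ⟨B, hB, hB3, fun H => hBX (H.mono ?_)⟩
  have h2 : ((2 ^ (24 * D ^ 3) : ℕ) : ℝ) ≤
      Real.exp (648 * Real.log N ^ ((3:ℝ)/4) * Real.log (Real.log N) ^ ((1:ℝ)/4)) := by
    push_cast
    refine le_trans (two_pow_le_exp _) (Real.exp_le_exp.2 ?_)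
    rw [ht3]
    have h3 : 1 ≤ Real.log (Real.log N) ^ ((1:ℝ)/4) := Real.one_le_rpow hll (by norm_num)
    push_cast
    calc (24 * D ^ 3 : ℝ) ≤ 24 * (3 * t) ^ 3 := by gcongr
      _ = 648 * t ^ 3 * 1 := by ring
      _ ≤ _ := by gcongr
  exact_mod_cast h2.trans (Nat.le_ceil _)

lemma part_two (k : ℕ) (hk0 : ⌈Real.exp 3375⌉₊ ≤ k) :
    ∃ N : ℕ,
      (k : ℝ) ^ ((1 / 1024 : ℝ) * (Real.log k / Real.log (Real.log k)) ^ ((1:ℝ)/3)) ≤ (N : ℝ) ∧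
      ∃ B ⊆ Finset.Icc 1 N, No3APF B ∧ ¬ HasAPF (Finset.Icc 1 N \ B) k := by
  have hke : Real.exp 3375 ≤ k := Nat.ceil_le.1 hk0
  have hkpos : (0 : ℝ) < k := lt_of_lt_of_le (Real.exp_pos _) hke
  have hlog : 3375 ≤ Real.log k := (Real.le_log_iff_exp_le hkpos).2 hke
  have hll : 1 ≤ Real.log (Real.log k) := by
    rw [Real.le_log_iff_exp_le (by linarith)]
    linarith [Real.exp_one_lt_d9]
  obtain ⟨u, hu⟩ : ∃ u, u = Real.log k ^ ((1:ℝ)/3) := ⟨_, rfl⟩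
  have hu0 : 0 ≤ u := by rw [hu]; exact Real.rpow_nonneg (by linarith) _
  have hu3 : u ^ 3 = Real.log k := by
    rw [hu, ← Real.rpow_natCast, ← Real.rpow_mul (by linarith)]
    norm_num
  have hu1 : 15 ≤ u := by
    by_contra hc
    push Not at hc
    have : u ^ 3 < 15 ^ 3 := pow_lt_pow_left₀ hc hu0 (by norm_num)
    linarith
  obtain ⟨D, hD⟩ : ∃ D, D = ⌊u / 3⌋₊ := ⟨_, rfl⟩
  have hDu : (D : ℝ) ≤ u / 3 := by rw [hD]; exact Nat.floor_le (by linarith)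
  have hDl : u / 4 ≤ D := by
    have := Nat.lt_floor_add_one (u / 3)
    rw [← hD] at this
    linarith
  have hD5 : 5 ≤ D := by
    rw [hD]
    apply Nat.le_floor
    push_cast
    linarith
  have hD4 : 625 ≤ D ^ 4 := by
    calc 625 = 5 ^ 4 := by norm_num
      _ ≤ D ^ 4 := Nat.pow_le_pow_left hD5 4
  have hN : 8 * 2 ^ (D ^ 4 - 3) ≤ 2 ^ (D ^ 4) := by
    have : D ^ 4 = (D ^ 4 - 3) + 3 := by omega
    conv_rhs => rw [this, pow_add]
    omega
  obtain ⟨B, hB, hB3, hBX⟩ := main_params D hD5 _ hN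
  refine ⟨2 ^ (D ^ 4 - 3), ?_, B, hB, hB3, fun H => hBX (H.mono ?_)⟩
  · push_cast
    refine le_trans ?_ (exp_half_le_two_pow (D ^ 4 - 3))
    rw [Real.rpow_def_of_pos hkpos]
    apply Real.exp_le_exp.2
    have h1 : (Real.log k / Real.log (Real.log k)) ^ ((1:ℝ)/3) ≤ u := by
      rw [hu]
      apply Real.rpow_le_rpow
      · apply div_nonneg <;> linarith
      · exact div_le_self (by linarith) hll
      · norm_num
    have h2 : (D ^ 4 : ℝ) / 2 ≤ ((D ^ 4 - 3 : ℕ) : ℝ) := by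
      have h3 : (625 : ℝ) ≤ D ^ 4 := by exact_mod_cast hD4
      rw [Nat.cast_sub (by omega)]
      push_cast
      linarith
    have h4 : (u / 4) ^ 4 ≤ (D : ℝ) ^ 4 := by gcongr
    calc Real.log k * (1 / 1024 * (Real.log k / Real.log (Real.log k)) ^ ((1:ℝ)/3))
        ≤ u ^ 3 * (1 / 1024 * u) := by
          rw [hu3]
          gcongr
      _ = (u / 4) ^ 4 / 4 := by ring
      _ ≤ _ := by linarith
  · have h2 : ((2 ^ (24 * D ^ 3) : ℕ) : ℝ) ≤ k := by
      push_cast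
      refine le_trans (two_pow_le_exp _) ?_
      rw [← Real.le_log_iff_exp_le hkpos, ← hu3]
      push_cast
      calc (24 * D ^ 3 : ℝ) ≤ 24 * (u / 3) ^ 3 := by gcongr
        _ = 24 / 27 * u ^ 3 := by ring
        _ ≤ u ^ 3 := by nlinarith [pow_nonneg hu0 3]
    exact_mod_cast h2

theorem statement0 :
    ∃ C c : ℝ, 0 < C ∧ 0 < c ∧
      (∃ N₀ : ℕ, ∀ N : ℕ, N₀ ≤ N →
        ∃ B ⊆ Finset.Icc 1 N, No3APF B ∧
          ¬ HasAPF (Finset.Icc 1 N \ B)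
            ⌈Real.exp (C * Real.log N ^ ((3:ℝ)/4) * Real.log (Real.log N) ^ ((1:ℝ)/4))⌉₊) ∧
      (∃ k₀ : ℕ, ∀ k : ℕ, k₀ ≤ k →
        ∃ N : ℕ,
          (k : ℝ) ^ (c * (Real.log k / Real.log (Real.log k)) ^ ((1:ℝ)/3)) ≤ (N : ℝ) ∧
          ∃ B ⊆ Finset.Icc 1 N, No3APF B ∧ ¬ HasAPF (Finset.Icc 1 N \ B) k) := by
  exact ⟨648, 1 / 1024, by norm_num, by norm_num, ⟨_, part_one⟩, ⟨_, part_two⟩⟩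
end

section
/- There is an absolute constant C > 0 such that for every sufficiently large integer r and every integer N > exp(C·r⁴·log r), there exists a set B ⊆ {1,…,N} containing no nontrivial 3-term arithmetic progression and such that {1,…,N} \ B contains no arithmetic progression of length ⌈N^{1/r}⌉. -/
namespace VdW
open Finset

section oneD
variable {Q : ℕ} [NeZero Q]

/-- The standard additive character of `ZMod Q`. -/
noncomputable def ee (t : ZMod Q) : ℂ := ZMod.stdAddChar t

/-- Chordal distance of `t / Q` to `0` on the circle. -/
noncomputable def nn (t : ZMod Q) : ℝ := ‖1 - ee t‖

lemma ee_zero : ee (0 : ZMod Q) = 1 := by simp [ee]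

lemma ee_add (s t : ZMod Q) : ee (s + t) = ee s * ee t := by
  simp [ee, AddChar.map_add_eq_mul]

lemma norm_ee (t : ZMod Q) : ‖ee t‖ = 1 := by
  simp only [ee, ZMod.stdAddChar_apply]; exact Circle.norm_coe _

lemma ee_neg (t : ZMod Q) : ee (-t) = (starRingEnd ℂ) (ee t) := by
  have h1 : ee (-t) * ee t = 1 := by rw [← ee_add]; simp [ee_zero]
  have h2 : (starRingEnd ℂ) (ee t) * ee t = 1 := by
    rw [Complex.conj_mul', norm_ee]; norm_num
  have h0 : ee t ≠ 0 := by
    intro h; have := norm_ee t; rw [h] at this; simp at this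
  exact mul_right_cancel₀ h0 (h1.trans h2.symm)

lemma ee_nat_mul (j : ℕ) (t : ZMod Q) : ee ((j : ZMod Q) * t) = ee t ^ j := by
  induction j with
  | zero => simp [ee_zero]
  | succ n ih => push_cast; rw [add_mul, one_mul, ee_add, ih, pow_succ]

lemma ee_sum {ι : Type*} (s : Finset ι) (f : ι → ZMod Q) :
    ee (∑ i ∈ s, f i) = ∏ i ∈ s, ee (f i) := by
  classical
  induction s using Finset.induction_on with
  | empty => simp [ee_zero]
  | insert a s ha ih => rw [sum_insert ha, prod_insert ha, ee_add, ih]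

lemma nn_nonneg (t : ZMod Q) : 0 ≤ nn t := norm_nonneg _

lemma nn_zero : nn (0 : ZMod Q) = 0 := by simp [nn, ee_zero]

lemma nn_neg (t : ZMod Q) : nn (-t) = nn t := by
  unfold nn
  rw [ee_neg, ← Complex.norm_conj]; simp

lemma nn_add (s t : ZMod Q) : nn (s + t) ≤ nn s + nn t := by
  unfold nn
  have : 1 - ee (s + t) = (1 - ee s) + ee s * (1 - ee t) := by rw [ee_add]; ring
  rw [this]
  refine (norm_add_le _ _).trans ?_
  rw [norm_mul, norm_ee, one_mul]

lemma nn_sq (t : ZMod Q) : nn t ^ 2 = 2 - 2 * (ee t).re := by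
  have h := norm_ee t
  unfold nn
  rw [← Complex.normSq_eq_norm_sq, Complex.normSq_apply]
  have h2 : (ee t).re * (ee t).re + (ee t).im * (ee t).im = 1 := by
    rw [← Complex.normSq_apply, Complex.normSq_eq_norm_sq, h]; norm_num
  simp
  linarith

lemma nn_second_diff (v h : ZMod Q) :
    nn (v - h) ^ 2 + nn (v + h) ^ 2 - 2 * nn v ^ 2 = 2 * (ee v).re * nn h ^ 2 := by
  simp only [nn_sq]
  rw [sub_eq_add_neg v h, ee_add, ee_add, ee_neg]
  simp
  ring

lemma sum_ee_mul (b : ZMod Q) : ∑ t : ZMod Q, ee (b * t) = if b = 0 then (Q : ℂ) else 0 := by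
  have h := AddChar.sum_mulShift (R := ZMod Q) (R' := ℂ) b (ZMod.isPrimitive_stdAddChar Q)
  simp only [ZMod.card] at h
  have h2 : ((if b = 0 then Q else 0 : ℕ) : ℂ) = if b = 0 then (Q : ℂ) else 0 := by
    split_ifs <;> simp
  rw [← h2, ← h]
  refine Finset.sum_congr rfl fun x _ => ?_
  rw [mul_comm]; rfl

lemma nn_ge (t : ZMod Q) : 4 * |(t.valMinAbs : ℝ)| / Q ≤ nn t := by
  have hQ : (0 : ℝ) < Q := by exact_mod_cast Nat.pos_of_ne_zero (NeZero.ne Q)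
  set v : ℤ := t.valMinAbs with hv
  have ht : t = (v : ZMod Q) := by rw [hv, ZMod.coe_valMinAbs]
  have h1 : |(v : ℝ)| ≤ Q / 2 := by
    have h := ZMod.natAbs_valMinAbs_le t
    have h2 : ((t.valMinAbs.natAbs : ℕ) : ℝ) ≤ Q / 2 := by
      have : ((t.valMinAbs.natAbs : ℕ) : ℝ) ≤ ((Q / 2 : ℕ) : ℝ) := by exact_mod_cast h
      exact this.trans Nat.cast_div_le
    rwa [Nat.cast_natAbs, Int.cast_abs] at h2
  have h3 : nn t = 2 * |Real.sin (Real.pi * v / Q)| := by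
    have e1 : ee t = Complex.exp (((2 * Real.pi * v / Q : ℝ)) * Complex.I) := by
      unfold ee
      rw [ht, ZMod.stdAddChar_coe]
      congr 1
      push_cast; ring
    have e2 : nn t ^ 2 = (2 * |Real.sin (Real.pi * v / Q)|) ^ 2 := by
      rw [nn_sq, e1, Complex.exp_ofReal_mul_I_re, mul_pow, sq_abs]
      have : 2 * Real.pi * v / Q = 2 * (Real.pi * v / Q) := by ring
      rw [this, Real.cos_two_mul']
      have := Real.sin_sq_add_cos_sq (Real.pi * v / Q)
      nlinarith
    exact (sq_eq_sq₀ (nn_nonneg t) (by positivity)).1 e2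
  have h4 : |Real.sin (Real.pi * v / Q)| = Real.sin (Real.pi * |(v : ℝ)| / Q) := by
    have hnn : 0 ≤ Real.sin (Real.pi * |(v : ℝ)| / Q) := by
      apply Real.sin_nonneg_of_nonneg_of_le_pi
      · positivity
      · rw [div_le_iff₀ hQ]
        have := Real.pi_pos
        nlinarith [abs_nonneg (v : ℝ)]
    rcases abs_choice (v : ℝ) with h | h
    · rw [h] at hnn ⊢; exact abs_of_nonneg hnn
    · rw [h] at hnn ⊢
      have : Real.pi * -(v : ℝ) / Q = -(Real.pi * v / Q) := by ring
      rw [this, Real.sin_neg] at hnn ⊢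
      exact abs_of_nonpos (by linarith)
  have h5 : 2 / Real.pi * (Real.pi * |(v : ℝ)| / Q) ≤ Real.sin (Real.pi * |(v : ℝ)| / Q) := by
    apply Real.mul_le_sin
    · positivity
    · rw [div_le_div_iff₀ hQ two_pos]
      have := Real.pi_pos
      nlinarith
  have h6 : 2 / Real.pi * (Real.pi * |(v : ℝ)| / Q) = 2 * |(v : ℝ)| / Q := by
    have := Real.pi_ne_zero
    field_simp
  rw [h3, h4]
  rw [h6] at h5
  calc 4 * |(v : ℝ)| / Q = 2 * (2 * |(v : ℝ)| / Q) := by ring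
    _ ≤ _ := by linarith

lemma card_nn_le (τ : ℝ) (hτ : 0 ≤ τ) :
    ((univ.filter (fun t : ZMod Q => nn t ≤ τ)).card : ℝ) ≤ τ * Q / 2 + 1 := by
  have hQ : (0 : ℝ) < Q := by exact_mod_cast Nat.pos_of_ne_zero (NeZero.ne Q)
  set n : ℕ := ⌊τ * Q / 4⌋₊ with hn
  have hmap : ((univ.filter (fun t : ZMod Q => nn t ≤ τ)).card) ≤
      (Finset.Icc (-(n : ℤ)) n).card := by
    apply Finset.card_le_card_of_injOn (fun t => t.valMinAbs)
    · intro t ht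
      have ht' : nn t ≤ τ := by simpa using ht
      have h := (nn_ge t).trans ht'
      rw [div_le_iff₀ hQ] at h
      have h2 : ((t.valMinAbs.natAbs : ℕ) : ℝ) ≤ τ * Q / 4 := by
        rw [Nat.cast_natAbs, Int.cast_abs]; linarith
      have h3 : t.valMinAbs.natAbs ≤ n := Nat.le_floor h2
      simp only [Finset.coe_Icc, Set.mem_Icc]
      omega
    · intro a _ b _ hab
      exact ZMod.injective_valMinAbs hab
  have h1 : (Finset.Icc (-(n : ℤ)) n).card = 2 * n + 1 := by
    rw [Int.card_Icc]; omega
  have h2 : (n : ℝ) ≤ τ * Q / 4 := Nat.floor_le (by positivity)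
  calc ((univ.filter (fun t : ZMod Q => nn t ≤ τ)).card : ℝ) ≤ ((2 * n + 1 : ℕ) : ℝ) := by
        rw [← h1]; exact_mod_cast hmap
    _ = 2 * n + 1 := by push_cast; ring
    _ ≤ _ := by linarith

end oneD

/-- Abstract Parseval identity. -/
lemma parseval {α T : Type*} [DecidableEq α] [Fintype T] (φ : α → T → ℂ) (q : ℝ) (s : Finset α)
    (horth : ∀ a ∈ s, ∀ b ∈ s, ∑ t, φ a t * (starRingEnd ℂ) (φ b t) = if a = b then (q : ℂ) else 0)
    (c : α → ℂ) :
    ∑ t, ‖∑ a ∈ s, c a * φ a t‖ ^ 2 = q * ∑ a ∈ s, ‖c a‖ ^ 2 := by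
  have key : ((∑ t, ‖∑ a ∈ s, c a * φ a t‖ ^ 2 : ℝ) : ℂ) = ((q * ∑ a ∈ s, ‖c a‖ ^ 2 : ℝ) : ℂ) := by
    push_cast
    calc ∑ t, ((‖∑ a ∈ s, c a * φ a t‖ : ℂ)) ^ 2
        = ∑ t, ∑ a ∈ s, ∑ b ∈ s, (c a * (starRingEnd ℂ) (c b)) *
            (φ a t * (starRingEnd ℂ) (φ b t)) := by
          refine Finset.sum_congr rfl fun t _ => ?_
          rw [← Complex.mul_conj', map_sum, Finset.sum_mul_sum]
          refine Finset.sum_congr rfl fun a _ => Finset.sum_congr rfl fun b _ => ?_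
          rw [map_mul]; ring
      _ = ∑ a ∈ s, ∑ b ∈ s, (c a * (starRingEnd ℂ) (c b)) *
            ∑ t, (φ a t * (starRingEnd ℂ) (φ b t)) := by
          rw [Finset.sum_comm]
          refine Finset.sum_congr rfl fun a _ => ?_
          rw [Finset.sum_comm]
          refine Finset.sum_congr rfl fun b _ => ?_
          rw [Finset.mul_sum]
      _ = ∑ a ∈ s, (c a * (starRingEnd ℂ) (c a)) * q := by
          refine Finset.sum_congr rfl fun a ha => ?_
          rw [Finset.sum_eq_single_of_mem a ha]
          · rw [horth a ha a ha, if_pos rfl]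
          · intro b hb hba
            rw [horth a ha b hb, if_neg (Ne.symm hba), mul_zero]
      _ = (q : ℂ) * ∑ a ∈ s, (‖c a‖ : ℂ) ^ 2 := by
          rw [Finset.mul_sum]
          refine Finset.sum_congr rfl fun a _ => ?_
          rw [Complex.mul_conj']; ring
  exact_mod_cast key

section fejer
variable {Q : ℕ} [NeZero Q]

/-- Unnormalised Fejer kernel. -/
noncomputable def fej (R : ℕ) (t : ZMod Q) : ℝ := ‖∑ a ∈ range R, ee ((a : ZMod Q) * t)‖ ^ 2

lemma fej_nonneg (R : ℕ) (t : ZMod Q) : 0 ≤ fej R t := by unfold fej; positivity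

lemma sum_fej (R : ℕ) (hR : R < Q) : ∑ t : ZMod Q, fej R t = R * Q := by
  have h := parseval (T := ZMod Q) (fun (a : ℕ) t => ee ((a : ZMod Q) * t)) (Q : ℝ) (range R) ?_
    (fun _ => 1)
  · simp only [one_mul, norm_one, one_pow, sum_const, card_range, nsmul_eq_mul, mul_one] at h
    unfold fej
    rw [h]; ring
  · intro a ha b hb
    have : ∀ t : ZMod Q, ee ((a : ZMod Q) * t) * (starRingEnd ℂ) (ee ((b : ZMod Q) * t)) =
        ee (((a : ZMod Q) - (b : ZMod Q)) * t) := by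
      intro t
      rw [← ee_neg, ← ee_add]; congr 1; ring
    simp only [this, sum_ee_mul, sub_eq_zero]
    rw [mem_range] at ha hb
    have : ((a : ZMod Q) = (b : ZMod Q)) ↔ a = b := by
      rw [ZMod.natCast_eq_natCast_iff']
      rw [Nat.mod_eq_of_lt (by omega), Nat.mod_eq_of_lt (by omega)]
    simp [this]

lemma sum_fej_nn (R : ℕ) (hR : R < Q) (hR0 : 0 < R) :
    ∑ t : ZMod Q, fej R t * nn t ^ 2 = 2 * Q := by
  have h1 : ∀ t : ZMod Q, fej R t * nn t ^ 2 = 2 - 2 * (ee ((R : ZMod Q) * t)).re := by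
    intro t
    rw [← nn_sq]
    unfold fej nn
    rw [← mul_pow, ← norm_mul]
    congr 2
    simp only [ee_nat_mul]
    have := geom_sum_mul (ee t) R
    linear_combination -this
  simp only [h1]
  rw [sum_sub_distrib, ← mul_sum, ← Complex.re_sum, sum_ee_mul, if_neg]
  · simp [ZMod.card]; ring
  · intro h
    rw [ZMod.natCast_eq_zero_iff] at h
    exact absurd (Nat.le_of_dvd hR0 h) (by omega)

lemma norm_geom_le (k : ℕ) (t : ZMod Q) (τ : ℝ) (hτ : 0 < τ) (ht : τ ≤ nn t) :
    ‖∑ j ∈ range k, ee ((j : ZMod Q) * t)‖ ≤ 2 / τ := by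
  rw [le_div_iff₀ hτ]
  calc ‖∑ j ∈ range k, ee ((j : ZMod Q) * t)‖ * τ
      ≤ ‖∑ j ∈ range k, ee ((j : ZMod Q) * t)‖ * nn t := by gcongr
    _ = ‖1 - ee ((k : ZMod Q) * t)‖ := by
        unfold nn
        rw [← norm_mul]
        simp only [ee_nat_mul]
        have := geom_sum_mul (ee t) k
        congr 1
        linear_combination -this
    _ ≤ ‖(1 : ℂ)‖ + ‖ee ((k : ZMod Q) * t)‖ := norm_sub_le _ _
    _ = 2 := by rw [norm_ee]; norm_num

end fejer
end VdW

namespace VdW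
open Finset

section multi
set_option linter.unusedSectionVars false
variable {Q : ℕ} [NeZero Q] {D : ℕ}

/-- The strictly convex function (near `0`) on the torus. -/
noncomputable def FF (y : Fin D → ZMod Q) : ℝ := ∑ i, nn (y i) ^ 2

/-- Product Fejer kernel. -/
noncomputable def kap (R : ℕ) (y : Fin D → ZMod Q) : ℝ := ∏ i, fej R (y i)

lemma FF_nonneg (y : Fin D → ZMod Q) : 0 ≤ FF y := sum_nonneg fun _ _ => sq_nonneg _

lemma kap_nonneg (R : ℕ) (y : Fin D → ZMod Q) : 0 ≤ kap R y :=
  prod_nonneg fun _ _ => fej_nonneg _ _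

lemma FF_neg (y : Fin D → ZMod Q) : FF (-y) = FF y := by
  simp [FF, nn_neg]

lemma nn_le_of_FF (y : Fin D → ZMod Q) (ρ : ℝ) (hρ : 0 ≤ ρ) (h : FF y ≤ ρ ^ 2) (i : Fin D) :
    nn (y i) ≤ ρ := by
  have h1 : nn (y i) ^ 2 ≤ FF y :=
    single_le_sum (f := fun i => nn (y i) ^ 2) (fun _ _ => sq_nonneg _) (mem_univ i)
  exact (sq_le_sq₀ (nn_nonneg _) hρ).1 (h1.trans h)

lemma sum_prod_pi (f : Fin D → ZMod Q → ℝ) :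
    ∑ y : Fin D → ZMod Q, ∏ i, f i (y i) = ∏ i, ∑ t, f i t := by
  rw [prod_univ_sum]; simp

lemma sum_prod_piC (f : Fin D → ZMod Q → ℂ) :
    ∑ y : Fin D → ZMod Q, ∏ i, f i (y i) = ∏ i, ∑ t, f i t := by
  rw [prod_univ_sum]; simp

lemma sum_kap (R : ℕ) (hR : R < Q) :
    ∑ y : Fin D → ZMod Q, kap R y = ((R : ℝ) * Q) ^ D := by
  unfold kap
  rw [sum_prod_pi (fun _ => fej R)]
  simp [sum_fej R hR]

lemma sum_kap_nn (R : ℕ) (hR : R < Q) (hR0 : 0 < R) (i : Fin D) :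
    R * ∑ y : Fin D → ZMod Q, kap R y * nn (y i) ^ 2 = 2 * ((R : ℝ) * Q) ^ D := by
  have h1 : ∀ y : Fin D → ZMod Q, kap R y * nn (y i) ^ 2 =
      ∏ j, (fun j t => fej R t * if j = i then nn t ^ 2 else 1) j (y j) := by
    intro y
    simp only [kap]
    rw [prod_mul_distrib]
    congr 1
    rw [prod_eq_single i]
    · simp
    · intro b _ hb; simp [hb]
    · simp
  simp only [h1]
  rw [sum_prod_pi (fun j t => fej R t * if j = i then nn t ^ 2 else 1)]
  have h2 : ∀ j : Fin D, (∑ t : ZMod Q, fej R t * if j = i then nn t ^ 2 else 1) =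
      if j = i then 2 * (Q : ℝ) else R * Q := by
    intro j
    split_ifs with h
    · exact sum_fej_nn R hR hR0
    · simp [sum_fej R hR]
  simp only [h2]
  rw [← mul_prod_erase univ _ (mem_univ i), if_pos rfl]
  rw [prod_congr rfl (g := fun _ => (R : ℝ) * Q)]
  · rw [prod_const, card_erase_of_mem (mem_univ i), card_univ, Fintype.card_fin]
    have hD : D = (D - 1) + 1 := by have := i.pos; omega
    conv_rhs => rw [hD, pow_succ]
    ring
  · intro j hj
    rw [if_neg (ne_of_mem_erase hj)]

lemma sum_kap_FF (R : ℕ) (hR : R < Q) (hR0 : 0 < R) :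
    R * ∑ y : Fin D → ZMod Q, kap R y * FF y = 2 * D * ((R : ℝ) * Q) ^ D := by
  unfold FF
  simp only [mul_sum]
  rw [sum_comm]
  have : ∀ i : Fin D, ∑ y : Fin D → ZMod Q, (R : ℝ) * (kap R y * nn (y i) ^ 2) =
      2 * ((R : ℝ) * Q) ^ D := fun i => by
    rw [← mul_sum]; exact sum_kap_nn R hR hR0 i
  simp [this]; ring

/-- The box `[0,R)^D`. -/
def Bx (Q D R : ℕ) : Finset (Fin D → ZMod Q) :=
  Fintype.piFinset fun _ => (range R).image (fun n : ℕ => (n : ZMod Q))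

/-- The difference set of the box. -/
def Dif (Q D R : ℕ) : Finset (Fin D → ZMod Q) :=
  (Bx Q D R ×ˢ Bx Q D R).image (fun p => p.1 - p.2)

lemma card_Bx_le (R : ℕ) : (Bx Q D R).card ≤ R ^ D := by
  unfold Bx
  rw [Fintype.card_piFinset]
  simp only [prod_const, card_univ, Fintype.card_fin]
  exact Nat.pow_le_pow_left (card_image_le.trans (by simp)) _

lemma card_Dif_le (R : ℕ) : (Dif Q D R).card ≤ R ^ (2 * D) := by
  unfold Dif
  refine card_image_le.trans ?_
  rw [card_product, two_mul, pow_add]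
  exact Nat.mul_le_mul (card_Bx_le R) (card_Bx_le R)

lemma kap_eq (R : ℕ) (hR : R < Q) (y : Fin D → ZMod Q) :
    (kap R y : ℂ) = ∑ p ∈ Bx Q D R ×ˢ Bx Q D R, ee ((p.1 - p.2) ⬝ᵥ y) := by
  have hinj : ∀ a ∈ range R, ∀ b ∈ range R, (a : ZMod Q) = (b : ZMod Q) → a = b := by
    intro a ha b hb h
    rw [mem_range] at ha hb
    rw [ZMod.natCast_eq_natCast_iff', Nat.mod_eq_of_lt (by omega), Nat.mod_eq_of_lt (by omega)] at h
    exact h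
  have h1 : kap R y = ‖∑ a ∈ Bx Q D R, ee (a ⬝ᵥ y)‖ ^ 2 := by
    unfold kap fej
    rw [prod_pow, ← norm_prod]
    congr 2
    have : ∀ a : Fin D → ZMod Q, ee (a ⬝ᵥ y) = ∏ i, ee (a i * y i) := fun a => by
      rw [dotProduct, ee_sum]
    simp only [this]
    unfold Bx
    rw [← prod_univ_sum (fun _ => (range R).image (fun n : ℕ => (n : ZMod Q)))
      (fun i t => ee (t * y i))]
    refine prod_congr rfl fun i _ => ?_
    rw [sum_image hinj]
  rw [h1]
  push_cast
  rw [← Complex.mul_conj', map_sum, sum_mul_sum, sum_product]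
  refine sum_congr rfl fun a _ => sum_congr rfl fun b _ => ?_
  rw [← ee_neg, ← ee_add, sub_dotProduct, sub_eq_add_neg]

lemma sum_ee_dot (ξ : Fin D → ZMod Q) :
    ∑ y : Fin D → ZMod Q, ee (ξ ⬝ᵥ y) = if ξ = 0 then (Q : ℂ) ^ D else 0 := by
  have : ∀ y : Fin D → ZMod Q, ee (ξ ⬝ᵥ y) = ∏ i, (fun i t => ee (ξ i * t)) i (y i) := fun y => by
    rw [dotProduct, ee_sum]
  simp only [this]
  rw [sum_prod_piC (fun i t => ee (ξ i * t))]
  simp only [sum_ee_mul]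
  split_ifs with h
  · simp [h]
  · obtain ⟨i, hi⟩ := Function.ne_iff.1 h
    exact prod_eq_zero (mem_univ i) (if_neg hi)

/-- The smoothed orbit counting function. -/
noncomputable def orb (R k : ℕ) (x y : Fin D → ZMod Q) : ℝ :=
  ∑ j ∈ range k, kap R (y - (j : ZMod Q) • x)

/-- Exponential sum along the orbit. -/
noncomputable def SS (k : ℕ) (x ξ : Fin D → ZMod Q) : ℂ :=
  ∑ j ∈ range k, ee ((j : ZMod Q) * (-(ξ ⬝ᵥ x)))

lemma orb_nonneg (R k : ℕ) (x y : Fin D → ZMod Q) : 0 ≤ orb R k x y :=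
  sum_nonneg fun _ _ => kap_nonneg _ _

lemma orb_eq (R k : ℕ) (hR : R < Q) (x y : Fin D → ZMod Q) :
    (orb R k x y : ℂ) = ∑ ξ ∈ Dif Q D R,
      ((((Bx Q D R ×ˢ Bx Q D R).filter (fun p => p.1 - p.2 = ξ)).card : ℂ) * SS k x ξ) *
        ee (ξ ⬝ᵥ y) := by
  have h1 : (orb R k x y : ℂ) = ∑ p ∈ Bx Q D R ×ˢ Bx Q D R,
      SS k x (p.1 - p.2) * ee ((p.1 - p.2) ⬝ᵥ y) := by
    unfold orb SS
    push_cast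
    simp only [kap_eq R hR]
    rw [sum_comm]
    refine sum_congr rfl fun p _ => ?_
    rw [sum_mul]
    refine sum_congr rfl fun j _ => ?_
    rw [← ee_add, dotProduct_sub, dotProduct_smul, smul_eq_mul]
    congr 1; ring
  rw [h1]
  rw [← sum_fiberwise_of_maps_to (s := Bx Q D R ×ˢ Bx Q D R) (t := Dif Q D R)
    (g := fun p => p.1 - p.2) (fun p hp => mem_image_of_mem _ hp)]
  refine sum_congr rfl fun ξ _ => ?_
  rw [sum_congr rfl (g := fun _ => SS k x ξ * ee (ξ ⬝ᵥ y))]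
  · rw [sum_const, nsmul_eq_mul]; ring
  · intro p hp
    rw [(mem_filter.1 hp).2]

lemma sum_orb_sq (R k : ℕ) (hR : R < Q) (x : Fin D → ZMod Q) :
    ∑ y, orb R k x y ^ 2 ≤ (Q : ℝ) ^ D * ((R : ℝ) ^ D) ^ 2 * ∑ ξ ∈ Dif Q D R, ‖SS k x ξ‖ ^ 2 := by
  have h1 : ∀ y, orb R k x y ^ 2 = ‖∑ ξ ∈ Dif Q D R,
      ((((Bx Q D R ×ˢ Bx Q D R).filter (fun p => p.1 - p.2 = ξ)).card : ℂ) * SS k x ξ) *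
        ee (ξ ⬝ᵥ y)‖ ^ 2 := by
    intro y
    rw [← orb_eq R k hR, Complex.norm_real, Real.norm_eq_abs, sq_abs]
  simp only [h1]
  rw [parseval (T := Fin D → ZMod Q) (fun ξ y => ee (ξ ⬝ᵥ y)) ((Q : ℝ) ^ D) (Dif Q D R)]
  · rw [mul_assoc]
    refine mul_le_mul_of_nonneg_left ?_ (by positivity)
    rw [mul_sum]
    refine sum_le_sum fun ξ _ => ?_
    rw [norm_mul, mul_pow]
    refine mul_le_mul_of_nonneg_right ?_ (by positivity)
    refine pow_le_pow_left₀ (norm_nonneg _) ?_ 2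
    rw [Complex.norm_natCast]
    have : ((Bx Q D R ×ˢ Bx Q D R).filter (fun p => p.1 - p.2 = ξ)).card ≤ R ^ D := by
      refine le_trans ?_ (card_Bx_le (Q := Q) (D := D) R)
      refine card_le_card_of_injOn (fun p => p.1) ?_ ?_
      · intro p hp
        exact (mem_product.1 (mem_filter.1 hp).1).1
      · intro p hp p' hp' h
        have e1 := (mem_filter.1 hp).2
        have e2 := (mem_filter.1 hp').2
        have h' : p.1 = p'.1 := h
        refine Prod.ext h' ?_
        have : p.1 - p.2 = p'.1 - p'.2 := e1.trans e2.symm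
        rw [h'] at this
        exact sub_right_injective this
    exact_mod_cast this
  · intro a _ b _
    have : ∀ y : Fin D → ZMod Q, ee (a ⬝ᵥ y) * (starRingEnd ℂ) (ee (b ⬝ᵥ y)) =
        ee ((a - b) ⬝ᵥ y) := by
      intro y
      rw [← ee_neg, ← ee_add, sub_dotProduct, sub_eq_add_neg]
    simp only [this, sum_ee_dot, sub_eq_zero]
    push_cast
    rfl

/-- The orbit of a nonexceptional `x` is spread out. -/
lemma spread (R k : ℕ) (hR : R < Q) (hR0 : 0 < R) (hk : 0 < k) (x : Fin D → ZMod Q)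
    (ρ τ : ℝ) (hρ : 0 < ρ) (hτ : 0 < τ) (T : ℝ)
    (hT : (((Dif Q D R).filter (fun ξ => nn (ξ ⬝ᵥ x) < τ)).card : ℝ) ≤ T)
    (hRτ : (R : ℝ) ^ (2 * D) * (2 / τ) ^ 2 ≤ (k : ℝ) ^ 2)
    (hRρ : 4 * D ≤ R * ρ ^ 2) :
    (Q : ℝ) ^ D ≤ 4 * (T + 1) *
      (univ.filter (fun y : Fin D → ZMod Q =>
        ∃ j < k, FF (y - (j : ZMod Q) • x) ≤ ρ ^ 2)).card := by
  classical
  have hQ : (0 : ℝ) < Q := by exact_mod_cast Nat.pos_of_ne_zero (NeZero.ne Q)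
  have hRr : (0 : ℝ) < R := by exact_mod_cast hR0
  have hkr : (0 : ℝ) < k := by exact_mod_cast hk
  set U := univ.filter (fun y : Fin D → ZMod Q => ∃ j < k, FF (y - (j : ZMod Q) • x) ≤ ρ ^ 2)
    with hU
  set P : ℝ := ((R : ℝ) * Q) ^ D with hP
  have hPpos : 0 < P := by positivity
  -- exponential sums
  have hS : ∑ ξ ∈ Dif Q D R, ‖SS k x ξ‖ ^ 2 ≤ (T + 1) * (k : ℝ) ^ 2 := by
    rw [← sum_filter_add_sum_filter_not (Dif Q D R) (fun ξ => nn (ξ ⬝ᵥ x) < τ)]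
    have a1 : ∑ ξ ∈ (Dif Q D R).filter (fun ξ => nn (ξ ⬝ᵥ x) < τ), ‖SS k x ξ‖ ^ 2 ≤
        T * (k : ℝ) ^ 2 := by
      refine (sum_le_card_nsmul _ _ ((k : ℝ) ^ 2) ?_).trans ?_
      · intro ξ _
        refine pow_le_pow_left₀ (norm_nonneg _) ?_ 2
        unfold SS
        refine (norm_sum_le _ _).trans ?_
        simp [norm_ee]
      · rw [nsmul_eq_mul]
        exact mul_le_mul_of_nonneg_right hT (by positivity)
    have a2 : ∑ ξ ∈ (Dif Q D R).filter (fun ξ => ¬ nn (ξ ⬝ᵥ x) < τ), ‖SS k x ξ‖ ^ 2 ≤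
        (k : ℝ) ^ 2 := by
      refine (sum_le_card_nsmul _ _ ((2 / τ) ^ 2) ?_).trans ?_
      · intro ξ hξ
        refine pow_le_pow_left₀ (norm_nonneg _) ?_ 2
        unfold SS
        refine norm_geom_le k _ τ hτ ?_
        rw [nn_neg]
        exact not_lt.1 (mem_filter.1 hξ).2
      · rw [nsmul_eq_mul]
        refine le_trans ?_ hRτ
        refine mul_le_mul_of_nonneg_right ?_ (by positivity)
        have := (card_filter_le (Dif Q D R) (fun ξ => ¬ nn (ξ ⬝ᵥ x) < τ)).trans
          (card_Dif_le (Q := Q) (D := D) R)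
        exact_mod_cast this
    linarith
  have htot : ∑ y, orb R k x y = k * P := by
    unfold orb
    rw [sum_comm]
    have : ∀ j ∈ range k, ∑ y : Fin D → ZMod Q, kap R (y - (j : ZMod Q) • x) = P := by
      intro j _
      rw [hP, ← sum_kap R hR]
      exact Equiv.sum_comp (Equiv.subRight ((j : ZMod Q) • x)) (fun y => kap R y)
    rw [sum_congr rfl this]; simp
  have htail : ∑ y ∈ univ.filter (fun y : Fin D → ZMod Q => ¬ FF y ≤ ρ ^ 2), kap R y ≤ P / 2 := by
    have h := sum_kap_FF (Q := Q) (D := D) R hR hR0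
    have h2 : ρ ^ 2 * ∑ y ∈ univ.filter (fun y : Fin D → ZMod Q => ¬ FF y ≤ ρ ^ 2), kap R y ≤
        ∑ y : Fin D → ZMod Q, kap R y * FF y := by
      rw [mul_sum]
      refine le_trans (sum_le_sum (g := fun y => kap R y * FF y) ?_)
        (sum_le_sum_of_subset_of_nonneg (filter_subset _ _) ?_)
      · intro y hy
        rw [mul_comm]
        exact mul_le_mul_of_nonneg_left (not_le.1 (mem_filter.1 hy).2).le (kap_nonneg _ _)
      · intro y _ _
        exact mul_nonneg (kap_nonneg _ _) (FF_nonneg _)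
    set W := ∑ y ∈ univ.filter (fun y : Fin D → ZMod Q => ¬ FF y ≤ ρ ^ 2), kap R y
    have h3 : R * (ρ ^ 2 * W) ≤ 2 * D * P := by
      rw [hP, ← h]; exact mul_le_mul_of_nonneg_left h2 hRr.le
    have h4 : (R * ρ ^ 2) * W ≤ (R * ρ ^ 2) * (P / 2) := by
      calc (R * ρ ^ 2) * W = R * (ρ ^ 2 * W) := by ring
        _ ≤ 2 * D * P := h3
        _ = (4 * D) * (P / 2) := by ring
        _ ≤ _ := mul_le_mul_of_nonneg_right hRρ (by positivity)
    exact le_of_mul_le_mul_left h4 (by positivity)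
  have hout : ∑ y ∈ univ.filter (fun y => y ∉ U), orb R k x y ≤ k * (P / 2) := by
    unfold orb
    rw [sum_comm]
    refine (sum_le_card_nsmul _ _ (P / 2) ?_).trans (by simp)
    intro j hj
    refine le_trans ?_ htail
    have : ∑ y ∈ univ.filter (fun y : Fin D → ZMod Q => ¬ FF y ≤ ρ ^ 2), kap R y =
        ∑ y ∈ univ.filter (fun y : Fin D → ZMod Q => ¬ FF (y - (j : ZMod Q) • x) ≤ ρ ^ 2),
          kap R (y - (j : ZMod Q) • x) := by
      rw [sum_filter, sum_filter]
      exact (Equiv.sum_comp (Equiv.subRight ((j : ZMod Q) • x))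
        (fun y => if ¬ FF y ≤ ρ ^ 2 then kap R y else 0)).symm
    rw [this]
    refine sum_le_sum_of_subset_of_nonneg ?_ fun _ _ _ => kap_nonneg _ _
    intro y hy
    rw [mem_filter] at hy ⊢
    refine ⟨mem_univ _, fun h => hy.2 ?_⟩
    rw [hU, mem_filter]
    exact ⟨mem_univ _, j, mem_range.1 hj, h⟩
  have hin : k * (P / 2) ≤ ∑ y ∈ U, orb R k x y := by
    have h := sum_filter_add_sum_filter_not univ (fun y => y ∈ U) (fun y => orb R k x y)
    rw [htot] at h
    have e : univ.filter (fun y => y ∈ U) = U := by ext; simp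
    rw [e] at h
    linarith
  have hCS := sq_sum_le_card_mul_sum_sq (s := U) (f := fun y => orb R k x y)
  have hsub : ∑ y ∈ U, orb R k x y ^ 2 ≤ ∑ y, orb R k x y ^ 2 :=
    sum_le_sum_of_subset_of_nonneg (subset_univ _) fun _ _ _ => sq_nonneg _
  have hfin : (k * (P / 2)) ^ 2 ≤
      U.card * ((Q : ℝ) ^ D * ((R : ℝ) ^ D) ^ 2 * ((T + 1) * (k : ℝ) ^ 2)) := by
    calc (k * (P / 2)) ^ 2 ≤ (∑ y ∈ U, orb R k x y) ^ 2 :=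
          pow_le_pow_left₀ (by positivity) hin 2
      _ ≤ _ := hCS
      _ ≤ _ := by
        refine mul_le_mul_of_nonneg_left ?_ (Nat.cast_nonneg _)
        refine hsub.trans ((sum_orb_sq R k hR x).trans ?_)
        exact mul_le_mul_of_nonneg_left hS (by positivity)
  have hc : (0 : ℝ) < (k : ℝ) ^ 2 * ((R : ℝ) ^ D) ^ 2 * (Q : ℝ) ^ D / 4 := by positivity
  refine le_of_mul_le_mul_left ?_ hc
  calc (k : ℝ) ^ 2 * ((R : ℝ) ^ D) ^ 2 * (Q : ℝ) ^ D / 4 * (Q : ℝ) ^ D = (k * (P / 2)) ^ 2 := by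
        rw [hP, mul_pow]; ring
    _ ≤ _ := hfin
    _ = _ := by ring

end multi
end VdW

namespace VdW
open Finset

/-- Fibres of a surjective homomorphism have equal size. -/
lemma card_preimage {A B : Type*} [AddCommGroup A] [AddCommGroup B] [Fintype A] [Fintype B]
    [DecidableEq B] (f : A →+ B) (hf : Function.Surjective f) (J : Finset B) :
    (univ.filter (fun a => f a ∈ J)).card * Fintype.card B = J.card * Fintype.card A := by
  classical
  have hfib : ∀ b : B, (univ.filter (fun a => f a = b)).card =
      (univ.filter (fun a => f a = 0)).card := by
    intro b
    obtain ⟨a0, ha0⟩ := hf b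
    refine card_bij (fun a _ => a - a0) ?_ ?_ ?_
    · intro a ha
      have : f a = b := by simpa using ha
      simp [this, ha0]
    · intro a _ a' _ h
      simpa using h
    · intro a ha
      have : f a = 0 := by simpa using ha
      exact ⟨a + a0, by simp [this, ha0], by simp⟩
  set κ := (univ.filter (fun a => f a = 0)).card
  have h1 : ∀ J : Finset B, (univ.filter (fun a => f a ∈ J)).card = J.card * κ := by
    intro J
    rw [card_eq_sum_card_fiberwise (f := f) (t := J)]
    · rw [sum_congr rfl (g := fun _ => κ)]
      · simp
      · intro b hb
        rw [← hfib b]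
        congr 1
        ext a
        simp only [mem_filter, mem_univ, true_and]
        constructor
        · exact fun h => h.2
        · intro h; exact ⟨h ▸ hb, h⟩
    · intro a ha
      simpa using ha
  have h2 := h1 univ
  simp only [mem_univ, filter_true, card_univ] at h2
  rw [h1, h2]; ring

section lin
variable {Q : ℕ} [Fact Q.Prime] {D : ℕ}

lemma exists_coords (n : ℕ) : ∀ (W : Submodule (ZMod Q) (Fin D → ZMod Q)),
    Module.finrank (ZMod Q) W ≤ n → ∃ s : Finset (Fin D), s.card ≤ n ∧
      ∀ w ∈ W, (∀ i ∈ s, w i = 0) → w = 0 := by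
  classical
  induction n with
  | zero =>
    intro W hW
    refine ⟨∅, by simp, fun w hw _ => ?_⟩
    have : W = ⊥ := Submodule.finrank_eq_zero.1 (Nat.le_zero.1 hW)
    rw [this] at hw
    simpa using hw
  | succ n ih =>
    intro W hW
    by_cases hbot : W = ⊥
    · refine ⟨∅, by simp, fun w hw _ => ?_⟩
      rw [hbot] at hw
      simpa using hw
    · obtain ⟨w, hw, hw0⟩ := Submodule.exists_mem_ne_zero_of_ne_bot hbot
      obtain ⟨i, hi⟩ := Function.ne_iff.1 hw0
      have hlt : W ⊓ LinearMap.ker (LinearMap.proj (R := ZMod Q) (φ := fun _ : Fin D => ZMod Q) i)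
          < W := by
        refine lt_of_le_of_ne inf_le_left fun h => hi ?_
        rw [← h] at hw
        simpa using hw.2
      have := Submodule.finrank_lt_finrank_of_lt hlt
      obtain ⟨s, hs, hs2⟩ := ih _ (by omega : Module.finrank (ZMod Q) (W ⊓ LinearMap.ker
        (LinearMap.proj (R := ZMod Q) (φ := fun _ : Fin D => ZMod Q) i) : Submodule _ _) ≤ n)
      refine ⟨insert i s, (card_insert_le _ _).trans (by omega), fun w' hw' h => ?_⟩
      refine hs2 w' ⟨hw', ?_⟩ fun j hj => h j (mem_insert_of_mem hj)
      simpa using h i (mem_insert_self _ _)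

lemma subspace_card (m b : ℕ) (hb : 1 ≤ b) (S : Finset (Fin D → ZMod Q)) (B : Finset (ZMod Q))
    (hB : B.card ≤ b) (hS : ∀ y ∈ S, ∀ i, y i ∈ B)
    (hm : Module.finrank (ZMod Q) (Submodule.span (ZMod Q) (S : Set (Fin D → ZMod Q))) ≤ m) :
    S.card ≤ b ^ m := by
  classical
  obtain ⟨s, hs, hs2⟩ := exists_coords m _ hm
  have h1 : S.card ≤ (Fintype.piFinset (fun _ : s => B)).card := by
    refine card_le_card_of_injOn (fun y i => y i) ?_ ?_
    · intro y hy
      rw [mem_coe, Fintype.mem_piFinset]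
      intro i
      exact hS y hy i
    · intro y hy y' hy' h
      have : y - y' = 0 := by
        refine hs2 _ (Submodule.sub_mem _ (Submodule.subset_span hy)
          (Submodule.subset_span hy')) fun i hi => ?_
        have := congrFun h ⟨i, hi⟩
        simpa [sub_eq_zero] using this
      exact sub_eq_zero.1 this
  refine h1.trans ?_
  rw [Fintype.card_piFinset]
  simp only [prod_const, card_univ, Fintype.card_coe]
  exact (Nat.pow_le_pow_left hB _).trans (Nat.pow_le_pow_right hb hs)

lemma exists_indep (m : ℕ) (S : Finset (Fin D → ZMod Q))
    (hm : m ≤ Module.finrank (ZMod Q) (Submodule.span (ZMod Q) (S : Set (Fin D → ZMod Q)))) :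
    ∃ v : Fin m → (Fin D → ZMod Q), (∀ i, v i ∈ S) ∧ LinearIndependent (ZMod Q) v := by
  classical
  obtain ⟨b, hbS, hspan, hli⟩ := exists_linearIndependent (ZMod Q) (S : Set (Fin D → ZMod Q))
  have hfin : b.Finite := S.finite_toSet.subset hbS
  have : Fintype b := hfin.fintype
  have hcard : Fintype.card b = Module.finrank (ZMod Q)
      (Submodule.span (ZMod Q) (S : Set (Fin D → ZMod Q))) := by
    rw [← hspan]
    have := finrank_span_eq_card hli
    rw [Subtype.range_coe] at this
    exact this.symm
  have hle : Fintype.card (Fin m) ≤ Fintype.card b := by rw [Fintype.card_fin, hcard]; exact hm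
  obtain ⟨g⟩ := Function.Embedding.nonempty_of_card_le hle
  exact ⟨fun i => (g i : Fin D → ZMod Q), fun i => hbS (g i).2, hli.comp g g.injective⟩

lemma card_indep (m : ℕ) (v : Fin m → (Fin D → ZMod Q)) (hv : LinearIndependent (ZMod Q) v)
    (I : Finset (ZMod Q)) :
    (univ.filter (fun x : Fin D → ZMod Q => ∀ i, v i ⬝ᵥ x ∈ I)).card * Q ^ m =
      I.card ^ m * Q ^ D := by
  classical
  let M : Matrix (Fin m) (Fin D) (ZMod Q) := Matrix.of v
  have hsurj : Function.Surjective M.mulVecLin := by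
    rw [← LinearMap.range_eq_top]
    apply Submodule.eq_top_of_finrank_eq
    have : M.rank = Fintype.card (Fin m) := LinearIndependent.rank_matrix (M := M) hv
    rw [Matrix.rank] at this
    rw [this]; simp
  have h := card_preimage M.mulVecLin.toAddMonoidHom hsurj (Fintype.piFinset fun _ => I)
  have e : (univ.filter (fun x : Fin D → ZMod Q => ∀ i, v i ⬝ᵥ x ∈ I)) =
      (univ.filter (fun x => M.mulVecLin.toAddMonoidHom x ∈ Fintype.piFinset fun _ => I)) := by
    ext x
    simp [Fintype.mem_piFinset, Matrix.mulVec, M]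
  rw [e]
  simpa using h

/-- Few `x` have many almost-relations. -/
lemma card_exceptional (R m : ℕ) (hR0 : 0 < R) (τ : ℝ) (hτ : 0 ≤ τ) (hτQ : 2 ≤ τ * Q) :
    ((univ.filter (fun x : Fin D → ZMod Q =>
      R ^ (2 * m) < ((Dif Q D R).filter (fun ξ => nn (ξ ⬝ᵥ x) < τ)).card)).card : ℝ) ≤
      ((R : ℝ) ^ (2 * D) * τ) ^ m * (Q : ℝ) ^ D := by
  classical
  have hQ : (0 : ℝ) < Q := by exact_mod_cast Nat.pos_of_ne_zero (NeZero.ne Q)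
  set I : Finset (ZMod Q) := univ.filter (fun t => nn t ≤ τ) with hI
  have hIc : (I.card : ℝ) ≤ τ * Q := by
    have := card_nn_le (Q := Q) τ hτ
    rw [hI]; linarith
  set V := (Fintype.piFinset (fun _ : Fin m => Dif Q D R)).filter
    (fun v => LinearIndependent (ZMod Q) v) with hV
  have hsub : (univ.filter (fun x : Fin D → ZMod Q =>
      R ^ (2 * m) < ((Dif Q D R).filter (fun ξ => nn (ξ ⬝ᵥ x) < τ)).card)) ⊆
      V.biUnion (fun v => univ.filter (fun x : Fin D → ZMod Q => ∀ i, v i ⬝ᵥ x ∈ I)) := by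
    intro x hx
    rw [mem_filter] at hx
    have hx2 := hx.2
    set S := (Dif Q D R).filter (fun ξ => nn (ξ ⬝ᵥ x) < τ) with hS
    have hm : m ≤ Module.finrank (ZMod Q)
        (Submodule.span (ZMod Q) (S : Set (Fin D → ZMod Q))) := by
      by_contra hlt
      push Not at hlt
      have := subspace_card m (R ^ 2) (Nat.one_le_pow _ _ hR0) S
        ((((range R).image (fun n : ℕ => (n : ZMod Q))) ×ˢ
          ((range R).image (fun n : ℕ => (n : ZMod Q)))).image (fun p => p.1 - p.2)) ?_ ?_ hlt.le
      · rw [← pow_mul] at this; omega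
      · refine card_image_le.trans ?_
        rw [card_product, sq]
        exact Nat.mul_le_mul (card_image_le.trans (by simp)) (card_image_le.trans (by simp))
      · intro y hy i
        have hy' := (mem_filter.1 hy).1
        unfold Dif at hy'
        obtain ⟨p, hp, rfl⟩ := mem_image.1 hy'
        rw [mem_product] at hp
        refine mem_image.2 ⟨(p.1 i, p.2 i), ?_, rfl⟩
        unfold Bx at hp
        rw [Fintype.mem_piFinset, Fintype.mem_piFinset] at hp
        exact mem_product.2 ⟨hp.1 i, hp.2 i⟩
    obtain ⟨v, hvS, hvli⟩ := exists_indep m S hm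
    rw [mem_biUnion]
    refine ⟨v, ?_, ?_⟩
    · rw [hV, mem_filter, Fintype.mem_piFinset]
      exact ⟨fun i => (mem_filter.1 (hvS i)).1, hvli⟩
    · rw [mem_filter]
      refine ⟨mem_univ _, fun i => ?_⟩
      rw [hI, mem_filter]
      exact ⟨mem_univ _, (mem_filter.1 (hvS i)).2.le⟩
  have hone : ∀ v ∈ V, ((univ.filter (fun x : Fin D → ZMod Q => ∀ i, v i ⬝ᵥ x ∈ I)).card : ℝ) ≤
      τ ^ m * (Q : ℝ) ^ D := by
    intro v hv
    have h := card_indep m v (mem_filter.1 hv).2 I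
    have h' : ((univ.filter (fun x : Fin D → ZMod Q => ∀ i, v i ⬝ᵥ x ∈ I)).card : ℝ) *
      (Q : ℝ) ^ m = (I.card : ℝ) ^ m * (Q : ℝ) ^ D := by exact_mod_cast h
    have hQm : (0 : ℝ) < (Q : ℝ) ^ m := by positivity
    refine le_of_mul_le_mul_right ?_ hQm
    rw [h']
    calc (I.card : ℝ) ^ m * (Q : ℝ) ^ D ≤ (τ * Q) ^ m * (Q : ℝ) ^ D := by gcongr
      _ = _ := by rw [mul_pow]; ring
  have hVc : (V.card : ℝ) ≤ ((R : ℝ) ^ (2 * D)) ^ m := by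
    have : V.card ≤ (R ^ (2 * D)) ^ m := by
      refine (card_filter_le _ _).trans ?_
      rw [Fintype.card_piFinset]
      simp only [prod_const, card_univ, Fintype.card_fin]
      exact Nat.pow_le_pow_left (card_Dif_le R) _
    exact_mod_cast this
  calc ((univ.filter (fun x : Fin D → ZMod Q =>
      R ^ (2 * m) < ((Dif Q D R).filter (fun ξ => nn (ξ ⬝ᵥ x) < τ)).card)).card : ℝ)
      ≤ ((V.biUnion (fun v => univ.filter
          (fun x : Fin D → ZMod Q => ∀ i, v i ⬝ᵥ x ∈ I))).card : ℝ) := by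
        exact_mod_cast card_le_card hsub
    _ ≤ ∑ v ∈ V, ((univ.filter (fun x : Fin D → ZMod Q => ∀ i, v i ⬝ᵥ x ∈ I)).card : ℝ) := by
        exact_mod_cast card_biUnion_le
    _ ≤ V.card • (τ ^ m * (Q : ℝ) ^ D) := sum_le_card_nsmul _ _ _ hone
    _ = V.card * (τ ^ m * (Q : ℝ) ^ D) := nsmul_eq_mul _ _
    _ ≤ ((R : ℝ) ^ (2 * D)) ^ m * (τ ^ m * (Q : ℝ) ^ D) := by gcongr
    _ = _ := by rw [mul_pow]; ring

end lin
end VdW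

namespace VdW
open Finset

section choose
variable {Q : ℕ} [Fact Q.Prime] {D : ℕ}

lemma card_small (σ : ℝ) (hσ : 0 ≤ σ) (hσQ : 2 ≤ σ * Q) :
    ((univ.filter (fun x : Fin D → ZMod Q => ∀ i, nn (x i) ≤ σ)).card : ℝ) ≤
      σ ^ D * (Q : ℝ) ^ D := by
  classical
  set I : Finset (ZMod Q) := univ.filter (fun t => nn t ≤ σ) with hI
  have hIc : (I.card : ℝ) ≤ σ * Q := by
    have := card_nn_le (Q := Q) σ hσ
    rw [hI]; linarith
  have e : (univ.filter (fun x : Fin D → ZMod Q => ∀ i, nn (x i) ≤ σ)) =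
      Fintype.piFinset (fun _ => I) := by
    ext x; simp [hI]
  rw [e, Fintype.card_piFinset]
  simp only [prod_const, card_univ, Fintype.card_fin]
  push_cast
  rw [← mul_pow]
  gcongr

lemma natCast_ne_zero' {d : ℕ} (h1 : 1 ≤ d) (h2 : d < Q) : (d : ZMod Q) ≠ 0 := by
  intro h
  rw [ZMod.natCast_eq_zero_iff] at h
  exact absurd (Nat.le_of_dvd h1 h) (by omega)

lemma card_smul (u : ZMod Q) (hu : u ≠ 0) (P : (Fin D → ZMod Q) → Prop) [DecidablePred P] :
    (univ.filter (fun θ : Fin D → ZMod Q => P (u • θ))).card = (univ.filter P).card := by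
  refine card_bij (fun θ _ => u • θ) ?_ ?_ ?_
  · intro a ha; simpa using ha
  · intro a _ b _ h
    have := congrArg (fun z => u⁻¹ • z) h
    simpa [smul_smul, inv_mul_cancel₀ hu] using this
  · intro b hb
    refine ⟨u⁻¹ • b, ?_, ?_⟩
    · simpa [smul_smul, mul_inv_cancel₀ hu] using hb
    · simp [smul_smul, mul_inv_cancel₀ hu]

lemma choose_theta (N R m : ℕ) (hNQ : N < Q) (hR0 : 0 < R) (τ σ : ℝ) (hτ : 0 ≤ τ) (hσ : 0 ≤ σ)
    (hτQ : 2 ≤ τ * Q) (hσQ : 2 ≤ σ * Q)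
    (hsmall : N * (((R : ℝ) ^ (2 * D) * τ) ^ m + σ ^ D) < 1) :
    ∃ θ : Fin D → ZMod Q, ∀ d : ℕ, 1 ≤ d → d ≤ N →
      σ ^ 2 < FF ((d : ZMod Q) • θ) ∧
      ((Dif Q D R).filter (fun ξ => nn (ξ ⬝ᵥ ((d : ZMod Q) • θ)) < τ)).card ≤ R ^ (2 * m) := by
  classical
  have hQ : (0 : ℝ) < Q := by exact_mod_cast Nat.pos_of_ne_zero (NeZero.ne Q)
  by_contra hcon
  push Not at hcon
  let P1 : (Fin D → ZMod Q) → Prop := fun x =>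
    R ^ (2 * m) < ((Dif Q D R).filter (fun ξ => nn (ξ ⬝ᵥ x) < τ)).card
  let P2 : (Fin D → ZMod Q) → Prop := fun x => ∀ i, nn (x i) ≤ σ
  have hcov : (univ : Finset (Fin D → ZMod Q)) ⊆ (Icc 1 N).biUnion (fun d =>
      univ.filter (fun θ => P1 ((d : ZMod Q) • θ)) ∪
      univ.filter (fun θ => P2 ((d : ZMod Q) • θ))) := by
    intro θ _
    obtain ⟨d, hd1, hdN, hd⟩ := hcon θ
    rw [mem_biUnion]
    refine ⟨d, mem_Icc.2 ⟨hd1, hdN⟩, ?_⟩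
    rw [mem_union, mem_filter, mem_filter]
    by_cases h : σ ^ 2 < FF ((d : ZMod Q) • θ)
    · exact Or.inl ⟨mem_univ _, hd h⟩
    · exact Or.inr ⟨mem_univ _, fun i => nn_le_of_FF _ σ hσ (not_lt.1 h) i⟩
  have h1 : (Fintype.card (Fin D → ZMod Q) : ℝ) ≤
      ∑ d ∈ Icc 1 N, (((R : ℝ) ^ (2 * D) * τ) ^ m * (Q : ℝ) ^ D + σ ^ D * (Q : ℝ) ^ D) := by
    rw [← card_univ]
    have := (card_le_card hcov).trans card_biUnion_le
    have h' : ((univ : Finset (Fin D → ZMod Q)).card : ℝ) ≤ ∑ d ∈ Icc 1 N,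
      ((univ.filter (fun θ : Fin D → ZMod Q => P1 ((d : ZMod Q) • θ)) ∪
      univ.filter (fun θ => P2 ((d : ZMod Q) • θ))).card : ℝ) := by exact_mod_cast this
    refine h'.trans (sum_le_sum fun d hd => ?_)
    rw [mem_Icc] at hd
    have hd0 : (d : ZMod Q) ≠ 0 := natCast_ne_zero' hd.1 (by omega)
    have h2 := card_union_le (univ.filter (fun θ : Fin D → ZMod Q => P1 ((d : ZMod Q) • θ)))
      (univ.filter (fun θ => P2 ((d : ZMod Q) • θ)))
    rw [card_smul _ hd0 P1, card_smul _ hd0 P2] at h2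
    have h3 := card_exceptional (Q := Q) (D := D) R m hR0 τ hτ hτQ
    have h4 := card_small (Q := Q) (D := D) σ hσ hσQ
    have h2' : ((univ.filter (fun θ : Fin D → ZMod Q => P1 ((d : ZMod Q) • θ)) ∪
      univ.filter (fun θ => P2 ((d : ZMod Q) • θ))).card : ℝ) ≤
      ((univ.filter P1).card : ℝ) + ((univ.filter P2).card : ℝ) := by exact_mod_cast h2
    refine h2'.trans (add_le_add ?_ ?_)
    · convert h3
    · convert h4
  have hQD : (0 : ℝ) < (Q : ℝ) ^ D := by positivity
  rw [sum_const, Nat.card_Icc, nsmul_eq_mul] at h1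
  simp only [Fintype.card_pi, ZMod.card, prod_const, card_univ, Fintype.card_fin,
    Nat.add_sub_cancel] at h1
  push_cast at h1
  nlinarith

/-- A point `n` of the orbit hits the piece centred at `p.1` with shell index `p.2`. -/
def hit (A : ℕ) (ρ : ℝ) (y : Fin D → ZMod Q) (p : (Fin D → ZMod Q) × ZMod A) : Prop :=
  FF (y - p.1) ≤ ρ ^ 2 ∧ ((⌊A * FF (y - p.1)⌋₊ : ℕ) : ZMod A) = p.2

open Classical in
lemma card_miss (A k : ℕ) [NeZero A] (ρ L : ℝ) (hL : 0 < L) (z x : Fin D → ZMod Q)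
    (hU : (Q : ℝ) ^ D ≤ L * (univ.filter (fun y : Fin D → ZMod Q =>
        ∃ j < k, FF (y - (j : ZMod Q) • x) ≤ ρ ^ 2)).card) :
    ((univ.filter (fun p : (Fin D → ZMod Q) × ZMod A =>
      ∀ j < k, ¬ hit A ρ (z + (j : ZMod Q) • x) p)).card : ℝ) ≤
      ((Q : ℝ) ^ D * A) * (1 - 1 / (L * A)) := by
  have hA : (0 : ℝ) < A := by exact_mod_cast Nat.pos_of_ne_zero (NeZero.ne A)
  set U := univ.filter (fun y : Fin D → ZMod Q => ∃ j < k, FF (y - (j : ZMod Q) • x) ≤ ρ ^ 2)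
  set Ms := univ.filter (fun p : (Fin D → ZMod Q) × ZMod A =>
      ∀ j < k, ¬ hit A ρ (z + (j : ZMod Q) • x) p)
  set H := univ.filter (fun p : (Fin D → ZMod Q) × ZMod A =>
      ¬ ∀ j < k, ¬ hit A ρ (z + (j : ZMod Q) • x) p)
  have hsum : Ms.card + H.card = Q ^ D * A := by
    have := card_filter_add_card_filter_not (s := (univ : Finset ((Fin D → ZMod Q) × ZMod A)))
      (fun p => ∀ j < k, ¬ hit A ρ (z + (j : ZMod Q) • x) p)
    rw [this]; simp [ZMod.card]
  have hUH : U.card ≤ H.card := by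
    have hch : ∀ y ∈ U, ∃ j, j < k ∧ FF (y - (j : ZMod Q) • x) ≤ ρ ^ 2 := fun y hy => by
      obtain ⟨j, h1, h2⟩ := (mem_filter.1 hy).2
      exact ⟨j, h1, h2⟩
    let J : (Fin D → ZMod Q) → ℕ := fun y =>
      if h : ∃ j, j < k ∧ FF (y - (j : ZMod Q) • x) ≤ ρ ^ 2 then h.choose else 0
    refine card_le_card_of_injOn (fun y => (y + z,
      ((⌊A * FF (z + (J y : ZMod Q) • x - (y + z))⌋₊ : ℕ) : ZMod A))) ?_ ?_
    · intro y hy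
      have hJ : J y < k ∧ FF (y - (J y : ZMod Q) • x) ≤ ρ ^ 2 := by
        have h := hch y hy
        simp only [J, dif_pos h]
        exact h.choose_spec
      rw [mem_coe, mem_filter]
      refine ⟨mem_univ _, fun h => h (J y) hJ.1 ⟨?_, rfl⟩⟩
      have : z + (J y : ZMod Q) • x - (y + z) = -(y - (J y : ZMod Q) • x) := by abel
      simp only [this, FF_neg]
      exact hJ.2
    · intro y _ y' _ h
      have := (Prod.ext_iff.1 h).1
      simpa using this
  have e1 : (Ms.card : ℝ) + H.card = (Q : ℝ) ^ D * A := by exact_mod_cast hsum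
  have e2 : (U.card : ℝ) ≤ H.card := by exact_mod_cast hUH
  have e3 : (Q : ℝ) ^ D / L ≤ U.card := by rw [div_le_iff₀ hL]; linarith
  have e4 : ((Q : ℝ) ^ D * A) * (1 - 1 / (L * A)) = (Q : ℝ) ^ D * A - (Q : ℝ) ^ D / L := by
    field_simp
  rw [e4]; linarith

/-- The collision map of a triple of centres. -/
def coll (M A : ℕ) (i j l : Fin M) :
    (Fin M → (Fin D → ZMod Q) × ZMod A) →+ (Fin D → ZMod Q) where
  toFun ω := (ω i).1 - (ω j).1 - (ω j).1 + (ω l).1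
  map_zero' := by simp
  map_add' a b := by simp; abel

lemma coll_surj (hQ2 : 2 < Q) (M A : ℕ) (i j l : Fin M) (h : ¬ (i = j ∧ j = l)) :
    Function.Surjective (coll (Q := Q) (D := D) M A i j l) := by
  classical
  intro g
  have h2 : (2 : ZMod Q) ≠ 0 := by
    have := natCast_ne_zero' (Q := Q) (d := 2) (by norm_num) hQ2
    exact_mod_cast this
  by_cases hil : i = l
  · subst hil
    have hij : i ≠ j := fun e => h ⟨e, e.symm⟩
    refine ⟨Pi.single j (-((2 : ZMod Q)⁻¹ • g), 0), ?_⟩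
    simp only [coll, AddMonoidHom.coe_mk, ZeroHom.coe_mk, Pi.single_eq_same,
      Pi.single_eq_of_ne hij]
    have : g = (2 : ZMod Q) • ((2 : ZMod Q)⁻¹ • g) := by
      rw [smul_smul, mul_inv_cancel₀ h2, one_smul]
    conv_rhs => rw [this, two_smul]
    simp
  · by_cases hij : i = j
    · subst hij
      refine ⟨Pi.single l (g, 0), ?_⟩
      simp [coll, Pi.single_eq_of_ne hil]
    · refine ⟨Pi.single i (g, 0), ?_⟩
      simp [coll, Pi.single_eq_of_ne (Ne.symm hij), Pi.single_eq_of_ne (Ne.symm hil)]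

open Classical in
lemma choose_omega (hQ2 : 2 < Q) (N k A M : ℕ) [NeZero A] (ρ L : ℝ) (hρ : 0 ≤ ρ) (hL : 0 < L)
    (hρQ : 2 ≤ 4 * ρ * Q) (hLA : 1 ≤ L * A) (θ : Fin D → ZMod Q)
    (hU : ∀ d : ℕ, 1 ≤ d → d ≤ N → (Q : ℝ) ^ D ≤ L * (univ.filter (fun y : Fin D → ZMod Q =>
        ∃ j < k, FF (y - (j : ZMod Q) • ((d : ZMod Q) • θ)) ≤ ρ ^ 2)).card)
    (hsmall : (N : ℝ) ^ 2 * (1 - 1 / (L * A)) ^ M + (M : ℝ) ^ 3 * (4 * ρ) ^ D < 1) :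
    ∃ ω : Fin M → (Fin D → ZMod Q) × ZMod A,
      (∀ i j l, (∀ t, nn ((coll M A i j l ω) t) ≤ 4 * ρ) → i = j ∧ j = l) ∧
      (∀ n d : ℕ, 1 ≤ n → n ≤ N → 1 ≤ d → d ≤ N → ∃ j < k, ∃ i,
        hit A ρ ((n : ZMod Q) • θ + (j : ZMod Q) • ((d : ZMod Q) • θ)) (ω i)) := by
  have hQ : (0 : ℝ) < Q := by exact_mod_cast Nat.pos_of_ne_zero (NeZero.ne Q)
  have hA : (0 : ℝ) < A := by exact_mod_cast Nat.pos_of_ne_zero (NeZero.ne A)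
  by_contra hcon
  push Not at hcon
  let Ω := Fin M → (Fin D → ZMod Q) × ZMod A
  let Ms : ℕ × ℕ → Finset ((Fin D → ZMod Q) × ZMod A) := fun q => univ.filter (fun p =>
    ∀ j < k, ¬ hit A ρ ((q.1 : ZMod Q) • θ + (j : ZMod Q) • ((q.2 : ZMod Q) • θ)) p)
  let small : Finset (Fin D → ZMod Q) := univ.filter (fun x => ∀ t, nn (x t) ≤ 4 * ρ)
  let Tr : Finset (Fin M × Fin M × Fin M) := univ.filter (fun p => ¬ (p.1 = p.2.1 ∧ p.2.1 = p.2.2))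
  have hcov : (univ : Finset Ω) ⊆
      ((Icc 1 N ×ˢ Icc 1 N).biUnion (fun q => Fintype.piFinset (fun _ => Ms q))) ∪
      (Tr.biUnion (fun p => univ.filter (fun ω : Ω => coll M A p.1 p.2.1 p.2.2 ω ∈ small))) := by
    intro ω _
    rw [mem_union, mem_biUnion, mem_biUnion]
    by_cases hc : ∀ i j l, (∀ t, nn ((coll M A i j l ω) t) ≤ 4 * ρ) → i = j ∧ j = l
    · left
      obtain ⟨n, d, h1, h2, h3, h4, h5⟩ := hcon ω hc
      refine ⟨(n, d), mem_product.2 ⟨mem_Icc.2 ⟨h1, h2⟩, mem_Icc.2 ⟨h3, h4⟩⟩, ?_⟩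
      rw [Fintype.mem_piFinset]
      intro i
      rw [mem_filter]
      exact ⟨mem_univ _, fun j hj => h5 j hj i⟩
    · right
      simp only [not_forall] at hc
      obtain ⟨i, j, l, h1, h2⟩ := hc
      exact ⟨(i, j, l), mem_filter.2 ⟨mem_univ _, h2⟩,
        mem_filter.2 ⟨mem_univ _, mem_filter.2 ⟨mem_univ _, h1⟩⟩⟩
  set W : ℝ := ((Q : ℝ) ^ D * A) ^ M with hW
  have hWpos : 0 < W := by positivity
  have hΩ : (Fintype.card Ω : ℝ) = W := by
    have : Fintype.card Ω = (Q ^ D * A) ^ M := by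
      simp only [Ω]
      rw [Fintype.card_pi]; simp [ZMod.card]
    rw [this]; push_cast; rfl
  have h0 : 0 ≤ 1 - 1 / (L * A) := by
    rw [sub_nonneg, div_le_one (by positivity)]; exact hLA
  have hb1 : ∀ q ∈ Icc 1 N ×ˢ Icc 1 N, ((Fintype.piFinset (fun _ : Fin M => Ms q)).card : ℝ) ≤
      W * (1 - 1 / (L * A)) ^ M := by
    intro q hq
    rw [mem_product, mem_Icc, mem_Icc] at hq
    rw [Fintype.card_piFinset]
    simp only [prod_const, card_univ, Fintype.card_fin]
    push_cast
    rw [hW, ← mul_pow]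
    exact pow_le_pow_left₀ (Nat.cast_nonneg _)
      (card_miss A k ρ L hL _ _ (hU q.2 hq.2.1 hq.2.2)) M
  have hb2 : ∀ p ∈ Tr, ((univ.filter (fun ω : Ω => coll M A p.1 p.2.1 p.2.2 ω ∈ small)).card : ℝ) ≤
      W * (4 * ρ) ^ D := by
    intro p hp
    have h := card_preimage (coll (Q := Q) (D := D) M A p.1 p.2.1 p.2.2)
      (coll_surj hQ2 M A _ _ _ (mem_filter.1 hp).2) small
    have hG : Fintype.card (Fin D → ZMod Q) = Q ^ D := by simp [ZMod.card]
    rw [hG] at h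
    have h' : ((univ.filter (fun ω : Ω => coll M A p.1 p.2.1 p.2.2 ω ∈ small)).card : ℝ) *
        (Q : ℝ) ^ D = small.card * W := by
      rw [← hΩ]; exact_mod_cast h
    have hs := card_small (Q := Q) (D := D) (4 * ρ) (by positivity) hρQ
    have hQD : (0 : ℝ) < (Q : ℝ) ^ D := by positivity
    refine le_of_mul_le_mul_right ?_ hQD
    rw [h']
    calc (small.card : ℝ) * W ≤ ((4 * ρ) ^ D * (Q : ℝ) ^ D) * W := by
          refine mul_le_mul_of_nonneg_right ?_ hWpos.le
          convert hs
      _ = _ := by ring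
  have hTr : (Tr.card : ℝ) ≤ (M : ℝ) ^ 3 := by
    have : Tr.card ≤ M ^ 3 := by
      refine (card_filter_le _ _).trans ?_
      simp [pow_succ, mul_assoc]
    exact_mod_cast this
  have htot : W ≤ (N : ℝ) ^ 2 * (W * (1 - 1 / (L * A)) ^ M) + (M : ℝ) ^ 3 * (W * (4 * ρ) ^ D) := by
    have c1 := (card_le_card hcov).trans (card_union_le _ _)
    have c2 : ((univ : Finset Ω).card : ℝ) ≤
      (((Icc 1 N ×ˢ Icc 1 N).biUnion (fun q => Fintype.piFinset (fun _ : Fin M => Ms q))).card : ℝ)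
      + ((Tr.biUnion (fun p => univ.filter
          (fun ω : Ω => coll M A p.1 p.2.1 p.2.2 ω ∈ small))).card : ℝ) := by
      exact_mod_cast c1
    rw [card_univ, hΩ] at c2
    refine c2.trans (add_le_add ?_ ?_)
    · calc (((Icc 1 N ×ˢ Icc 1 N).biUnion
            (fun q => Fintype.piFinset (fun _ : Fin M => Ms q))).card : ℝ)
          ≤ ∑ q ∈ Icc 1 N ×ˢ Icc 1 N, ((Fintype.piFinset (fun _ : Fin M => Ms q)).card : ℝ) := by
            exact_mod_cast card_biUnion_le
        _ ≤ _ := sum_le_card_nsmul _ _ _ hb1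
        _ = _ := by
          rw [nsmul_eq_mul, card_product, Nat.card_Icc, Nat.add_sub_cancel]; push_cast; ring
    · calc ((Tr.biUnion (fun p => univ.filter
            (fun ω : Ω => coll M A p.1 p.2.1 p.2.2 ω ∈ small))).card : ℝ)
          ≤ ∑ p ∈ Tr, ((univ.filter
            (fun ω : Ω => coll M A p.1 p.2.1 p.2.2 ω ∈ small)).card : ℝ) := by
            exact_mod_cast card_biUnion_le
        _ ≤ _ := sum_le_card_nsmul _ _ _ hb2
        _ = Tr.card * (W * (4 * ρ) ^ D) := nsmul_eq_mul _ _
        _ ≤ _ := mul_le_mul_of_nonneg_right hTr (by positivity)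
  nlinarith

end choose
end VdW

namespace VdW
open Finset

section combine
variable {Q : ℕ} [Fact Q.Prime] {D : ℕ}

lemma FF_second_diff (v h : Fin D → ZMod Q) (hv : FF v ≤ 1) :
    FF h ≤ FF (v - h) + FF (v + h) - 2 * FF v := by
  have e : FF (v - h) + FF (v + h) - 2 * FF v = ∑ i, 2 * (ee (v i)).re * nn (h i) ^ 2 := by
    unfold FF
    rw [mul_sum, ← sum_add_distrib, ← sum_sub_distrib]
    refine sum_congr rfl fun i _ => ?_
    exact nn_second_diff (v i) (h i)
  rw [e]
  unfold FF
  refine sum_le_sum fun i _ => ?_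
  have h1 := nn_le_of_FF v 1 zero_le_one (by simpa using hv) i
  have h2 := nn_sq (v i)
  have h3 : nn (v i) ^ 2 ≤ 1 := by
    have := nn_nonneg (v i)
    nlinarith
  have h4 : 1 ≤ 2 * (ee (v i)).re := by linarith
  nlinarith [sq_nonneg (nn (h i))]

lemma floor_close (A : ℕ) [NeZero A] (p q : ℝ) (hp0 : 0 ≤ p) (hq0 : 0 ≤ q) (hp : p < 1) (hq : q < 1)
    (h : ((⌊A * p⌋₊ : ℕ) : ZMod A) = ((⌊A * q⌋₊ : ℕ) : ZMod A)) : A * p < A * q + 1 := by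
  have hA : (0 : ℝ) < A := by exact_mod_cast Nat.pos_of_ne_zero (NeZero.ne A)
  have h1 : ⌊A * p⌋₊ < A := by
    rw [Nat.floor_lt (by positivity)]; nlinarith
  have h2 : ⌊A * q⌋₊ < A := by
    rw [Nat.floor_lt (by positivity)]; nlinarith
  rw [ZMod.natCast_eq_natCast_iff', Nat.mod_eq_of_lt h1, Nat.mod_eq_of_lt h2] at h
  have h3 := Nat.lt_floor_add_one (A * p)
  have h4 := Nat.floor_le (a := (A : ℝ) * q) (by positivity)
  rw [h] at h3
  linarith

lemma combine (hQ2 : 2 < Q) (N k A M R m : ℕ) [NeZero A] (ρ τ σ : ℝ)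
    (hNQ : N < Q) (hRQ : R < Q) (hR0 : 0 < R) (hk : 2 ≤ k)
    (hρ : 0 < ρ) (hρ1 : ρ < 1) (hτ : 0 < τ) (hσ : 0 ≤ σ)
    (hτQ : 2 ≤ τ * Q) (hσQ : 2 ≤ σ * Q) (hρQ : 2 ≤ 4 * ρ * Q)
    (hσA : 2 ≤ σ ^ 2 * A)
    (hRτ : (R : ℝ) ^ (2 * D) * (2 / τ) ^ 2 ≤ (k : ℝ) ^ 2)
    (hRρ : 4 * D ≤ R * ρ ^ 2)
    (hsmall1 : N * (((R : ℝ) ^ (2 * D) * τ) ^ m + σ ^ D) < 1)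
    (hsmall2 : (N : ℝ) ^ 2 * (1 - 1 / (4 * ((R : ℝ) ^ (2 * m) + 1) * A)) ^ M +
      (M : ℝ) ^ 3 * (4 * ρ) ^ D < 1) :
    ∃ B ⊆ Finset.Icc 1 N, No3APF B ∧ ¬ HasAPF (Finset.Icc 1 N \ B) k := by
  classical
  have hA1 : (1 : ℝ) ≤ A := by exact_mod_cast Nat.pos_of_ne_zero (NeZero.ne A)
  obtain ⟨θ, hθ⟩ := choose_theta (D := D) N R m hNQ hR0 τ σ hτ.le hσ hτQ hσQ hsmall1
  have hL : (0 : ℝ) < 4 * ((R : ℝ) ^ (2 * m) + 1) := by positivity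
  have hLA : 1 ≤ 4 * ((R : ℝ) ^ (2 * m) + 1) * A := by
    have : (0 : ℝ) ≤ (R : ℝ) ^ (2 * m) := by positivity
    nlinarith
  have hU : ∀ d : ℕ, 1 ≤ d → d ≤ N → (Q : ℝ) ^ D ≤ 4 * ((R : ℝ) ^ (2 * m) + 1) *
      (univ.filter (fun y : Fin D → ZMod Q =>
        ∃ j < k, FF (y - (j : ZMod Q) • ((d : ZMod Q) • θ)) ≤ ρ ^ 2)).card := by
    intro d h1 h2
    have h := (hθ d h1 h2).2
    exact spread R k hRQ hR0 (by omega) _ ρ τ hρ hτ ((R : ℝ) ^ (2 * m)) (by exact_mod_cast h)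
      hRτ hRρ
  obtain ⟨ω, hω1, hω2⟩ := choose_omega (D := D) hQ2 N k A M ρ _ hρ.le hL hρQ hLA θ
    (by convert hU) hsmall2
  refine ⟨(Finset.Icc 1 N).filter (fun n => ∃ i, hit A ρ ((n : ZMod Q) • θ) (ω i)),
    filter_subset _ _, ?_, ?_⟩
  · intro a d hd ha hb hc
    rw [mem_filter] at ha hb hc
    obtain ⟨ha0, i, hi1, hi2⟩ := ha
    obtain ⟨hb0, j, hj1, hj2⟩ := hb
    obtain ⟨hc0, l, hl1, hl2⟩ := hc
    rw [mem_Icc] at ha0 hb0 hc0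
    have hh := (hθ d hd (by omega)).1
    set h := (d : ZMod Q) • θ with hhdef
    set v := ((a + d : ℕ) : ZMod Q) • θ - (ω j).1 with hv
    have ea : ((a : ℕ) : ZMod Q) • θ = v + (ω j).1 - h := by
      rw [hv, hhdef]; push_cast; rw [add_smul]; abel
    have ec : ((a + 2 * d : ℕ) : ZMod Q) • θ = v + (ω j).1 + h := by
      rw [hv, hhdef]; push_cast; rw [add_smul, add_smul, two_mul, add_smul]; abel
    have hij := hω1 i j l ?_
    · obtain ⟨rfl, rfl⟩ := hij
      have eu : ((a : ℕ) : ZMod Q) • θ - (ω i).1 = v - h := by rw [ea]; abel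
      have ew : ((a + 2 * d : ℕ) : ZMod Q) • θ - (ω i).1 = v + h := by rw [ec]; abel
      rw [eu] at hi1 hi2
      rw [ew] at hl1 hl2
      have hρ2 : ρ ^ 2 < 1 := by nlinarith
      have s1 := FF_second_diff v h (by linarith)
      have s2 := floor_close A (FF (v - h)) (FF v) (FF_nonneg _) (FF_nonneg _) (by linarith)
        (by linarith) (hi2.trans hj2.symm)
      have s3 := floor_close A (FF (v + h)) (FF v) (FF_nonneg _) (FF_nonneg _) (by linarith)
        (by linarith) (hl2.trans hj2.symm)
      nlinarith
    · intro t
      set u := ((a : ℕ) : ZMod Q) • θ - (ω i).1 with hu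
      set w := ((a + 2 * d : ℕ) : ZMod Q) • θ - (ω l).1 with hw
      have e : (coll M A i j l ω) = -(u + -v + -v + w) := by
        simp only [coll, AddMonoidHom.coe_mk, ZeroHom.coe_mk]
        rw [hu, hw, ea, ec]; abel
      rw [e, Pi.neg_apply, nn_neg]
      simp only [Pi.add_apply, Pi.neg_apply]
      have n1 := nn_add (u t + -v t + -v t) (w t)
      have n2 := nn_add (u t + -v t) (-v t)
      have n3 := nn_add (u t) (-v t)
      rw [nn_neg] at n2 n3
      have m1 := nn_le_of_FF u ρ hρ.le hi1 t
      have m2 := nn_le_of_FF v ρ hρ.le hj1 t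
      have m3 := nn_le_of_FF w ρ hρ.le hl1 t
      linarith
  · rintro ⟨a, d, hd, hAP⟩
    have h0 := hAP 0 (by omega)
    have h1 := hAP 1 (by omega)
    rw [mem_sdiff, mem_Icc] at h0 h1
    obtain ⟨j, hj, i, hhit⟩ := hω2 a d (by omega) (by omega) hd (by omega)
    have hjm := hAP j hj
    rw [mem_sdiff] at hjm
    refine hjm.2 (mem_filter.2 ⟨hjm.1, i, ?_⟩)
    have e : ((a + j * d : ℕ) : ZMod Q) • θ =
        (a : ZMod Q) • θ + (j : ZMod Q) • ((d : ZMod Q) • θ) := by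
      push_cast; rw [add_smul, mul_smul]
    rw [e]; exact hhit

end combine
end VdW

namespace VdW
open Finset

lemma numeric (r s N k : ℕ) (hr : 1 ≤ r) (hs : 10000 * r ^ 2 ≤ s)
    (hN1 : s ^ (4800 * r ^ 2) ≤ N) (hN2 : N ≤ s ^ (4800 * r ^ 2 + 1)) (hNk : N ≤ k ^ r)
    (hk : 2 ≤ k) :
    ∃ B ⊆ Finset.Icc 1 N, No3APF B ∧ ¬ HasAPF (Finset.Icc 1 N \ B) k := by
  have hr2 : r ≤ r ^ 2 := Nat.le_self_pow two_ne_zero r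
  have hs4 : 10000 ≤ s := by omega
  have hs1 : 1 ≤ s := by omega
  have hsr : (10000 : ℝ) ≤ s := by exact_mod_cast hs4
  have hs0 : (0 : ℝ) < s := by linarith
  have hs1r : (1 : ℝ) ≤ s := by linarith
  have hN1r : (s : ℝ) ^ (4800 * r ^ 2) ≤ N := by exact_mod_cast hN1
  have hN2r : (N : ℝ) ≤ (s : ℝ) ^ (4800 * r ^ 2 + 1) := by exact_mod_cast hN2
  have hNkr : (N : ℝ) ≤ (k : ℝ) ^ r := by exact_mod_cast hNk
  have hN0 : (0 : ℝ) < N := lt_of_lt_of_le (by positivity) hN1r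
  have hkr : (2 : ℝ) ≤ k := by exact_mod_cast hk
  obtain ⟨Q, hQge, hQp⟩ := Nat.exists_infinite_primes (N + s ^ 3 + 3 + k + s ^ (20 * r + 2))
  have : Fact Q.Prime := ⟨hQp⟩
  have : NeZero (s ^ (2 * (20 * r + 2))) := ⟨by positivity⟩
  have hsQ : s ≤ s ^ 3 := Nat.le_self_pow (by norm_num) s
  have hsw0 : 0 < s ^ (20 * r + 2) := by positivity
  have hQk : (k : ℝ) ≤ Q := by exact_mod_cast (by omega : k ≤ Q)
  have hQw : (s : ℝ) ^ (20 * r + 2) ≤ Q := by exact_mod_cast (by omega : s ^ (20 * r + 2) ≤ Q)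
  have hQs : (s : ℝ) ≤ Q := by exact_mod_cast (by omega : s ≤ Q)
  have hp1 : ∀ n : ℕ, (1 : ℝ) ≤ (s : ℝ) ^ n := fun n => one_le_pow₀ hs1r
  refine combine (Q := Q) (D := 240 * r) (by omega) N k (s ^ (2 * (20 * r + 2))) (s ^ (60 * r))
    (s ^ 3) (2 * r) (1 / s) (2 * (s : ℝ) ^ (720 * r) / k) (2 / (s : ℝ) ^ (20 * r + 2))
    (by omega) (by omega) (by positivity) hk (by positivity) ?_ (by positivity) (by positivity)
    ?_ ?_ ?_ ?_ ?_ ?_ ?_ ?_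
  · rw [div_lt_one hs0]; linarith
  · rw [div_mul_eq_mul_div, le_div_iff₀ (by linarith)]
    nlinarith [hp1 (720 * r)]
  · rw [div_mul_eq_mul_div, le_div_iff₀ (by positivity)]
    linarith
  · rw [mul_one_div, div_mul_eq_mul_div, le_div_iff₀ hs0]
    linarith
  · push_cast
    rw [div_pow, ← pow_mul, mul_comm (20 * r + 2) 2, div_mul_cancel₀ _ (by positivity)]
    norm_num
  · apply le_of_eq
    push_cast
    have : ((s : ℝ) ^ 3) ^ (2 * (240 * r)) = ((s : ℝ) ^ (720 * r)) ^ 2 := by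
      rw [← pow_mul, ← pow_mul]; congr 1; ring
    rw [this]
    field_simp
  · push_cast
    have : (s : ℝ) ^ 3 * (1 / s) ^ 2 = s := by field_simp
    rw [this]
    have : (10000 : ℝ) * (r : ℝ) ^ 2 ≤ s := by exact_mod_cast hs
    have h2 : (r : ℝ) ≤ (r : ℝ) ^ 2 := by exact_mod_cast hr2
    have h3 : (0 : ℝ) ≤ r := Nat.cast_nonneg r
    linarith
  · rw [mul_add]
    have t1 : (N : ℝ) * ((((s ^ 3 : ℕ) : ℝ) ^ (2 * (240 * r)) *
        (2 * (s : ℝ) ^ (720 * r) / k)) ^ (2 * r)) ≤ 1 / 4 := by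
      have e : (((s ^ 3 : ℕ) : ℝ) ^ (2 * (240 * r)) * (2 * (s : ℝ) ^ (720 * r) / k)) ^ (2 * r) =
          (2 * (s : ℝ) ^ (2160 * r)) ^ (2 * r) / ((k : ℝ) ^ r) ^ 2 := by
        have ek : ((k : ℝ) ^ r) ^ 2 = (k : ℝ) ^ (2 * r) := by rw [← pow_mul, mul_comm]
        have es : ((s : ℝ) ^ 3) ^ (2 * (240 * r)) * (s : ℝ) ^ (720 * r) =
            (s : ℝ) ^ (2160 * r) := by
          rw [← pow_mul, ← pow_add]; congr 1; ring
        rw [ek, ← div_pow]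
        push_cast
        congr 1
        rw [← es]; ring
      rw [e]
      have h1 : (2 * (s : ℝ) ^ (2160 * r)) ^ (2 * r) ≤ N / 4 := by
        calc (2 * (s : ℝ) ^ (2160 * r)) ^ (2 * r) ≤ ((s : ℝ) * (s : ℝ) ^ (2160 * r)) ^ (2 * r) := by
              gcongr; linarith
          _ = (s : ℝ) ^ (4320 * r ^ 2 + 2 * r) := by
              rw [← pow_succ', ← pow_mul]; congr 1; ring
          _ ≤ (s : ℝ) ^ (4320 * r ^ 2 + 2 * r + 1) / 4 := by
              rw [pow_succ _ (4320 * r ^ 2 + 2 * r)]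
              have := hp1 (4320 * r ^ 2 + 2 * r)
              nlinarith
          _ ≤ (s : ℝ) ^ (4800 * r ^ 2) / 4 := by
              have : (s : ℝ) ^ (4320 * r ^ 2 + 2 * r + 1) ≤ (s : ℝ) ^ (4800 * r ^ 2) :=
                pow_le_pow_right₀ hs1r (by omega)
              linarith
          _ ≤ N / 4 := by linarith
      have h2 : (N : ℝ) ^ 2 ≤ ((k : ℝ) ^ r) ^ 2 := pow_le_pow_left₀ hN0.le hNkr 2
      rw [mul_div_assoc', div_le_iff₀ (by positivity)]
      nlinarith
    have t2 : (N : ℝ) * (2 / (s : ℝ) ^ (20 * r + 2)) ^ (240 * r) ≤ 1 / 4 := by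
      rw [div_pow, mul_div_assoc', div_le_iff₀ (by positivity), ← pow_mul]
      have h1 : (2 : ℝ) ^ (240 * r) ≤ (s : ℝ) ^ (240 * r) :=
        pow_le_pow_left₀ (by norm_num) (by linarith) _
      calc (N : ℝ) * 2 ^ (240 * r) ≤ (s : ℝ) ^ (4800 * r ^ 2 + 1) * (s : ℝ) ^ (240 * r) := by
            gcongr
        _ = (s : ℝ) ^ (4800 * r ^ 2 + 1 + 240 * r) := by rw [← pow_add]
        _ ≤ 1 / 4 * (s : ℝ) ^ (4800 * r ^ 2 + 1 + 240 * r + 1) := by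
            rw [pow_succ _ (4800 * r ^ 2 + 1 + 240 * r)]
            have := hp1 (4800 * r ^ 2 + 1 + 240 * r)
            nlinarith
        _ ≤ 1 / 4 * (s : ℝ) ^ ((20 * r + 2) * (240 * r)) := by
            have : (s : ℝ) ^ (4800 * r ^ 2 + 1 + 240 * r + 1) ≤
                (s : ℝ) ^ ((20 * r + 2) * (240 * r)) := by
              refine pow_le_pow_right₀ hs1r ?_
              have : (20 * r + 2) * (240 * r) = 4800 * r ^ 2 + 480 * r := by ring
              omega
            linarith
    linarith
  · have t1 : (N : ℝ) ^ 2 * (1 - 1 / (4 * (((s ^ 3 : ℕ) : ℝ) ^ (2 * (2 * r)) + 1) *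
        ((s ^ (2 * (20 * r + 2)) : ℕ) : ℝ))) ^ (s ^ (60 * r)) ≤ 1 / 2 := by
      set X : ℝ := 4 * (((s ^ 3 : ℕ) : ℝ) ^ (2 * (2 * r)) + 1) *
        ((s ^ (2 * (20 * r + 2)) : ℕ) : ℝ) with hX
      have hXle : X ≤ (s : ℝ) ^ (52 * r + 5) := by
        have e1 : ((s ^ 3 : ℕ) : ℝ) ^ (2 * (2 * r)) = (s : ℝ) ^ (12 * r) := by
          push_cast; rw [← pow_mul]; congr 1; ring
        rw [hX, e1]
        have h1 : 4 * ((s : ℝ) ^ (12 * r) + 1) ≤ (s : ℝ) ^ (12 * r + 1) := by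
          rw [pow_succ]
          nlinarith [hp1 (12 * r)]
        push_cast
        calc 4 * ((s : ℝ) ^ (12 * r) + 1) * (s : ℝ) ^ (2 * (20 * r + 2))
            ≤ (s : ℝ) ^ (12 * r + 1) * (s : ℝ) ^ (2 * (20 * r + 2)) := by gcongr
          _ = _ := by rw [← pow_add]; congr 1; ring
      have hX1 : 1 ≤ X := by
        rw [hX]
        have a1 : (1 : ℝ) ≤ ((s ^ (2 * (20 * r + 2)) : ℕ) : ℝ) := by
          push_cast; exact hp1 _
        have a2 : (0 : ℝ) ≤ ((s ^ 3 : ℕ) : ℝ) ^ (2 * (2 * r)) := by positivity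
        nlinarith
      have hX0 : 0 < X := by linarith
      have b1 : (1 - 1 / X) ^ (s ^ (60 * r)) ≤ Real.exp (-(s : ℝ) ^ 3) := by
        have c1 : 1 - 1 / X ≤ Real.exp (-(1 / X)) := by
          have := Real.add_one_le_exp (-(1 / X)); linarith
        have c0 : 0 ≤ 1 - 1 / X := by
          rw [sub_nonneg, div_le_one hX0]; exact hX1
        refine (pow_le_pow_left₀ c0 c1 _).trans ?_
        rw [← Real.exp_nat_mul]
        apply Real.exp_le_exp.2
        push_cast
        rw [mul_neg, neg_le_neg_iff, mul_one_div, le_div_iff₀ hX0]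
        calc (s : ℝ) ^ 3 * X ≤ (s : ℝ) ^ 3 * (s : ℝ) ^ (52 * r + 5) := by gcongr
          _ = (s : ℝ) ^ (52 * r + 8) := by rw [← pow_add]; congr 1; ring
          _ ≤ (s : ℝ) ^ (60 * r) := pow_le_pow_right₀ hs1r (by omega)
      have b2 : (N : ℝ) ^ 2 ≤ Real.exp ((s : ℝ) * (2 * (4800 * (r : ℝ) ^ 2 + 1))) := by
        have c1 : (s : ℝ) ≤ Real.exp s := by
          have := Real.add_one_le_exp (s : ℝ); linarith
        calc (N : ℝ) ^ 2 ≤ ((s : ℝ) ^ (4800 * r ^ 2 + 1)) ^ 2 := by gcongr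
          _ = (s : ℝ) ^ (2 * (4800 * r ^ 2 + 1)) := by rw [← pow_mul]; congr 1; ring
          _ ≤ (Real.exp s) ^ (2 * (4800 * r ^ 2 + 1)) := pow_le_pow_left₀ hs0.le c1 _
          _ = _ := by rw [← Real.exp_nat_mul]; congr 1; push_cast; ring
      calc (N : ℝ) ^ 2 * (1 - 1 / X) ^ (s ^ (60 * r))
          ≤ Real.exp ((s : ℝ) * (2 * (4800 * (r : ℝ) ^ 2 + 1))) * Real.exp (-(s : ℝ) ^ 3) := by
            refine mul_le_mul b2 b1 ?_ (Real.exp_pos _).le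
            refine pow_nonneg ?_ _
            rw [sub_nonneg, div_le_one hX0]; exact hX1
        _ = Real.exp ((s : ℝ) * (2 * (4800 * (r : ℝ) ^ 2 + 1)) + -(s : ℝ) ^ 3) := by
            rw [Real.exp_add]
        _ ≤ Real.exp (-1) := by
            apply Real.exp_le_exp.2
            have h3 : (10000 : ℝ) * (r : ℝ) ^ 2 ≤ s := by exact_mod_cast hs
            have h4 : (s : ℝ) * (2 * (4800 * (r : ℝ) ^ 2 + 1)) ≤ s * (2 * s) := by
              have h5 : 2 * (4800 * (r : ℝ) ^ 2 + 1) ≤ 2 * s := by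
                have : (1 : ℝ) ≤ (r : ℝ) ^ 2 := by exact_mod_cast (by omega : 1 ≤ r ^ 2)
                linarith
              exact mul_le_mul_of_nonneg_left h5 hs0.le
            nlinarith [mul_pos hs0 hs0]
        _ ≤ 1 / 2 := by
            rw [Real.exp_neg, one_div]
            refine inv_anti₀ (by norm_num) ?_
            have := Real.add_one_le_exp (1 : ℝ); linarith
    have t2 : (((s ^ (60 * r) : ℕ)) : ℝ) ^ 3 * (4 * (1 / (s : ℝ))) ^ (240 * r) ≤ 1 / 4 := by
      push_cast
      have e : ((s : ℝ) ^ (60 * r)) ^ 3 * (4 * (1 / (s : ℝ))) ^ (240 * r) =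
          (256 / (s : ℝ)) ^ (60 * r) := by
        have : 240 * r = 4 * (60 * r) := by ring
        rw [this, pow_mul _ 4, ← pow_mul, mul_comm (60 * r) 3, pow_mul, ← mul_pow]
        congr 1
        field_simp
        norm_num
      rw [e]
      have h1 : 256 / (s : ℝ) ≤ 1 / 4 := by
        rw [div_le_iff₀ hs0]; linarith
      calc (256 / (s : ℝ)) ^ (60 * r) ≤ (256 / (s : ℝ)) ^ 1 :=
            pow_le_pow_of_le_one (by positivity) (by linarith) (by omega)
        _ ≤ 1 / 4 := by rw [pow_one]; exact h1
    linarith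

end VdW

theorem statement1 :
    ∃ C : ℝ, 0 < C ∧ ∃ r₀ : ℕ, ∀ r : ℕ, r₀ ≤ r → ∀ N : ℕ,
      Real.exp (C * (r : ℝ) ^ 4 * Real.log r) < (N : ℝ) →
      ∃ B ⊆ Finset.Icc 1 N, No3APF B ∧
        ¬ HasAPF (Finset.Icc 1 N \ B) ⌈(N : ℝ) ^ ((1 : ℝ) / r)⌉₊ := by
  refine ⟨19200, by norm_num, 100, fun r hr N hN => ?_⟩
  have hr0 : (0 : ℝ) < r := by exact_mod_cast (by omega : 0 < r)
  have hrr : (100 : ℝ) ≤ r := by exact_mod_cast hr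
  set E : ℕ := 4800 * r ^ 2 with hE
  have hr2 : r ≤ r ^ 2 := Nat.le_self_pow two_ne_zero r
  have hE0 : E ≠ 0 := by omega
  have hE0r : (0 : ℝ) < E := by exact_mod_cast Nat.pos_of_ne_zero hE0
  have hpow : (r : ℝ) ^ (19200 * r ^ 4) < N := by
    have e : Real.exp (19200 * (r : ℝ) ^ 4 * Real.log r) = (r : ℝ) ^ (19200 * r ^ 4) := by
      have : 19200 * (r : ℝ) ^ 4 * Real.log r = ((19200 * r ^ 4 : ℕ) : ℝ) * Real.log r := by
        push_cast; ring
      rw [this, Real.exp_nat_mul, Real.exp_log hr0]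
    rwa [e] at hN
  have hbig : (((10000 * r ^ 2 : ℕ) : ℝ)) ^ E ≤ N := by
    refine le_trans ?_ hpow.le
    calc (((10000 * r ^ 2 : ℕ) : ℝ)) ^ E ≤ ((r : ℝ) ^ 4) ^ E := by
          refine pow_le_pow_left₀ (Nat.cast_nonneg _) ?_ _
          push_cast
          have h1 : (10000 : ℝ) ≤ (r : ℝ) ^ 2 := by nlinarith
          have h4 : (r : ℝ) ^ 4 = (r : ℝ) ^ 2 * (r : ℝ) ^ 2 := by ring
          rw [h4]
          exact mul_le_mul_of_nonneg_right h1 (sq_nonneg (r : ℝ))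
      _ = (r : ℝ) ^ (4 * E) := by rw [← pow_mul]
      _ ≤ _ := by
          refine pow_le_pow_right₀ (by linarith) ?_
          have : r ^ 2 ≤ r ^ 4 := Nat.pow_le_pow_right (by omega) (by norm_num)
          omega
  have hN1 : (1 : ℝ) < N := by
    refine lt_of_le_of_lt ?_ hpow
    exact one_le_pow₀ (by linarith)
  have hN0 : (0 : ℝ) ≤ N := by linarith
  set s : ℕ := ⌊(N : ℝ) ^ ((1 : ℝ) / E)⌋₊ with hs
  have hroot : ((N : ℝ) ^ ((1 : ℝ) / E)) ^ E = N := by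
    rw [one_div]; exact Real.rpow_inv_natCast_pow hN0 hE0
  have hroot0 : 0 ≤ (N : ℝ) ^ ((1 : ℝ) / E) := Real.rpow_nonneg hN0 _
  have hsge : 10000 * r ^ 2 ≤ s := by
    apply Nat.le_floor
    refine le_of_pow_le_pow_left₀ hE0 hroot0 ?_
    rw [hroot]; exact hbig
  have hsl : (s : ℝ) ^ E ≤ N := by
    rw [← hroot]
    exact pow_le_pow_left₀ (Nat.cast_nonneg _) (Nat.floor_le hroot0) _
  have hs0 : (0 : ℝ) < s := by exact_mod_cast (by omega : 0 < s)
  have hsu : (N : ℝ) ≤ (s : ℝ) ^ (E + 1) := by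
    have h1 : (N : ℝ) ≤ ((s : ℝ) + 1) ^ E := by
      conv_lhs => rw [← hroot]
      exact pow_le_pow_left₀ hroot0 (Nat.lt_floor_add_one _).le _
    have h2 : ((s : ℝ) + 1) ^ E = (s : ℝ) ^ E * (1 / (s : ℝ) + 1) ^ E := by
      rw [← mul_pow]; congr 1; field_simp; ring
    have h3 : (1 / (s : ℝ) + 1) ^ E ≤ s := by
      calc (1 / (s : ℝ) + 1) ^ E ≤ (Real.exp (1 / s)) ^ E :=
            pow_le_pow_left₀ (by positivity) (Real.add_one_le_exp _) _
        _ = Real.exp (E * (1 / s)) := by rw [Real.exp_nat_mul]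
        _ ≤ Real.exp 1 := by
            apply Real.exp_le_exp.2
            rw [mul_one_div, div_le_one hs0]
            exact_mod_cast (by omega : E ≤ s)
        _ ≤ 3 := by linarith [Real.exp_one_lt_d9]
        _ ≤ s := by exact_mod_cast (by omega : 3 ≤ s)
    rw [h2] at h1
    rw [pow_succ]
    exact h1.trans (mul_le_mul_of_nonneg_left h3 (by positivity))
  apply VdW.numeric r s N _ (by omega) hsge
  · exact_mod_cast hsl
  · exact_mod_cast hsu
  · have h1 : (N : ℝ) ≤ ((⌈(N : ℝ) ^ ((1 : ℝ) / r)⌉₊ : ℕ) : ℝ) ^ r := by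
      have h2 : ((N : ℝ) ^ ((1 : ℝ) / r)) ^ r = N := by
        rw [one_div]; exact Real.rpow_inv_natCast_pow hN0 (by omega)
      conv_lhs => rw [← h2]
      exact pow_le_pow_left₀ (Real.rpow_nonneg hN0 _) (Nat.le_ceil _) _
    exact_mod_cast h1
  · have : 1 < ⌈(N : ℝ) ^ ((1 : ℝ) / r)⌉₊ := by
      rw [Nat.lt_ceil]
      push_cast
      exact Real.one_lt_rpow hN1 (by positivity)
    omega
end

section
/- There is an absolute constant C₃ > 0 such that: if r is a sufficiently large integer, D = C₃r², and 0 < ρ < 1/D, then there exist an integer M ≥ 1 and points x₁,…,x_M ∈ 𝕋^D satisfying: (1) whenever i₁,i₂,i₃ ∈ {1,…,M} are not all equal, ‖x_{i₁} − 2x_{i₂} + x_{i₃}‖_{𝕋^D} ≥ 10ρ; and (2) for every ℚ-vector subspace V ≤ ℚ^D of dimension at most 4r and every x ∈ 𝕋^D, there is some j ∈ {1,…,M} such that ‖ξ·(x_j − x)‖_𝕋 ≤ 1/100 for every ξ ∈ V ∩ ℤ^D with |ξ| ≤ ρ^{−3}. -/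
noncomputable section

/-- Well-distributed centres `x 1, …, x M` in the torus `𝕋^D`, for parameters `(D, r, ρ)`:
(1) whenever `i₁, i₂, i₃` are not all equal, `‖x i₁ - 2 • x i₂ + x i₃‖_{𝕋^D} ≥ 10ρ`;
(2) for every `ℚ`-subspace `V ≤ ℚ^D` of dimension at most `4r` and every `y ∈ 𝕋^D` there is
some `j` with `‖ξ · (x j - y)‖_𝕋 ≤ 1/100` for all `ξ ∈ V ∩ ℤ^D` with `|ξ| ≤ ρ⁻³`.
The norm on `Fin D → AddCircle 1` is the sup norm, and on `AddCircle 1` it is the distance to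
the nearest integer. -/
def Centres (r D M : ℕ) (ρ : ℝ) (x : Fin M → (Fin D → AddCircle (1 : ℝ))) : Prop :=
  (∀ i₁ i₂ i₃ : Fin M, ¬ (i₁ = i₂ ∧ i₂ = i₃) →
      10 * ρ ≤ ‖x i₁ - (2 : ℤ) • x i₂ + x i₃‖) ∧
  (∀ V : Submodule ℚ (Fin D → ℚ), Module.finrank ℚ V ≤ 4 * r →
    ∀ y : Fin D → AddCircle (1 : ℝ), ∃ j : Fin M,
      ∀ ξ : Fin D → ℤ, (fun i => (ξ i : ℚ)) ∈ V → (∀ i, (|ξ i| : ℝ) ≤ ρ⁻¹ ^ 3) →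
        ‖∑ i, ξ i • (x j i - y i)‖ ≤ 1 / 100)

open Finset


theorem choose_lem {G ι : Type*} [AddCommGroup G] [Fintype G] [DecidableEq G] [Fintype ι]
    (hd : Function.Surjective (fun g : G => (2:ℤ) • g)) (S : Finset G) (B : ι → Finset G)
    (M : ℕ) (δ : ℝ) (hB : ∀ i, δ * Fintype.card G ≤ (B i).card)
    (h : (M:ℝ)^3 * (S.card / Fintype.card G) + Fintype.card ι * (1 - δ)^M < 1) :
    ∃ f : Fin M → G, (∀ i₁ i₂ i₃, ¬ (i₁ = i₂ ∧ i₂ = i₃) → f i₁ - (2:ℤ) • f i₂ + f i₃ ∉ S) ∧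
      ∀ i, ∃ j, f j ∈ B i := by
  classical
  by_contra hcon
  push Not at hcon
  have hG : (0:ℝ) < Fintype.card G := by exact_mod_cast Fintype.card_pos
  set bad1 : Fin M × Fin M × Fin M → Finset (Fin M → G) := fun t =>
    if (t.1 = t.2.1 ∧ t.2.1 = t.2.2) then ∅ else
      univ.filter fun f => f t.1 - (2:ℤ) • f t.2.1 + f t.2.2 ∈ S with hb1
  set bad2 : ι → Finset (Fin M → G) := fun i => Fintype.piFinset fun _ => (B i)ᶜ with hb2
  have hcov : (univ : Finset (Fin M → G)) ⊆ univ.biUnion bad1 ∪ univ.biUnion bad2 := by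
    intro f _
    by_cases h1 : ∀ i₁ i₂ i₃, ¬ (i₁ = i₂ ∧ i₂ = i₃) → f i₁ - (2:ℤ) • f i₂ + f i₃ ∉ S
    · obtain ⟨i, hi⟩ := hcon f (by simpa using h1)
      refine mem_union_right _ (mem_biUnion.2 ⟨i, mem_univ _, ?_⟩)
      simp [hb2, Fintype.mem_piFinset, hi]
    · push Not at h1
      obtain ⟨a, b, c, h2, h3⟩ := h1
      refine mem_union_left _ (mem_biUnion.2 ⟨(a, b, c), mem_univ _, ?_⟩)
      have : ¬ (a = b ∧ b = c) := by simpa using h2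
      simp [hb1, this, h3]
  have hc1 : ∀ t, ((bad1 t).card : ℝ) ≤ S.card / Fintype.card G * (Fintype.card G)^M := by
    rintro ⟨a, b, c⟩
    by_cases habc : a = b ∧ b = c
    · simp only [hb1, habc, and_self, if_true, card_empty, Nat.cast_zero]; positivity
    let H : (Fin M → G) →+ G :=
      Pi.evalAddMonoidHom _ a - (2:ℤ) • Pi.evalAddMonoidHom _ b + Pi.evalAddMonoidHom _ c
    have hH : ∀ f, H f = f a - (2:ℤ) • f b + f c := fun f => rfl
    have hs : Function.Surjective H := by
      intro g
      by_cases h1 : a = b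
      · have h2 : c ≠ b := fun h => habc ⟨h1, h.symm⟩
        refine ⟨Pi.single c g, ?_⟩
        rw [hH]; subst h1; simp [h2.symm]
      by_cases h2 : b = c
      · refine ⟨Pi.single a g, ?_⟩
        rw [hH]; subst h2; simp [Ne.symm h1]
      by_cases h3 : a = c
      · obtain ⟨g', hg'⟩ := hd g
        refine ⟨Pi.single a g', ?_⟩
        rw [hH]; subst h3; simp [h2, ← hg', two_zsmul]
      · refine ⟨Pi.single a g, ?_⟩
        rw [hH]; simp [Ne.symm h1, Ne.symm h3]
    have hfib : ∀ g, (univ.filter fun f => H f = g).card = (univ.filter fun f => H f = 0).card := by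
      intro g
      exact AddMonoidHom.card_fiber_eq_of_mem_range H (hs g) (hs 0)
    have e1 : (Fintype.card G)^M = Fintype.card G * (univ.filter fun f => H f = 0).card := by
      have := card_eq_sum_card_fiberwise (s := univ) (t := univ) (f := H) (by simp)
      simp only [hfib, sum_const, card_univ, Fintype.card_fun, Fintype.card_fin] at this
      simpa using this
    have e2 : (bad1 (a, b, c)).card = S.card * (univ.filter fun f => H f = 0).card := by
      have : bad1 (a,b,c) = univ.filter fun f => H f ∈ S := by
        simp only [hb1, habc, if_false]; rfl
      rw [this]
      have := card_eq_sum_card_fiberwise (s := univ.filter fun f => H f ∈ S) (t := S) (f := H) (by intro f; simp)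
      rw [this]
      rw [sum_congr rfl (g := fun _ => (univ.filter fun f => H f = 0).card)]
      · simp
      · intro g hg
        rw [← hfib g]
        congr 1
        ext f; simp; intro h; rw [h]; exact hg
    rw [e2]
    have e1' : ((Fintype.card G:ℝ))^M = Fintype.card G * (univ.filter fun f => H f = 0).card := by
      exact_mod_cast e1
    rw [e1']; push_cast
    apply le_of_eq; field_simp
  have hc2 : ∀ i, ((bad2 i).card : ℝ) ≤ (1 - δ)^M * (Fintype.card G)^M := by
    intro i
    rw [hb2, Fintype.card_piFinset, prod_const, card_univ, Fintype.card_fin, ← mul_pow]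
    push_cast
    apply pow_le_pow_left₀ (by positivity)
    rw [card_compl, Nat.cast_sub (card_le_univ _)]
    linarith [hB i]
  have := card_le_card hcov
  rw [card_univ, Fintype.card_fun, Fintype.card_fin] at this
  have h2 : ((Fintype.card G : ℝ))^M ≤ ∑ t, ((bad1 t).card:ℝ) + ∑ i, ((bad2 i).card : ℝ) := by
    exact_mod_cast this.trans ((card_union_le _ _).trans (add_le_add card_biUnion_le card_biUnion_le))
  have h3 := add_le_add (sum_le_sum fun t (_ : t ∈ univ) => hc1 t) (sum_le_sum fun t (_ : t ∈ univ) => hc2 t)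
  simp only [sum_const, card_univ, Fintype.card_prod, Fintype.card_fin, nsmul_eq_mul] at h3
  push_cast at h3
  have h4 : (0:ℝ) < (Fintype.card G : ℝ)^M := by positivity
  nlinarith [h2.trans h3]


theorem circ_norm_le (x : ℝ) : ‖(x : AddCircle (1:ℝ))‖ ≤ |x| := by
  rw [UnitAddCircle.norm_eq]
  simpa using round_le x 0

theorem circ_count (q : ℕ) [NeZero q] (t : ℝ) (ht : 0 ≤ t) :
    ((univ.filter fun a : ZMod q => ‖ZMod.toAddCircle a‖ < t).card : ℝ) ≤ 2 * t * q + 1 := by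
  classical
  have hq : (0:ℝ) < q := by exact_mod_cast NeZero.pos q
  have hsub : (univ.filter fun a : ZMod q => ‖ZMod.toAddCircle a‖ < t) ⊆
      (Icc (-⌊t*q⌋) ⌊t*q⌋).image (fun k : ℤ => (k : ZMod q)) := by
    intro a ha
    rw [mem_filter, ZMod.toAddCircle_apply, UnitAddCircle.norm_eq] at ha
    set n := round ((a.val:ℝ) / q)
    have h1 := abs_lt.1 ha.2
    have e : (a.val:ℝ) / q - n = (((a.val:ℤ) - n * q : ℤ):ℝ) / q := by
      push_cast; field_simp
    rw [e, lt_div_iff₀ hq, div_lt_iff₀ hq] at h1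
    refine mem_image.2 ⟨(a.val:ℤ) - n * q, mem_Icc.2 ⟨?_, ?_⟩, ?_⟩
    · rw [neg_le]; apply Int.le_floor.2; push_cast at h1 ⊢; linarith
    · apply Int.le_floor.2; linarith
    · simp
  have h0 : 0 ≤ ⌊t*q⌋ := Int.floor_nonneg.2 (by positivity)
  have h2 := (card_le_card hsub).trans card_image_le
  rw [Int.card_Icc] at h2
  have h3 : ((univ.filter fun a : ZMod q => ‖ZMod.toAddCircle a‖ < t).card : ℤ) ≤ 2 * ⌊t*q⌋ + 1 := by
    omega
  have h4 : ((univ.filter fun a : ZMod q => ‖ZMod.toAddCircle a‖ < t).card : ℝ) ≤ 2 * ⌊t*q⌋ + 1 := by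
    exact_mod_cast h3
  linarith [Int.floor_le (t*q)]

theorem circ_approx (q : ℕ) [NeZero q] (y : AddCircle (1:ℝ)) :
    ∃ a : ZMod q, ‖ZMod.toAddCircle a - y‖ ≤ 1 / q := by
  have hq : (0:ℝ) < q := by exact_mod_cast NeZero.pos q
  induction y using QuotientAddGroup.induction_on with
  | H y =>
    refine ⟨(⌊y * q⌋ : ℤ), ?_⟩
    rw [ZMod.toAddCircle_intCast]
    change ‖((((⌊y*q⌋:ℤ) / q - y : ℝ)) : AddCircle (1:ℝ))‖ ≤ _
    refine (circ_norm_le _).trans ?_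
    have e : ((⌊y*q⌋:ℤ) / q - y : ℝ) = (⌊y*q⌋ - y * q) / q := by field_simp
    rw [e, abs_div, abs_of_pos hq]
    gcongr
    rw [abs_le]; constructor <;> linarith [Int.floor_le (y*q), Int.lt_floor_add_one (y*q)]

theorem circ_cell (q K : ℕ) [NeZero q] (hK : 0 < K) (a b : ZMod q)
    (h : a.val * K / q = b.val * K / q) : ‖ZMod.toAddCircle (a - b)‖ ≤ 1 / K := by
  have hq0 := NeZero.pos q
  have hq : (0:ℝ) < q := by exact_mod_cast hq0
  rw [map_sub, ZMod.toAddCircle_apply, ZMod.toAddCircle_apply, ← AddCircle.coe_sub]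
  refine (circ_norm_le _).trans ?_
  have h1 := Nat.div_mul_le_self (a.val * K) q
  have h2 := Nat.div_mul_le_self (b.val * K) q
  have h3 := Nat.lt_div_mul_add (a := a.val * K) hq0
  have h4 := Nat.lt_div_mul_add (a := b.val * K) hq0
  rw [h] at h1 h3
  set c := b.val * K / q * q
  have hK' : (0:ℝ) < K := by exact_mod_cast hK
  have h1' : (c:ℝ) ≤ a.val * K := by exact_mod_cast h1
  have h2' : (c:ℝ) ≤ b.val * K := by exact_mod_cast h2
  have h3' : (a.val * K : ℝ) < c + q := by exact_mod_cast h3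
  have h4' : (b.val * K : ℝ) < c + q := by exact_mod_cast h4
  rw [← sub_div, abs_div, abs_of_pos hq, div_le_div_iff₀ hq hK', ← abs_of_pos hK', ← abs_mul,
    abs_le]
  constructor <;> nlinarith

theorem bohr_size {q : ℕ} [NeZero q] {D m : ℕ} (K : ℕ) (hK : 0 < K) (t : Fin m → Fin D → ZMod q) :
    Fintype.card (Fin D → ZMod q) ≤ K ^ m * (univ.filter fun x : Fin D → ZMod q =>
      ∀ i, ‖ZMod.toAddCircle (∑ l, t i l * x l)‖ ≤ 1 / K).card := by
  classical
  have hq0 := NeZero.pos q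
  let cell : (Fin D → ZMod q) → (Fin m → Fin K) := fun x i =>
    ⟨(∑ l, t i l * x l).val * K / q, by
      apply Nat.div_lt_of_lt_mul
      exact Nat.mul_lt_mul_of_pos_right (ZMod.val_lt _) hK⟩
  have hc := card_eq_sum_card_fiberwise (s := (univ : Finset (Fin D → ZMod q)))
    (t := univ) (f := cell) (by simp)
  rw [← card_univ, hc]
  refine (sum_le_card_nsmul _ _ (univ.filter fun x : Fin D → ZMod q =>
      ∀ i, ‖ZMod.toAddCircle (∑ l, t i l * x l)‖ ≤ 1 / K).card ?_).trans (by simp)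
  intro c _
  rcases (univ.filter fun x => cell x = c).eq_empty_or_nonempty with h | ⟨x₀, hx₀⟩
  · simp [h]
  refine card_le_card_of_injOn (fun x => x - x₀) ?_ (fun a _ b _ h => sub_left_injective h)
  intro x hx
  simp only [mem_filter, mem_univ, true_and, coe_filter, Set.mem_ofPred_eq] at hx hx₀ ⊢
  intro i
  have e : ∑ l, t i l * (x - x₀) l = ∑ l, t i l * x l - ∑ l, t i l * x₀ l := by
    simp [mul_sub]
  rw [e]
  apply circ_cell _ _ hK
  have := congrFun (hx.trans hx₀.symm) i
  simpa [cell] using this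


theorem gram_lem {D k : ℕ} (X : Fin k → Fin D → ℤ) (R : ℤ) (hR : ∀ i l, |X i l| ≤ R)
    (hli : LinearIndependent ℚ (fun i l => (X i l : ℚ))) :
    ∃ d : ℤ, d ≠ 0 ∧ |d| ≤ (k.factorial : ℤ) * (D * R^2)^k ∧
      ∀ ξ : Fin D → ℤ, (∀ l, |ξ l| ≤ R) →
        (fun l => (ξ l : ℚ)) ∈ Submodule.span ℚ (Set.range (fun i l => (X i l : ℚ))) →
        ∃ n : Fin k → ℤ, (∀ i, |n i| ≤ (k.factorial : ℤ) * (D * R^2)^k) ∧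
          ∀ l, d * ξ l = ∑ i, n i * X i l := by
  set Y : Matrix (Fin D) (Fin k) ℤ := Matrix.of fun l i => X i l with hY
  set g : Matrix (Fin k) (Fin k) ℤ := Y.transpose * Y with hg
  have hinner : ∀ u v : Fin D → ℤ, (∀ l, |u l| ≤ R) → (∀ l, |v l| ≤ R) →
      |∑ l, u l * v l| ≤ D * R^2 := by
    intro u v hu hv
    refine (abs_sum_le_sum_abs _ _).trans ?_
    refine (sum_le_card_nsmul _ _ (R^2) ?_).trans (by simp)
    intro l _
    rw [abs_mul, sq]
    exact mul_le_mul (hu l) (hv l) (abs_nonneg _) ((abs_nonneg _).trans (hu l))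
  have hgb : ∀ i j, |g i j| ≤ D * R^2 := by
    intro i j
    rw [hg, Matrix.mul_apply]
    exact hinner _ _ (hR i) (hR j)
  set YQ : Matrix (Fin D) (Fin k) ℚ := Y.map (Int.castRingHom ℚ) with hYQ
  have hgQ : g.map (Int.castRingHom ℚ) = YQ.transpose * YQ := by
    rw [hg, Matrix.map_mul]; rfl
  have hYv : ∀ v : Fin k → ℚ, YQ.mulVec v = ∑ i, v i • (fun l => (X i l : ℚ)) := by
    intro v; ext l
    simp [Matrix.mulVec, dotProduct, hYQ, hY, mul_comm]
  have hdet : g.det ≠ 0 := by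
    intro h
    have h' : (g.map (Int.castRingHom ℚ)).det = 0 := by
      have := RingHom.map_det (Int.castRingHom ℚ) g
      rw [h] at this; simpa using this.symm
    rw [hgQ] at h'
    obtain ⟨v, hv0, hv⟩ := Matrix.exists_mulVec_eq_zero_iff.2 h'
    have h1 : v ∈ LinearMap.ker (YQ.transpose * YQ).mulVecLin := LinearMap.mem_ker.2 hv
    rw [Matrix.ker_mulVecLin_transpose_mul_self] at h1
    have h2 : YQ.mulVec v = 0 := by simpa using h1
    rw [hYv] at h2
    exact hv0 (funext fun i => Fintype.linearIndependent_iff.1 hli v h2 i)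
  have hdb : ∀ A : Matrix (Fin k) (Fin k) ℤ, (∀ i j, |A i j| ≤ D * R^2) →
      |A.det| ≤ (k.factorial : ℤ) * (D * R^2)^k := by
    intro A hA
    have := Matrix.det_le (A := A) (abv := AbsoluteValue.abs) (x := D * R^2) hA
    simpa using this
  refine ⟨g.det, hdet, hdb g hgb, ?_⟩
  intro ξ hξ hmem
  set b : Fin k → ℤ := Y.transpose.mulVec ξ with hb
  have hbb : ∀ i, |b i| ≤ D * R^2 := fun i => hinner _ _ (hR i) hξ
  refine ⟨g.cramer b, ?_, ?_⟩
  · intro i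
    rw [Matrix.cramer_apply]
    apply hdb
    intro a c
    rw [Matrix.updateCol_apply]
    split_ifs
    · exact hbb a
    · exact hgb a c
  · obtain ⟨c, hc⟩ := (Submodule.mem_span_range_iff_exists_fun ℚ).1 hmem
    rw [← hYv] at hc
    have hbc : (fun i => (b i : ℚ)) = (g.map (Int.castRingHom ℚ)).mulVec c := by
      rw [hgQ, ← Matrix.mulVec_mulVec, hc]
      ext i
      simp [hb, Matrix.mulVec, dotProduct, hYQ]
    have hcr : (fun i => ((g.cramer b i : ℤ) : ℚ)) = (g.det : ℚ) • c := by
      have h1 : (fun i => ((g.cramer b i : ℤ) : ℚ)) =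
          (g.map (Int.castRingHom ℚ)).cramer (fun i => (b i : ℚ)) := by
        ext i
        rw [Matrix.cramer_apply, Matrix.cramer_apply]
        have := RingHom.map_det (Int.castRingHom ℚ) (g.updateCol i b)
        simp only [eq_intCast] at this
        rw [this]
        congr 1
        ext a c
        simp only [RingHom.mapMatrix_apply, Matrix.map_apply, Matrix.updateCol_apply]
        split_ifs <;> simp
      rw [h1, hbc, Matrix.cramer_eq_adjugate_mulVec, Matrix.mulVec_mulVec, Matrix.adjugate_mul,
        Matrix.smul_mulVec, Matrix.one_mulVec]
      congr 1
      have := RingHom.map_det (Int.castRingHom ℚ) g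
      simpa using this.symm
    intro l
    have h2 := congrFun hc l
    rw [hYv] at h2
    have h3 : ((g.det * ξ l : ℤ) : ℚ) = ((∑ i, g.cramer b i * X i l : ℤ) : ℚ) := by
      rw [Int.cast_mul, Int.cast_sum]
      simp only [Int.cast_mul]
      rw [← h2]
      simp only [Finset.sum_apply, Pi.smul_apply, smul_eq_mul, mul_sum]
      refine sum_congr rfl fun i _ => ?_
      have := congrFun hcr i
      simp only [Pi.smul_apply, smul_eq_mul] at this
      rw [this]; ring
    exact_mod_cast h3

theorem lattice_lem {D m : ℕ} (hm : 1 ≤ m) (hD : 1 ≤ D) (R : ℕ) (hR : 1 ≤ R)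
    (V : Submodule ℚ (Fin D → ℚ)) (hV : Module.finrank ℚ V ≤ m) :
    ∃ (d : ℤ) (X : Fin m → Fin D → ℤ), d ≠ 0 ∧ |d| ≤ ((m * D * R^2)^m : ℕ) ∧
      ∀ ξ : Fin D → ℤ, (∀ l, |ξ l| ≤ R) → (fun l => (ξ l : ℚ)) ∈ V →
        ∃ n : Fin m → ℤ, (∀ i, |n i| ≤ ((m * D * R^2)^m : ℕ)) ∧
          ∀ l, d * ξ l = ∑ i, n i * X i l := by
  set s : Set (Fin D → ℚ) := {v | v ∈ V ∧ ∃ ξ : Fin D → ℤ, (∀ l, |ξ l| ≤ R) ∧ v = fun l => (ξ l : ℚ)}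
  obtain ⟨f, hf1, hf2, hf3⟩ := Submodule.exists_fun_fin_finrank_span_eq ℚ s
  have hk : Module.finrank ℚ (Submodule.span ℚ s) ≤ m := by
    refine (Submodule.finrank_mono ?_).trans hV
    exact Submodule.span_le.2 fun v hv => hv.1
  generalize Module.finrank ℚ (Submodule.span ℚ s) = k at *
  choose hfV X hX hfX using hf1
  have hfe : f = fun i l => (X i l : ℚ) := funext hfX
  rw [hfe] at hf2 hf3
  obtain ⟨d, hd0, hd, hmain⟩ := gram_lem X R hX hf3
  have hbound : (k.factorial : ℤ) * (D * (R:ℤ)^2)^k ≤ ((m * D * R^2)^m : ℕ) := by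
    have h1 : k.factorial * (D * R^2)^k ≤ (m * D * R^2)^m := by
      calc k.factorial * (D * R^2)^k ≤ k^k * (D * R^2)^k := by gcongr; exact Nat.factorial_le_pow k
        _ = (k * (D*R^2))^k := (mul_pow _ _ _).symm
        _ ≤ (m * (D*R^2))^k := by gcongr
        _ ≤ (m * (D*R^2))^m := Nat.pow_le_pow_right (by positivity) hk
        _ = _ := by rw [mul_assoc]
    exact_mod_cast h1
  obtain ⟨e, rfl⟩ := Nat.exists_eq_add_of_le hk
  refine ⟨d, Fin.append X 0, hd0, hd.trans hbound, fun ξ hξ hmem => ?_⟩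
  obtain ⟨n, hn, hn2⟩ := hmain ξ hξ (by rw [hf2]; exact Submodule.subset_span ⟨hmem, ξ, hξ, rfl⟩)
  refine ⟨Fin.append n 0, fun i => ?_, fun l => ?_⟩
  · refine Fin.addCases (fun i => ?_) (fun i => ?_) i
    · rw [Fin.append_left]; exact (hn i).trans hbound
    · rw [Fin.append_right]; simp; positivity
  · rw [Fin.sum_univ_add]; simp [hn2]


theorem num1 (r m D p M : ℕ) (ρ : ℝ) (s G : ℝ) (hr : 1 ≤ r) (hm : m = 4 * r)
    (hD : D = 2000 * r^2) (hρ : 0 < ρ) (hp : D < p) (hp2 : ρ ≤ 2 / p)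
    (hM : M = (p^(8*m+2))^m * p^5) (h : s / G ≤ (21 * ρ)^D) :
    (M:ℝ)^3 * (s / G) ≤ 1/4 := by
  have hr2 : 1 ≤ r^2 := Nat.one_le_pow _ _ hr
  have hp1 : (2000:ℝ) ≤ p := by exact_mod_cast (show 2000 ≤ p by omega)
  have hp0 : (0:ℝ) < p := by linarith
  have h1 : (21 * ρ)^D ≤ (1 / p : ℝ)^(1000*r^2) := by
    have e : D = 2 * (1000 * r^2) := by omega
    rw [e, pow_mul]
    apply pow_le_pow_left₀ (by positivity)
    calc (21*ρ)^2 ≤ (21 * (2/(p:ℝ)))^2 := by gcongr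
      _ ≤ 1 / (p:ℝ) := by
        have : (21 * (2/(p:ℝ)))^2 = (1764 / p) * (1 / p) := by ring
        rw [this]
        have : (1764:ℝ) / p ≤ 1 := by rw [div_le_one hp0]; linarith
        have h2 : (0:ℝ) < 1 / p := by positivity
        nlinarith
  have h2 : (M:ℝ)^3 = (p:ℝ)^(((8*m+2)*m+5)*3) := by
    rw [hM]; push_cast; rw [← pow_mul, ← pow_add, ← pow_mul]
  have h3 : ((8*m+2)*m+5)*3 + 1 ≤ 1000 * r^2 := by
    subst hm; nlinarith
  obtain ⟨e, he⟩ := Nat.exists_eq_add_of_le h3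
  calc (M:ℝ)^3 * (s/G) ≤ (p:ℝ)^(((8*m+2)*m+5)*3) * (1 / p : ℝ)^(1000*r^2) := by
        rw [h2]; gcongr; exact h.trans h1
    _ = (1/(p:ℝ)) * (1/(p:ℝ))^e := by
        rw [he, pow_add, pow_add, pow_one, ← mul_assoc, ← mul_assoc, ← mul_pow, mul_one_div_cancel hp0.ne',
          one_pow, one_mul]
    _ ≤ (1/(p:ℝ)) * 1 := by
        gcongr
        apply pow_le_one₀ (by positivity)
        rw [div_le_one hp0]; linarith
    _ ≤ 1/4 := by
        rw [mul_one]
        exact one_div_le_one_div_of_le (by norm_num) (by linarith)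

theorem num2 (r m D p q n : ℕ) (hr : 1 ≤ r) (hm : m = 4 * r) (hn : 1 ≤ n)
    (hD : D = 2000 * r^2) (hp : D < p) (hq : q ≤ 2 * p^(8*m+6)) :
    (((q^D)^m * q^D : ℕ) : ℝ) * (1 - 1 / (n:ℝ))^(n * p^5) ≤ 1/4 := by
  have hr2 : 1 ≤ r^2 := Nat.one_le_pow _ _ hr
  have hrr : r ≤ r^2 := by nlinarith
  have hn' : (1:ℝ) ≤ n := by exact_mod_cast hn
  have h1 : (1 - 1 / (n:ℝ))^n ≤ 1/2 :=
    (Real.one_sub_div_pow_le_exp_neg hn').trans Real.exp_neg_one_lt_half.le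
  have h0 : (0:ℝ) ≤ 1 - 1 / (n:ℝ) := by
    rw [sub_nonneg, div_le_one (by linarith)]; exact hn'
  have h2 : (1 - 1 / (n:ℝ))^(n * p^5) ≤ (1/2)^(p^5) := by
    rw [pow_mul]; exact pow_le_pow_left₀ (by positivity) h1 _
  have hq2 : q ≤ p^(8*m+7) := by
    calc q ≤ 2 * p^(8*m+6) := hq
      _ ≤ p * p^(8*m+6) := by gcongr; omega
      _ = _ := by ring
  have h3 : (q^D)^m * q^D ≤ 2^(p^4) := by
    calc (q^D)^m * q^D = q^(D*(m+1)) := by ring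
      _ ≤ (p^(8*m+7))^(D*(m+1)) := by gcongr
      _ = p^((8*m+7)*(D*(m+1))) := by rw [← pow_mul]
      _ ≤ (2^p)^((8*m+7)*(D*(m+1))) := by gcongr; exact Nat.lt_two_pow_self.le
      _ = 2^(p*((8*m+7)*(D*(m+1)))) := by rw [← pow_mul]
      _ ≤ 2^(p*(p*(p*p))) := by
        gcongr
        · norm_num
        · omega
        · omega
      _ = _ := by ring_nf
  have h4 : p^4 + 2 ≤ p^5 := by
    have : 2 ≤ p := by omega
    have h16 : 1 ≤ p^4 := Nat.one_le_pow _ _ (by omega)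
    have : p^5 = p^4 * p := by ring
    have : 2000 ≤ p := by omega
    nlinarith
  obtain ⟨e, he⟩ := Nat.exists_eq_add_of_le h4
  calc (((q^D)^m * q^D : ℕ) : ℝ) * (1 - 1 / (n:ℝ))^(n * p^5)
      ≤ ((2^(p^4) : ℕ):ℝ) * (1/2)^(p^5) := by
        apply mul_le_mul (by exact_mod_cast h3) h2 (by positivity) (by positivity)
    _ = 1/4 * (1/2)^e := by
        rw [he, pow_add, pow_add]; push_cast
        rw [← mul_assoc, ← mul_assoc, ← mul_pow]; norm_num
    _ ≤ 1/4 * 1 := by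
        gcongr
        exact pow_le_one₀ (by norm_num) (by norm_num)
    _ = 1/4 := by norm_num

theorem zsmul_norm_le' (n : ℤ) (x : AddCircle (1:ℝ)) : ‖n • x‖ ≤ |(n:ℝ)| * ‖x‖ := by
  have := norm_zsmul_le (n := n) (a := x)
  simpa [Int.norm_eq_abs] using this

theorem statement2 :
    ∃ C₃ : ℕ, 0 < C₃ ∧ ∃ r₀ : ℕ, ∀ r : ℕ, r₀ ≤ r → ∀ D : ℕ, D = C₃ * r ^ 2 →
      ∀ ρ : ℝ, 0 < ρ → ρ < 1 / (D : ℝ) →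
        ∃ M : ℕ, 1 ≤ M ∧ ∃ x : Fin M → (Fin D → AddCircle (1 : ℝ)), Centres r D M ρ x := by
  classical
  refine ⟨2000, by norm_num, 1, ?_⟩
  intro r hr D hD ρ hρ hρD
  have hr2 : 1 ≤ r^2 := Nat.one_le_pow _ _ hr
  have hrr : r ≤ r^2 := by nlinarith
  have hDR : (0:ℝ) < D := by exact_mod_cast (show 0 < D by omega)
  obtain ⟨m, hm⟩ : ∃ m, m = 4 * r := ⟨_, rfl⟩
  obtain ⟨p, hpdef⟩ : ∃ p, p = ⌈ρ⁻¹⌉₊ := ⟨_, rfl⟩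
  have hinv : (D:ℝ) < ρ⁻¹ := by
    rw [lt_inv_comm₀ hDR hρ, inv_eq_one_div]; exact hρD
  have hle : ρ⁻¹ ≤ p := by rw [hpdef]; exact Nat.le_ceil _
  have hp : D < p := by exact_mod_cast hinv.trans_le hle
  have hp2000 : 2000 ≤ p := by omega
  have hpR : (2000:ℝ) ≤ p := by exact_mod_cast hp2000
  have hp2 : ρ ≤ 2 / p := by
    have h1 : (p:ℝ) < ρ⁻¹ + 1 := by rw [hpdef]; exact Nat.ceil_lt_add_one (by positivity)
    have h2 : ρ * ρ⁻¹ = 1 := mul_inv_cancel₀ hρ.ne'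
    rw [le_div_iff₀ (by linarith)]
    have h3 : (1:ℝ) ≤ D := by exact_mod_cast (show 1 ≤ D by omega)
    nlinarith
  obtain ⟨q, hqp, hq1, hq2⟩ := Nat.exists_prime_lt_and_le_two_mul (p^(8*m+6)) (by positivity)
  have : Fact q.Prime := ⟨hqp⟩
  have hpq : p < q := lt_of_le_of_lt (Nat.le_self_pow (by omega) p) hq1
  have hqR : (0:ℝ) < q := by exact_mod_cast hqp.pos
  have hρq : 1 ≤ ρ * q := by
    have : (p:ℝ) ≤ q := by exact_mod_cast hpq.le
    calc 1 = ρ * ρ⁻¹ := (mul_inv_cancel₀ hρ.ne').symm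
      _ ≤ ρ * q := by gcongr; linarith
  obtain ⟨K, hK⟩ : ∃ K, K = p^(8*m+2) := ⟨_, rfl⟩
  have hK0 : 0 < K := by rw [hK]; positivity
  obtain ⟨M, hM⟩ : ∃ M, M = K^m * p^5 := ⟨_, rfl⟩
  have hM1 : 1 ≤ M := by rw [hM]; exact Nat.succ_le_of_lt (by positivity)
  have h2 : (2 : ZMod q) ≠ 0 := by
    intro h
    have : ((2:ℕ) : ZMod q) = 0 := by exact_mod_cast h
    rw [ZMod.natCast_eq_zero_iff] at this
    have := Nat.le_of_dvd (by norm_num) this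
    omega
  set S1 : Finset (ZMod q) := univ.filter fun a : ZMod q => ‖ZMod.toAddCircle a‖ < 10 * ρ with hS1
  have hS1c : (S1.card : ℝ) ≤ 21 * ρ * q := by
    have := circ_count q (10 * ρ) (by positivity)
    linarith
  set S : Finset (Fin D → ZMod q) := Fintype.piFinset fun _ => S1 with hS
  set B : ((Fin m → Fin D → ZMod q) × (Fin D → ZMod q)) → Finset (Fin D → ZMod q) := fun t =>
    univ.filter fun x => ∀ i, ‖ZMod.toAddCircle (∑ l, t.1 i l * (x l - t.2 l))‖ ≤ 1 / K with hBdef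
  have hGc : Fintype.card (Fin D → ZMod q) = q^D := by simp [ZMod.card]
  have hSG : (S.card : ℝ) / Fintype.card (Fin D → ZMod q) ≤ (21 * ρ)^D := by
    rw [hGc, hS, Fintype.card_piFinset, prod_const, card_univ, Fintype.card_fin]
    push_cast
    rw [div_le_iff₀ (by positivity), ← mul_pow]
    exact pow_le_pow_left₀ (by positivity) hS1c _
  have hB : ∀ t, (1 / ((K^m : ℕ) : ℝ)) * Fintype.card (Fin D → ZMod q) ≤ (B t).card := by
    rintro ⟨t, y⟩
    have h1 := bohr_size K hK0 t
    have h3 : (univ.filter fun x : Fin D → ZMod q =>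
      ∀ i, ‖ZMod.toAddCircle (∑ l, t i l * x l)‖ ≤ 1 / K).card ≤ (B (t, y)).card := by
      refine card_le_card_of_injOn (fun x => x + y) ?_ (fun a _ b _ h => add_left_injective y h)
      intro x hx
      simpa [hBdef] using hx
    have h4 : ((Fintype.card (Fin D → ZMod q) : ℕ):ℝ) ≤ ((K^m : ℕ):ℝ) * (B (t,y)).card := by
      exact_mod_cast h1.trans (Nat.mul_le_mul_left _ h3)
    rw [div_mul_eq_mul_div, one_mul, div_le_iff₀ (by positivity)]
    linarith
  obtain ⟨f, hf1, hf2⟩ := choose_lem (G := Fin D → ZMod q) (by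
      intro g
      refine ⟨fun l => 2⁻¹ * g l, ?_⟩
      ext l
      simp only [Pi.smul_apply, zsmul_eq_mul]
      push_cast
      rw [← mul_assoc, mul_inv_cancel₀ h2, one_mul]) S B M (1 / ((K^m : ℕ) : ℝ)) hB (by
    have e1 := num1 r m D p M ρ _ _ hr hm hD hρ hp hp2 (by rw [hM, hK]) hSG
    have e2 := num2 r m D p q (K^m) hr hm (Nat.succ_le_of_lt (by positivity)) hD hp hq2
    have e3 : Fintype.card ((Fin m → Fin D → ZMod q) × (Fin D → ZMod q)) = (q^D)^m * q^D := by
      simp [ZMod.card]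
    rw [← hM, ← e3] at e2
    linarith)
  refine ⟨M, hM1, fun j l => ZMod.toAddCircle (f j l), ?_, ?_⟩
  · intro i₁ i₂ i₃ hne
    by_contra hlt
    push Not at hlt
    rw [pi_norm_lt_iff (by positivity)] at hlt
    refine hf1 i₁ i₂ i₃ hne ?_
    rw [hS, Fintype.mem_piFinset]
    intro l
    rw [hS1, mem_filter]
    refine ⟨mem_univ _, ?_⟩
    have := hlt l
    simpa only [Pi.add_apply, Pi.sub_apply, Pi.smul_apply, map_add, map_sub, map_zsmul] using this
  · intro V hV y
    choose a ha using fun l => circ_approx q (y l)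
    obtain ⟨d, X, hd0, hdb, hmain⟩ := lattice_lem (m := m) (by omega) (show 1 ≤ D by omega) (p^3)
      (Nat.one_le_pow _ _ (by omega)) V (by rw [hm]; exact hV)
    have hA : (m * D * (p^3)^2)^m ≤ p^(8*m) := by
      rw [pow_mul]
      apply Nat.pow_le_pow_left
      calc m * D * (p^3)^2 ≤ p * p * (p^3)^2 := by gcongr; omega
        _ = p^8 := by ring
    have hdq : (d : ZMod q) ≠ 0 := by
      intro h
      rw [ZMod.intCast_zmod_eq_zero_iff_dvd] at h
      have h1 := Int.le_of_dvd (abs_pos.2 hd0) ((dvd_abs _ _).2 h)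
      have h3 : p^(8*m) ≤ p^(8*m+6) := Nat.pow_le_pow_right (by omega) (by omega)
      have h4 : (q:ℤ) ≤ ((p^(8*m+6) : ℕ) : ℤ) :=
        h1.trans (hdb.trans (by exact_mod_cast hA.trans h3))
      have : q ≤ p^(8*m+6) := by exact_mod_cast h4
      omega
    obtain ⟨j, hj⟩ := hf2 (fun i l => (d : ZMod q)⁻¹ * (X i l : ZMod q), a)
    simp only [hBdef, mem_filter, mem_univ, true_and] at hj
    refine ⟨j, fun ξ hξV hξ => ?_⟩
    have hξp : ∀ l, |ξ l| ≤ ((p^3 : ℕ) : ℤ) := by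
      intro l
      have h1 : (|ξ l| : ℝ) ≤ ((p^3 : ℕ) : ℝ) := by
        push_cast
        exact (hξ l).trans (pow_le_pow_left₀ (by positivity) hle 3)
      exact_mod_cast h1
    obtain ⟨n, hn, hn2⟩ := hmain ξ hξp hξV
    have hsplit : ∑ l, ξ l • (ZMod.toAddCircle (f j l) - y l) =
        ∑ i, n i • ZMod.toAddCircle (∑ l, (d : ZMod q)⁻¹ * (X i l : ZMod q) * (f j l - a l)) +
        ∑ l, ξ l • (ZMod.toAddCircle (a l) - y l) := by
      have e1 : ∑ i, n i • ZMod.toAddCircle (∑ l, (d : ZMod q)⁻¹ * (X i l : ZMod q) * (f j l - a l))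
          = ∑ l, ξ l • (ZMod.toAddCircle (f j l) - ZMod.toAddCircle (a l)) := by
        simp only [← map_sub, ← map_zsmul, ← map_sum]
        congr 1
        simp only [zsmul_eq_mul, mul_sum]
        rw [sum_comm]
        refine sum_congr rfl fun l _ => ?_
        have h3 : (d : ZMod q) * ξ l = ∑ i, (n i : ZMod q) * X i l := by
          exact_mod_cast congrArg (Int.cast : ℤ → ZMod q) (hn2 l)
        have h4 : (ξ l : ZMod q) = (d : ZMod q)⁻¹ * ∑ i, (n i : ZMod q) * X i l := by
          rw [← h3, ← mul_assoc, inv_mul_cancel₀ hdq, one_mul]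
        rw [h4, mul_sum, sum_mul]
        refine sum_congr rfl fun i _ => ?_
        ring
      rw [e1, ← sum_add_distrib]
      refine sum_congr rfl fun l _ => ?_
      rw [← smul_add]; congr 1; abel
    change ‖∑ l, ξ l • (ZMod.toAddCircle (f j l) - y l)‖ ≤ 1 / 100
    rw [hsplit]
    have hp0 : (0:ℝ) < p := by linarith
    have b1 : ‖∑ i, n i • ZMod.toAddCircle (∑ l, (d : ZMod q)⁻¹ * (X i l : ZMod q) * (f j l - a l))‖
        ≤ 1 / 200 := by
      calc _ ≤ ∑ i : Fin m, (p:ℝ)^(8*m) * (1 / K) := by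
            refine norm_sum_le_of_le _ fun i _ => (zsmul_norm_le' _ _).trans ?_
            have h3 : |(n i : ℝ)| ≤ (p:ℝ)^(8*m) := by
              have : |n i| ≤ ((p^(8*m) : ℕ) : ℤ) := (hn i).trans (by exact_mod_cast hA)
              exact_mod_cast this
            exact mul_le_mul h3 (hj i) (norm_nonneg _) (by positivity)
        _ = (m:ℝ) / p * (1 / p) := by
            rw [sum_const, card_univ, Fintype.card_fin, nsmul_eq_mul, hK, pow_add]
            push_cast
            field_simp
        _ ≤ 1 * (1/200) := by
            gcongr
            · rw [div_le_one hp0]; exact_mod_cast (show m ≤ p by omega)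
            · linarith
        _ = _ := one_mul _
    have b2 : ‖∑ l, ξ l • (ZMod.toAddCircle (a l) - y l)‖ ≤ 1 / 200 := by
      calc _ ≤ ∑ l : Fin D, (p:ℝ)^3 * (1 / q) := by
            refine norm_sum_le_of_le _ fun l _ => (zsmul_norm_le' _ _).trans ?_
            have h3 : |(ξ l : ℝ)| ≤ (p:ℝ)^3 := by exact_mod_cast hξp l
            exact mul_le_mul h3 (ha l) (norm_nonneg _) (by positivity)
        _ = (D:ℝ) * (p:ℝ)^3 / (q:ℝ) := by
            rw [sum_const, card_univ, Fintype.card_fin, nsmul_eq_mul]; ring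
        _ ≤ (p:ℝ) * (p:ℝ)^3 / (p:ℝ)^5 := by
            have h5 : (p:ℝ)^5 ≤ q := by
              have : p^5 ≤ p^(8*m+6) := Nat.pow_le_pow_right (by omega) (by omega)
              exact_mod_cast this.trans hq1.le
            gcongr
        _ = 1 / (p:ℝ) := by field_simp
        _ ≤ 1 / 200 := by gcongr; linarith
    calc _ ≤ _ := norm_add_le _ _
      _ ≤ 1/200 + 1/200 := add_le_add b1 b2
      _ = 1/100 := by norm_num

end
end
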